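/- Let M be a topological surface (a Hausdorff topological space in which every point has an open neighbourhood homeomorphic to an open subset of ℝ²), let f : M → M be a homeomorphism, and let H ⊆ M be a σ₂-horseshoe for f, i.e. there is a homeomorphism k : Σ₂ → H (onto H) with f ∘ k = k ∘ σ. Then for every irrational real α with 0 < α < 1/2 there exist a Denjoy example h_α with minimal set K_α whose rotation number is the class of α in 𝕋, and a continuous injective map γ_α : 𝕋 → M such that γ_α(h_α(x)) = f(γ_α(x)) for all x ∈ K_α, f(γ_α(K_α)) = γ_α(K_α), and γ_α(K_α) ⊆ H; that is, (K_α, γ_α, h_α) is a C⁰ Denjoy sub-system for f with rotation number α contained in H. -/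

import Mathlib

open Filter Topology Set

noncomputable section

/-- A Denjoy example: an orientation-preserving circle homeomorphism with
irrational rotation number together with its minimal invariant Cantor set. -/
structure DenjoySystem where
  /-- the circle homeomorphism -/
  h : UnitAddCircle ≃ₜ UnitAddCircle
  /-- the minimal set -/
  K : Set UnitAddCircle
  /-- a lift of `h` to `ℝ` -/
  lift : ℝ → ℝ
  lift_mono : StrictMono lift
  lift_cont : Continuous lift
  lift_bij : Function.Bijective lift
  lift_add : ∀ x : ℝ, lift (x + 1) = lift x + 1
  lift_proj : ∀ x : ℝ, ((lift x : ℝ) : UnitAddCircle) = h (x : UnitAddCircle)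
  /-- a representative of the rotation number -/
  rot : ℝ
  rot_lim : Filter.Tendsto (fun n : ℕ => lift^[n] 0 / (n : ℝ)) Filter.atTop (nhds rot)
  rot_irr : Irrational rot
  K_ne : K.Nonempty
  K_cpt : IsCompact K
  K_proper : K ≠ Set.univ
  K_inv : h '' K = K
  K_perf : Perfect K
  K_td : IsTotallyDisconnected K
  K_min : ∀ x ∈ K, ∀ y ∈ K, y ∈ closure {z | ∃ n : ℤ, (h.toEquiv ^ n) x = z}

/-- A weak Denjoy sub-system (WDS) for a map `f : M → M`. -/
structure WDS (M : Type*) [TopologicalSpace M] (f : M → M) extends DenjoySystem where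
  /-- the embedding of the minimal set into `M` -/
  j : K → M
  j_emb : Topology.IsEmbedding j
  range_inv : f '' Set.range j = Set.range j
  equivar : ∀ x y : K, h (x : UnitAddCircle) = (y : UnitAddCircle) → j y = f (j x)

/-- Weak cyclic order on the circle. -/
def CircBtw (a b c : UnitAddCircle) : Prop :=
  ∃ x y z : ℝ, (x : UnitAddCircle) = a ∧ (y : UnitAddCircle) = b ∧ (z : UnitAddCircle) = c ∧
    x ≤ y ∧ y ≤ z ∧ z ≤ x + 1

/-- The order graph of a WDS. -/
def WDS.orderGraph {M : Type*} [TopologicalSpace M] {f : M → M} (W : WDS M f) :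
    Set (M × M × M) :=
  {p | ∃ a b c : W.K, CircBtw (a : UnitAddCircle) (b : UnitAddCircle) (c : UnitAddCircle) ∧ p = (W.j a, W.j b, W.j c)}

/-- The reverse of the order graph of a WDS. -/
def WDS.revGraph {M : Type*} [TopologicalSpace M] {f : M → M} (W : WDS M f) :
    Set (M × M × M) :=
  {p | (p.2.2, p.2.1, p.1) ∈ W.orderGraph}


/-- The shift on the space `Σ₂ = {0,1}^ℤ` of two-sided binary sequences. -/
def shift2 (u : ℤ → Fin 2) : ℤ → Fin 2 := fun k => u (k + 1)

namespace DJ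

abbrev P := ℝ × ℝ

lemma pert (φ : P → P) (c : NNReal) (hc : c < 1) (hφ : LipschitzWith c φ) :
    ∃ e : P ≃ₜ P, ∀ x, e x = x + φ x := by
  have h : ApproximatesLinearOn (fun x => x + φ x)
      ((ContinuousLinearEquiv.refl ℝ P : P ≃L[ℝ] P) : P →L[ℝ] P) univ c := by
    intro x _ y _
    have := hφ.dist_le_mul x y
    simp only [dist_eq_norm] at this
    simpa [add_sub_add_comm] using this
  refine ⟨h.toHomeomorph _ (Or.inr ?_), fun x => rfl⟩
  have : ‖((ContinuousLinearEquiv.refl ℝ P).symm : P →L[ℝ] P)‖₊ = 1 := by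
    have : ((ContinuousLinearEquiv.refl ℝ P).symm : P →L[ℝ] P) = ContinuousLinearMap.id ℝ P := rfl
    rw [this]; ext; simp
  rw [this]; simpa using hc

section general
variable {X : Type*} [TopologicalSpace X]

lemma maps_of_id_off (ψ : X ≃ₜ X) {V : Set X} (h : ∀ x, x ∉ V → ψ x = x) {x : X} :
    ψ x ∈ V ↔ x ∈ V := by
  constructor
  · intro hx
    by_contra hn
    rw [h x hn] at hx; exact hn hx
  · intro hx
    by_contra hn
    have := h _ hn
    have := ψ.injective this
    rw [this] at hn; exact hn hx

lemma symm_id_off (ψ : X ≃ₜ X) {V : Set X} (h : ∀ x, x ∉ V → ψ x = x) :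
    ∀ x, x ∉ V → ψ.symm x = x := by
  intro x hx
  rw [Homeomorph.symm_apply_eq, h x hx]

lemma prod_homeo {ι : Type*} (s : Finset ι) (V : ι → Set X)
    (hd : ∀ l ∈ s, ∀ l' ∈ s, l ≠ l' → Disjoint (V l) (V l')) (ψ : ι → X ≃ₜ X)
    (h : ∀ l ∈ s, ∀ x, x ∉ V l → ψ l x = x) :
    ∃ Ψ : X ≃ₜ X, (∀ l ∈ s, ∀ x ∈ V l, Ψ x = ψ l x) ∧ ∀ x, (∀ l ∈ s, x ∉ V l) → Ψ x = x := by
  classical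
  induction s using Finset.induction_on with
  | empty => exact ⟨Homeomorph.refl X, by simp, fun x _ => rfl⟩
  | insert a s ha ih =>
    obtain ⟨Ψ, h1, h2⟩ := ih (fun l hl l' hl' => hd l (by simp [hl]) l' (by simp [hl']))
      (fun l hl => h l (by simp [hl]))
    have ha' := h a (by simp)
    have hda : ∀ l ∈ s, Disjoint (V a) (V l) := fun l hl =>
      hd a (by simp) l (by simp [hl]) (by rintro rfl; exact ha hl)
    refine ⟨(ψ a).trans Ψ, ?_, ?_⟩
    · intro l hl x hx
      rcases Finset.mem_insert.1 hl with rfl | hl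
      · apply h2
        intro l' hl' hx'
        exact (hda l' hl').le_bot ⟨(maps_of_id_off _ ha').2 hx, hx'⟩
      · have : x ∉ V a := fun hxa => (hda l hl).le_bot ⟨hxa, hx⟩
        simp [ha' x this, h1 l hl x hx]
    · intro x hx
      have : x ∉ V a := hx a (by simp)
      simp only [Homeomorph.trans_apply, ha' x this]
      exact h2 x (fun l hl => hx l (by simp [hl]))

lemma iter_homeo (ψ : X ≃ₜ X) (n : ℕ) : ∃ e : X ≃ₜ X, ∀ x, e x = ψ^[n] x := by
  induction n with
  | zero => exact ⟨Homeomorph.refl X, fun x => rfl⟩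
  | succ n ih =>
    obtain ⟨e, he⟩ := ih
    exact ⟨ψ.trans e, fun x => by simp [he]⟩

lemma drift_iter (ψ : X ≃ₜ X) {R E F : Set X} (hE : IsOpen E) (hR : ∀ x, x ∉ R → ψ x = x)
    (hEE : ∀ x ∈ E, ψ x ∈ E) (hev : ∀ x ∈ R, ∃ n : ℕ, ψ^[n] x ∈ E) (hF : IsCompact F)
    (hFs : F ⊆ E ∪ R) : ∃ Ψ : X ≃ₜ X, (∀ x, x ∉ R → Ψ x = x) ∧ ∀ x ∈ F, Ψ x ∈ E := by
  obtain ⟨n, hn⟩ := hF.elim_directed_cover (fun n : ℕ => (ψ^[n]) ⁻¹' E)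
    (fun n => hE.preimage (ψ.continuous.iterate n))
    (by
      intro x hx
      rw [mem_iUnion]
      rcases hFs hx with h | h
      · exact ⟨0, h⟩
      · exact hev x h)
    (by
      apply Monotone.directed_le
      apply monotone_nat_of_le_succ
      intro n x hx
      simp only [mem_preimage, Function.iterate_succ_apply'] at hx ⊢
      exact hEE _ hx)
  obtain ⟨e, he⟩ := iter_homeo ψ n
  refine ⟨e, ?_, ?_⟩
  · intro x hx
    rw [he]
    exact Function.iterate_fixed (hR x hx) n
  · intro x hx
    rw [he]; exact hn hx

def Shr (V : Set X) : Prop := IsOpen V ∧ ∃ p ∈ V, ∀ O ∈ 𝓝 p, ∀ F, IsCompact F → F ⊆ V →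
  ∃ ψ : X ≃ₜ X, (∀ x, x ∉ V → ψ x = x) ∧ ∀ x ∈ F, ψ x ∈ O

lemma Shr.extend {V V' : Set X} (h : Shr V) (hV' : IsOpen V') (hs : V ⊆ V')
    (hp : ∀ F, IsCompact F → F ⊆ V' → ∃ ψ : X ≃ₜ X, (∀ x, x ∉ V' → ψ x = x) ∧ ∀ x ∈ F, ψ x ∈ V) :
    Shr V' := by
  obtain ⟨hV, p, hpV, H⟩ := h
  refine ⟨hV', p, hs hpV, fun O hO F hF hFV => ?_⟩
  obtain ⟨ψ, h1, h2⟩ := hp F hF hFV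
  obtain ⟨ψ', h3, h4⟩ := H O hO (ψ '' F) (hF.image ψ.continuous) (by rintro _ ⟨x, hx, rfl⟩; exact h2 x hx)
  refine ⟨ψ.trans ψ', fun x hx => ?_, fun x hx => h4 _ ⟨x, hx, rfl⟩⟩
  simp only [Homeomorph.trans_apply, h1 x hx]
  exact h3 x (fun h => hx (hs h))

lemma Shr.image {Y : Type*} [TopologicalSpace Y] (e : X ≃ₜ Y) {V : Set X} (h : Shr V) :
    Shr (e '' V) := by
  obtain ⟨hV, p, hpV, H⟩ := h
  refine ⟨e.isOpen_image.2 hV, e p, ⟨p, hpV, rfl⟩, fun O hO F hF hFV => ?_⟩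
  obtain ⟨ψ, h1, h2⟩ := H (e ⁻¹' O) (e.continuous.continuousAt hO) (e ⁻¹' F)
    (e.isCompact_preimage.2 hF) (by
      intro x hx
      obtain ⟨y, hy, hxy⟩ := hFV hx
      rwa [← e.injective hxy])
  refine ⟨(e.symm.trans ψ).trans e, fun x hx => ?_, fun x hx => ?_⟩
  · simp only [Homeomorph.trans_apply]
    rw [h1, e.apply_symm_apply]
    intro h; exact hx ⟨_, h, e.apply_symm_apply x⟩
  · simp only [Homeomorph.trans_apply]
    exact h2 _ (by simpa using hx)

end general

/-- open rectangle -/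
def Rc (l r a b : ℝ) : Set P := {p | (l < p.1 ∧ p.1 < r) ∧ (a < p.2 ∧ p.2 < b)}

lemma isOpen_Rc (l r a b : ℝ) : IsOpen (Rc l r a b) := by
  unfold Rc
  simp only [ofPred_and]
  refine (IsOpen.inter ?_ ?_).inter (IsOpen.inter ?_ ?_)
  · exact isOpen_lt continuous_const continuous_fst
  · exact isOpen_lt continuous_fst continuous_const
  · exact isOpen_lt continuous_const continuous_snd
  · exact isOpen_lt continuous_snd continuous_const

def rho (l r a b : ℝ) (p : P) : ℝ := max 0 (min (min (p.1 - l) (r - p.1)) (min (p.2 - a) (b - p.2)))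

def drf (l r a b m : ℝ) (p : P) : ℝ := max (-rho l r a b p) (min (rho l r a b p) (m - p.1))

lemma lip_fst : LipschitzWith 1 (fun p : P => p.1) := LipschitzWith.prod_fst
lemma lip_snd : LipschitzWith 1 (fun p : P => p.2) := LipschitzWith.prod_snd

lemma lip_rho (l r a b : ℝ) : LipschitzWith 1 (rho l r a b) := by
  have h1 : LipschitzWith 1 (fun p : P => p.1 - l) := by
    simpa using lip_fst.sub (LipschitzWith.const l)
  have h2 : LipschitzWith 1 (fun p : P => r - p.1) := by
    simpa using (LipschitzWith.const r).sub lip_fst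
  have h3 : LipschitzWith 1 (fun p : P => p.2 - a) := by
    simpa using lip_snd.sub (LipschitzWith.const a)
  have h4 : LipschitzWith 1 (fun p : P => b - p.2) := by
    simpa using (LipschitzWith.const b).sub lip_snd
  have := ((h1.min h2).min (h3.min h4)).const_max 0
  simp only [max_self] at this
  exact this

lemma lip_drf (l r a b m : ℝ) : LipschitzWith 1 (drf l r a b m) := by
  have h2 : LipschitzWith 1 (fun p : P => m - p.1) := by
    simpa using (LipschitzWith.const m).sub lip_fst
  have h := lip_rho l r a b
  have := h.neg.max (h.min h2)
  simp only [max_self] at this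
  exact this

lemma drift_exists (l r a b m : ℝ) : ∃ e : P ≃ₜ P, ∀ p, e p = (p.1 + drf l r a b m p / 2, p.2) := by
  obtain ⟨e, he⟩ := pert (fun p => (drf l r a b m p / 2, 0)) (1/2) (by
      rw [← NNReal.coe_lt_coe]; norm_num) (by
    apply LipschitzWith.of_dist_le_mul
    intro x y
    have := (lip_drf l r a b m).dist_le_mul x y
    rw [Prod.dist_eq]
    simp only [dist_self]
    rw [max_eq_left dist_nonneg]
    rw [Real.dist_eq] at *
    rw [← sub_div, abs_div]
    simp at *
    linarith)
  exact ⟨e, fun p => by rw [he]; ext <;> simp⟩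

lemma pushX {l r a b u v : ℝ} (hlu : l ≤ u) (huv : u < v) (hvr : v ≤ r) {E F : Set P}
    (hE : IsOpen E) (hER : ∀ p ∈ Rc l r a b, p ∈ E ↔ u < p.1 ∧ p.1 < v)
    (hF : IsCompact F) (hFs : F ⊆ E ∪ Rc l r a b) :
    ∃ Ψ : P ≃ₜ P, (∀ x, x ∉ Rc l r a b → Ψ x = x) ∧ ∀ x ∈ F, Ψ x ∈ E := by
  set m := (u + v) / 2 with hm
  obtain ⟨e, he⟩ := drift_exists l r a b m
  have hrho0 : ∀ p, p ∉ Rc l r a b → rho l r a b p = 0 := by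
    intro p hp
    unfold rho
    apply max_eq_left
    by_contra hc
    push Not at hc
    simp only [lt_min_iff, sub_pos] at hc
    exact hp ⟨hc.1, hc.2⟩
  have hid : ∀ x, x ∉ Rc l r a b → e x = x := by
    intro x hx
    rw [he]
    have : drf l r a b m x = 0 := by
      unfold drf; rw [hrho0 x hx]
      simp
    rw [this]; simp
  have hmR : ∀ x, x ∈ Rc l r a b → e x ∈ Rc l r a b := fun x hx => (maps_of_id_off e hid).2 hx
  -- monotone approach
  have hpos : ∀ p, 0 ≤ rho l r a b p := fun p => le_max_left _ _
  have hA : ∀ p : P, p.1 ≤ m → drf l r a b m p = min (rho l r a b p) (m - p.1) := by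
    intro p hp
    unfold drf
    apply max_eq_right
    have := hpos p
    apply le_min <;> linarith
  have hB : ∀ p : P, m ≤ p.1 → drf l r a b m p = - min (rho l r a b p) (p.1 - m) := by
    intro p hp
    unfold drf
    have := hpos p
    rw [min_eq_right (by linarith : m - p.1 ≤ rho l r a b p)]
    rw [← neg_sub p.1 m, max_neg_neg]
  apply drift_iter e hE hid _ _ hF hFs
  · intro x hx
    by_cases hR : x ∈ Rc l r a b
    · rw [hER _ (hmR x hR)]
      rw [hER _ hR] at hx
      rw [he]
      have := hpos x
      rcases le_total x.1 m with h | h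
      · rw [hA x h]
        have h1 : 0 ≤ min (rho l r a b x) (m - x.1) := le_min this (by linarith)
        have h2 : min (rho l r a b x) (m - x.1) ≤ m - x.1 := min_le_right _ _
        constructor <;> dsimp only <;> linarith
      · rw [hB x h]
        have h1 : 0 ≤ min (rho l r a b x) (x.1 - m) := le_min this (by linarith)
        have h2 : min (rho l r a b x) (x.1 - m) ≤ x.1 - m := min_le_right _ _
        constructor <;> dsimp only <;> linarith
    · rw [hid x hR]; exact hx
  · intro x hx
    set η := (v - u) / 2 with hη
    set δ := min (rho l r a b x) (min (m - l) (r - m)) with hδ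
    have hrx : rho l r a b x = min (min (x.1 - l) (r - x.1)) (min (x.2 - a) (b - x.2)) := by
      unfold rho
      apply max_eq_right
      simp only [le_min_iff, sub_nonneg]
      exact ⟨⟨hx.1.1.le, hx.1.2.le⟩, ⟨hx.2.1.le, hx.2.2.le⟩⟩
    have hδ0 : 0 < δ := by
      rw [hδ, hrx]
      simp only [lt_min_iff, sub_pos]
      exact ⟨⟨⟨hx.1.1, hx.1.2⟩, ⟨hx.2.1, hx.2.2⟩⟩, by linarith, by linarith⟩
    set κ := min δ (η / 2) / 2 with hκ
    have hκ0 : 0 < κ := by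
      have : 0 < min δ (η/2) := lt_min hδ0 (by linarith)
      linarith
    have key : ∀ n : ℕ, (e^[n] x).2 = x.2 ∧ l + δ ≤ (e^[n] x).1 ∧ (e^[n] x).1 ≤ r - δ ∧
        e^[n] x ∈ Rc l r a b ∧ |(e^[n] x).1 - m| ≤ max (η/2) (|x.1 - m| - n * κ) := by
      intro n
      induction n with
      | zero =>
        have h1 : δ ≤ x.1 - l := by
          calc δ ≤ rho l r a b x := min_le_left _ _
            _ ≤ _ := by rw [hrx]; exact (min_le_left _ _).trans (min_le_left _ _)
        have h2 : δ ≤ r - x.1 := by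
          calc δ ≤ rho l r a b x := min_le_left _ _
            _ ≤ _ := by rw [hrx]; exact (min_le_left _ _).trans (min_le_right _ _)
        refine ⟨rfl, ?_, ?_, hx, ?_⟩
        · simp; linarith
        · simp; linarith
        · simp
      | succ n ih =>
        rw [Function.iterate_succ_apply']
        set y := e^[n] x with hy
        obtain ⟨i1, i2, i3, i4, i5⟩ := ih
        have hml : δ ≤ m - l := (min_le_right _ _).trans (min_le_left _ _)
        have hmr : δ ≤ r - m := (min_le_right _ _).trans (min_le_right _ _)
        have hρ : δ ≤ rho l r a b y := by
          unfold rho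
          apply le_max_of_le_right
          have h3 : δ ≤ x.2 - a := by
            calc δ ≤ rho l r a b x := min_le_left _ _
              _ ≤ _ := by rw [hrx]; exact (min_le_right _ _).trans (min_le_left _ _)
          have h4 : δ ≤ b - x.2 := by
            calc δ ≤ rho l r a b x := min_le_left _ _
              _ ≤ _ := by rw [hrx]; exact (min_le_right _ _).trans (min_le_right _ _)
          rw [i1]
          exact le_min (le_min (by linarith) (by linarith)) (le_min h3 h4)
        have hpush : (((n:ℕ)+1 : ℕ) : ℝ) = (n : ℝ) + 1 := by push_cast; ring
        rw [hpush]
        have hfin : ∀ d d' : ℝ, d ≤ max (η/2) (|x.1 - m| - n * κ) → 0 ≤ d → d' ≤ d - min (rho l r a b y) d / 2 →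
            d' ≤ max (η/2) (|x.1 - m| - (n + 1) * κ) := by
          intro d d' h1 h0 h2
          rcases le_total d (η/2) with h | h
          · apply le_max_of_le_left
            have : 0 ≤ min (rho l r a b y) d := le_min (hpos y) h0
            linarith
          · have hk : κ ≤ min (rho l r a b y) d / 2 := by
              have : min δ (η/2) ≤ min (rho l r a b y) d := min_le_min hρ h
              linarith
            rcases le_max_iff.1 h1 with h1 | h1
            · apply le_max_of_le_left; linarith
            · apply le_max_of_le_right; linarith
        rcases le_total y.1 m with h | h
        · have e1 : e y = (y.1 + min (rho l r a b y) (m - y.1) / 2, y.2) := by rw [he, hA y h]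
          have g1 : 0 ≤ min (rho l r a b y) (m - y.1) := le_min (hpos y) (by linarith)
          have g2 : min (rho l r a b y) (m - y.1) ≤ m - y.1 := min_le_right _ _
          refine ⟨by rw [e1]; exact i1, ?_, ?_, hmR y i4, ?_⟩
          · rw [e1]; dsimp only; linarith
          · rw [e1]; dsimp only; linarith
          · apply hfin (|y.1 - m|) _ i5 (abs_nonneg _)
            rw [e1]; dsimp only
            rw [abs_of_nonpos (by linarith), abs_of_nonpos (by linarith), neg_sub, neg_sub]
            linarith
        · have e1 : e y = (y.1 + (- min (rho l r a b y) (y.1 - m)) / 2, y.2) := by rw [he, hB y h]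
          have g1 : 0 ≤ min (rho l r a b y) (y.1 - m) := le_min (hpos y) (by linarith)
          have g2 : min (rho l r a b y) (y.1 - m) ≤ y.1 - m := min_le_right _ _
          refine ⟨by rw [e1]; exact i1, ?_, ?_, hmR y i4, ?_⟩
          · rw [e1]; dsimp only; linarith
          · rw [e1]; dsimp only; linarith
          · apply hfin (|y.1 - m|) _ i5 (abs_nonneg _)
            rw [e1]; dsimp only
            rw [abs_of_nonneg (by linarith), abs_of_nonneg (by linarith)]
            linarith
    obtain ⟨n, hn⟩ := exists_nat_gt (|x.1 - m| / κ)
    refine ⟨n, ?_⟩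
    obtain ⟨_, _, _, i4, i5⟩ := key n
    rw [hER _ i4]
    have : |x.1 - m| - n * κ < 0 := by
      rw [div_lt_iff₀ hκ0] at hn; linarith
    have hd : |(e^[n] x).1 - m| ≤ η / 2 := by
      rcases le_max_iff.1 i5 with h | h
      · exact h
      · have := abs_nonneg ((e^[n] x).1 - m); linarith
    rw [abs_le] at hd
    constructor <;> linarith

lemma pushY {l r a b u v : ℝ} (hlu : a ≤ u) (huv : u < v) (hvr : v ≤ b) {E F : Set P}
    (hE : IsOpen E) (hER : ∀ p ∈ Rc l r a b, p ∈ E ↔ u < p.2 ∧ p.2 < v)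
    (hF : IsCompact F) (hFs : F ⊆ E ∪ Rc l r a b) :
    ∃ Ψ : P ≃ₜ P, (∀ x, x ∉ Rc l r a b → Ψ x = x) ∧ ∀ x ∈ F, Ψ x ∈ E := by
  have hsw : ∀ p : P, p.swap ∈ Rc l r a b ↔ p ∈ Rc a b l r := by
    intro p; simp only [Rc, mem_ofPred_eq, Prod.fst_swap, Prod.snd_swap]; tauto
  obtain ⟨Ψ, h1, h2⟩ := pushX (l := a) (r := b) (a := l) (b := r) (E := Prod.swap ⁻¹' E)
    (F := Prod.swap ⁻¹' F) hlu huv hvr (hE.preimage continuous_swap)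
    (by
      intro p hp
      exact hER p.swap ((hsw p).2 hp))
    ((Homeomorph.prodComm ℝ ℝ).isCompact_preimage.2 hF)
    (by
      intro p hp
      rcases hFs hp with h | h
      · exact Or.inl h
      · exact Or.inr ((hsw p).1 h))
  refine ⟨((Homeomorph.prodComm ℝ ℝ).trans Ψ).trans (Homeomorph.prodComm ℝ ℝ), ?_, ?_⟩
  · intro x hx
    have : x.swap ∉ Rc a b l r := by
      rw [← hsw]; simpa using hx
    simp [Homeomorph.trans_apply, h1 _ this]
  · intro x hx
    have := h2 x.swap (by simpa using hx)
    simpa using this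

lemma Shr_Rc {l r a b : ℝ} (hlr : l < r) (hab : a < b) : Shr (Rc l r a b) := by
  refine ⟨isOpen_Rc _ _ _ _, ((l+r)/2, (a+b)/2), ⟨⟨by dsimp only; linarith, by dsimp only; linarith⟩, by dsimp only; linarith, by dsimp only; linarith⟩, ?_⟩
  intro O hO F hF hFs
  obtain ⟨ε, hε, hb⟩ := Metric.mem_nhds_iff.1 hO
  set u := max l ((l+r)/2 - ε) with hu
  set v := min r ((l+r)/2 + ε) with hv
  set u' := max a ((a+b)/2 - ε) with hu'
  set v' := min b ((a+b)/2 + ε) with hv'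
  have hul : l ≤ u := le_max_left _ _
  have hvr : v ≤ r := min_le_left _ _
  have hul' : a ≤ u' := le_max_left _ _
  have hvr' : v' ≤ b := min_le_left _ _
  have huv : u < v := by
    apply max_lt <;> apply lt_min <;> linarith
  have huv' : u' < v' := by
    apply max_lt <;> apply lt_min <;> linarith
  obtain ⟨Ψ1, a1, a2⟩ := pushY (l := l) (r := r) (E := Rc l r u' v') hul' huv' hvr' (isOpen_Rc _ _ _ _)
    (by intro p hp; simp only [Rc, mem_ofPred_eq] at hp ⊢; tauto) hF
    (fun x hx => Or.inr (hFs hx))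
  obtain ⟨Ψ2, b1, b2⟩ := pushX (a := u') (b := v') (E := Rc u v u' v') hul huv hvr (isOpen_Rc _ _ _ _)
    (by intro p hp; simp only [Rc, mem_ofPred_eq] at hp ⊢; tauto) (hF.image Ψ1.continuous)
    (by rintro _ ⟨x, hx, rfl⟩; exact Or.inr (a2 x hx))
  refine ⟨Ψ1.trans Ψ2, ?_, ?_⟩
  · intro x hx
    rw [Homeomorph.trans_apply, a1 x hx, b1]
    intro h; apply hx
    simp only [Rc, mem_ofPred_eq] at h ⊢
    exact ⟨h.1, by linarith, by linarith⟩
  · intro x hx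
    apply hb
    have := b2 _ ⟨x, hx, rfl⟩
    rw [Homeomorph.trans_apply]
    obtain ⟨⟨h1, h2⟩, h3, h4⟩ := this
    have e1 := le_max_right l ((l+r)/2 - ε)
    have e2 := min_le_right r ((l+r)/2 + ε)
    have e3 := le_max_right a ((a+b)/2 - ε)
    have e4 := min_le_right b ((a+b)/2 + ε)
    rw [Metric.mem_ball, Prod.dist_eq, max_lt_iff, Real.dist_eq, Real.dist_eq, abs_lt, abs_lt]
    refine ⟨⟨?_, ?_⟩, ?_, ?_⟩ <;> dsimp only <;> linarith

end DJ

namespace DJ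


abbrev Q := ℤ × ℤ

def Adj4 (u v : Q) : Prop :=
  (u.1 = v.1 ∧ (v.2 = u.2 + 1 ∨ u.2 = v.2 + 1)) ∨ (u.2 = v.2 ∧ (v.1 = u.1 + 1 ∨ u.1 = v.1 + 1))

def Adj8 (u v : Q) : Prop := u.1 ≤ v.1 + 1 ∧ v.1 ≤ u.1 + 1 ∧ u.2 ≤ v.2 + 1 ∧ v.2 ≤ u.2 + 1

lemma Adj4.symm {u v : Q} (h : Adj4 u v) : Adj4 v u := by
  unfold Adj4 at *; omega

lemma Adj8.symm {u v : Q} (h : Adj8 u v) : Adj8 v u := by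
  unfold Adj8 at *; omega

/-- `S` is connected with respect to the relation `A`. -/
def Conn (A : Q → Q → Prop) (S : Set Q) : Prop :=
  ∀ T : Set Q, (∀ u ∈ S, ∀ v ∈ S, A u v → u ∈ T → v ∈ T) → ∀ u ∈ S, ∀ v ∈ S, u ∈ T → v ∈ T

def Dd (k h j t : ℤ) : Prop := j = k ∧ h < t

def Coh (F : Set Q) (k h k2 h2 : ℤ) : Prop :=
  ∃ f : Set Q, (∀ i t, (i, t) ∈ F → (i, t+1) ∈ F → ((i, t) ∈ f ↔ (i, t+1) ∈ f)) ∧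
    ∀ j t, (j, t) ∈ F → (j+1, t) ∈ F →
      (((j, t) ∈ f ↔ (j+1, t) ∈ f) ↔ (Dd k h j t ↔ Dd k2 h2 j t))

lemma Coh.symm {F : Set Q} {k h k2 h2 : ℤ} (H : Coh F k h k2 h2) : Coh F k2 h2 k h := by
  obtain ⟨f, h1, h3⟩ := H
  refine ⟨f, h1, fun j t a b => ?_⟩
  rw [h3 j t a b]; exact Iff.comm

lemma Coh.trans {F : Set Q} {k h k2 h2 k3 h3 : ℤ} (H : Coh F k h k2 h2) (H' : Coh F k2 h2 k3 h3) :
    Coh F k h k3 h3 := by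
  obtain ⟨f, a1, a2⟩ := H
  obtain ⟨g, b1, b2⟩ := H'
  refine ⟨{u | u ∈ f ↔ u ∈ g}, fun i t x y => ?_, fun j t x y => ?_⟩
  · have := a1 i t x y
    have := b1 i t x y
    simp only [mem_ofPred_eq]
    grind
  · have h1 := a2 j t x y
    have h2' := b2 j t x y
    simp only [mem_ofPred_eq]
    by_cases c1 : (j, t) ∈ f <;> by_cases c2 : (j+1, t) ∈ f <;> by_cases c3 : (j, t) ∈ g <;>
      by_cases c4 : (j+1, t) ∈ g <;> simp [c1, c2, c3, c4] at h1 h2' ⊢ <;> grind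

lemma cohA {F : Set Q} {i r : ℤ} (h : (i, r) ∉ F) : Coh F i r (i-1) r := by
  refine ⟨{u | u.1 = i ∧ r < u.2}, ?_, ?_⟩
  · intro j t h1 h2
    simp only [mem_ofPred_eq]
    constructor
    · intro ⟨h3, h4⟩; exact ⟨h3, by omega⟩
    · intro ⟨h3, h4⟩
      refine ⟨h3, ?_⟩
      by_contra hc
      have : t = r := by omega
      subst this; subst h3; exact h h1
  · intro j t h1 h2
    simp only [mem_ofPred_eq, Dd]
    omega

lemma cohB {F : Set Q} {k r r' : ℤ} (h1 : r ≤ r' + 1) (h2 : r' ≤ r + 1)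
    (h : ¬ ((k, max r r') ∈ F ∧ (k+1, max r r') ∈ F)) : Coh F k r k r' := by
  refine ⟨∅, by simp, ?_⟩
  intro j t h3 h4
  simp only [mem_empty_iff_false, true_iff, Dd, iff_self]
  by_cases hj : j = k
  · subst hj
    have : t ≠ max r r' := by rintro rfl; exact h ⟨h3, h4⟩
    omega
  · simp [hj]

lemma coh_adj {F : Set Q} {u v : Q} (hu : u ∉ F) (hv : v ∉ F) (ha : Adj8 u v) :
    Coh F u.1 u.2 v.1 v.2 := by
  have main : ∀ u v : Q, u ∉ F → v ∉ F → Adj8 u v → u.1 + 1 = v.1 → Coh F u.1 u.2 v.1 v.2 := by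
    rintro ⟨a, b⟩ ⟨c, d⟩ hu hv ha h
    simp only [Adj8] at *
    have h1 : Coh F a b a d := by
      apply cohB (by omega) (by omega)
      rintro ⟨h1, h2⟩
      rcases max_choice b d with h' | h' <;> rw [h'] at h1 h2
      · exact hu h1
      · rw [h] at h2; exact hv h2
    have h2 : Coh F c d (c-1) d := cohA hv
    have : c - 1 = a := by omega
    rw [this] at h2
    exact h1.trans h2.symm
  have h3 : u.1 = v.1 ∨ u.1 + 1 = v.1 ∨ v.1 + 1 = u.1 := by unfold Adj8 at ha; omega
  rcases h3 with h | h | h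
  · obtain ⟨a, b⟩ := u
    obtain ⟨c, d⟩ := v
    dsimp only at h; subst h
    apply cohB (by unfold Adj8 at ha; dsimp only at ha; omega) (by unfold Adj8 at ha; dsimp only at ha; omega)
    rintro ⟨h1, h2⟩
    rcases max_choice b d with h' | h' <;> dsimp only at h1 h2 <;> rw [h'] at h1
    · exact hu h1
    · exact hv h1
  · exact main u v hu hv ha h
  · exact (main v u hv hu ha.symm h).symm

lemma coh_all {F : Set Q} (hF : Conn Adj8 Fᶜ) {u v : Q} (hu : u ∉ F) (hv : v ∉ F) :
    Coh F u.1 u.2 v.1 v.2 := by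
  refine hF {v | Coh F u.1 u.2 v.1 v.2} ?_ u hu v hv ?_
  · intro x hx y hy hxy hux
    exact Coh.trans hux (coh_adj hx hy hxy)
  · exact coh_adj hu hu (by unfold Adj8; omega)

lemma coh_edge {F : Set Q} (hF : Conn Adj8 Fᶜ) {e t1 t2 : ℤ}
    (h1 : ¬ ((e, t1) ∈ F ∧ (e+1, t1) ∈ F)) (h2 : ¬ ((e, t2) ∈ F ∧ (e+1, t2) ∈ F)) :
    Coh F e t2 e t1 := by
  have key : ∀ t, ¬ ((e, t) ∈ F ∧ (e+1, t) ∈ F) → ∃ u : Q, u ∉ F ∧ Coh F e t u.1 u.2 := by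
    intro t ht
    by_cases h : (e, t) ∈ F
    · refine ⟨(e+1, t), fun h' => ht ⟨h, h'⟩, ?_⟩
      have := cohA (fun h' => ht ⟨h, h'⟩)
      simp only [add_sub_cancel_right] at this
      exact this.symm
    · exact ⟨(e, t), h, coh_all hF h h⟩
  obtain ⟨u, hu, hu'⟩ := key t2 h2
  obtain ⟨v, hv, hv'⟩ := key t1 h1
  exact (hu'.trans (coh_all hF hu hv)).trans hv'.symm

lemma int_run {p : ℤ → Prop} {a b : ℤ} (h : ∀ t, a ≤ t → t + 1 < b → (p t ↔ p (t+1))) :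
    ∀ t, a ≤ t → t < b → ∀ t', a ≤ t' → t' < b → (p t ↔ p t') := by
  have key : ∀ t, a ≤ t → t < b → (p a ↔ p t) := by
    intro t ht
    induction t, ht using Int.leInduction with
    | base => intro _; rfl
    | succ n hn ih =>
      intro hb
      rw [ih (by omega), h n hn hb]
  intro t h1 h2 t' h3 h4
  rw [← key t h1 h2, key t' h3 h4]

lemma int_maxrun {p : ℤ → Prop} {r : ℤ} (hr : p r) (hf : {t | p t}.Finite) :
    ∃ a b, a ≤ r ∧ r < b ∧ (∀ t, a ≤ t → t < b → p t) ∧ ¬ p (a-1) ∧ ¬ p b := by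
  classical
  obtain ⟨B, hB⟩ := hf.bddAbove
  obtain ⟨A, hA⟩ := hf.bddBelow
  have e1 : ∃ n : ℕ, ¬ p (r + n) := by
    refine ⟨(B - r).toNat + 1, fun h => ?_⟩
    have := hB h
    omega
  have e2 : ∃ n : ℕ, ¬ p (r - n) := by
    refine ⟨(r - A).toNat + 1, fun h => ?_⟩
    have := hA h
    omega
  have n1 := Nat.find_spec e1
  have n2 := Nat.find_spec e2
  have m1 := fun m => @Nat.find_min _ _ e1 m
  have m2 := fun m => @Nat.find_min _ _ e2 m
  set N1 := Nat.find e1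
  set N2 := Nat.find e2
  have hN1 : N1 ≠ 0 := by intro h; rw [h] at n1; simp at n1; exact n1 hr
  have hN2 : N2 ≠ 0 := by intro h; rw [h] at n2; simp at n2; exact n2 hr
  refine ⟨r - N2 + 1, r + N1, by omega, by omega, ?_, by simpa using n2, n1⟩
  intro t h1 h2
  rcases le_total r t with h | h
  · have := m1 (t - r).toNat (by omega)
    have e : r + ((t - r).toNat : ℤ) = t := by omega
    rw [e] at this
    exact not_not.1 this
  · have := m2 (r - t).toNat (by omega)
    have e : r - ((r - t).toNat : ℤ) = t := by omega
    rw [e] at this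
    exact not_not.1 this

/-- closed unit square -/
def Sq (z : Q) : Set P := {p | ((z.1 : ℝ) ≤ p.1 ∧ p.1 ≤ z.1 + 1) ∧ ((z.2 : ℝ) ≤ p.2 ∧ p.2 ≤ z.2 + 1)}

def VF (F : Set Q) : Set P := {p | ∀ z, p ∈ Sq z → z ∈ F}

lemma near1 {x x' : ℝ} (h1 : (⌈x⌉ : ℝ) - 1 < x') (h2 : x' < ⌊x⌋ + 1) {i : ℤ} (h3 : (i:ℝ) ≤ x')
    (h4 : x' ≤ i + 1) : (i:ℝ) ≤ x ∧ x ≤ i + 1 := by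
  constructor
  · have : (i:ℝ) < ((⌊x⌋ + 1 : ℤ) : ℝ) := by push_cast; linarith
    have := Int.cast_lt.1 this
    have : i ≤ ⌊x⌋ := by omega
    exact Int.le_floor.1 this
  · have : ((⌈x⌉ - 1 : ℤ):ℝ) < ((i + 1 : ℤ) : ℝ) := by push_cast; linarith
    have := Int.cast_lt.1 this
    have : ⌈x⌉ ≤ i + 1 := by omega
    have := Int.ceil_le.1 this
    push_cast at this; exact this

lemma isOpen_VF (F : Set Q) : IsOpen (VF F) := by
  rw [isOpen_iff_mem_nhds]
  intro p hp
  have : Rc ((⌈p.1⌉:ℝ) - 1) (⌊p.1⌋ + 1) ((⌈p.2⌉:ℝ) - 1) (⌊p.2⌋ + 1) ∈ 𝓝 p := by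
    apply (isOpen_Rc _ _ _ _).mem_nhds
    refine ⟨⟨?_, Int.lt_floor_add_one _⟩, ?_, Int.lt_floor_add_one _⟩
    · have := Int.ceil_lt_add_one p.1; linarith
    · have := Int.ceil_lt_add_one p.2; linarith
  filter_upwards [this] with q hq z hz
  apply hp
  exact ⟨near1 hq.1.1 hq.1.2 hz.1.1 hz.1.2, near1 hq.2.1 hq.2.2 hz.2.1 hz.2.2⟩

lemma mem_Sq_floor (p : P) : p ∈ Sq (⌊p.1⌋, ⌊p.2⌋) :=
  ⟨⟨Int.floor_le _, (Int.lt_floor_add_one _).le⟩, Int.floor_le _, (Int.lt_floor_add_one _).le⟩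

lemma VF_disjoint {F G : Set Q} (h : Disjoint F G) : Disjoint (VF F) (VF G) := by
  rw [Set.disjoint_left]
  intro p h1 h2
  exact h.le_bot ⟨h1 _ (mem_Sq_floor p), h2 _ (mem_Sq_floor p)⟩

lemma VF_mono {F G : Set Q} (h : F ⊆ G) : VF F ⊆ VF G := fun _ hp z hz => h (hp z hz)

/-- column of the run -/
def Run (i a b : ℤ) : Set Q := {z | z.1 = i ∧ a ≤ z.2 ∧ z.2 < b}

lemma VF_Run (i a b : ℤ) : VF (Run i a b) = Rc i (i+1) a b := by
  ext p
  constructor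
  · intro h
    have h1 := h _ (mem_Sq_floor p)
    have h2 := h (⌊p.1⌋, ⌈p.2⌉ - 1) ⟨(mem_Sq_floor p).1, by
      have := Int.ceil_lt_add_one p.2; push_cast; linarith, by
      have := Int.le_ceil p.2; push_cast; linarith⟩
    have h3 := h (⌈p.1⌉ - 1, ⌊p.2⌋) ⟨⟨by
      have := Int.ceil_lt_add_one p.1; push_cast; linarith, by
      have := Int.le_ceil p.1; push_cast; linarith⟩, (mem_Sq_floor p).2⟩
    simp only [Run, mem_ofPred_eq] at h1 h2 h3
    have g1 : i < ⌈p.1⌉ := by omega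
    have g2 : ⌊p.1⌋ < i + 1 := by omega
    have g3 : a < ⌈p.2⌉ := by omega
    have g4 : ⌊p.2⌋ < b := by omega
    rw [Int.lt_ceil] at g1 g3
    rw [Int.floor_lt] at g2 g4
    push_cast at g2
    exact ⟨⟨g1, g2⟩, g3, g4⟩
  · rintro ⟨⟨h1, h2⟩, h3, h4⟩ z ⟨⟨g1, g2⟩, g3, g4⟩
    have e1 : (i:ℝ) < ((z.1 + 1 : ℤ):ℝ) := by push_cast; linarith
    have e2 : (z.1:ℝ) < ((i + 1 : ℤ):ℝ) := by push_cast; linarith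
    have e3 : (a:ℝ) < ((z.2 + 1 : ℤ):ℝ) := by push_cast; linarith
    have e4 : (z.2:ℝ) < (b:ℝ) := by linarith
    rw [Int.cast_lt] at e1 e2 e3 e4
    exact ⟨by omega, by omega, by omega⟩

lemma glue {S : Set Q} {i a b a' b' j : ℤ} (hj : j = i + 1 ∨ j = i - 1) (ha : a ≤ a') (hab : a' < b')
    (hb : b' ≤ b) (h1 : ∀ t, a ≤ t → t < b → (i, t) ∉ S) (h1a : (i, a-1) ∉ S) (h1b : (i, b) ∉ S)
    (h2 : ∀ t, a ≤ t → t < b → ((j, t) ∈ S ↔ a' ≤ t ∧ t < b'))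
    (h3 : ∀ t, a ≤ t → t < b → (2 * i - j, t) ∉ S) (hS : Shr (VF S)) :
    Shr (VF (S ∪ Run i a b)) := by
  have haR : (a:ℝ) ≤ a' := by exact_mod_cast ha
  have habR : (a':ℝ) < b' := by exact_mod_cast hab
  have hbR : (b':ℝ) ≤ b := by exact_mod_cast hb
  set l : ℤ := min i j with hl
  set r : ℤ := max i j + 1 with hr
  have hlj : (l:ℝ) ≤ j := by exact_mod_cast min_le_right _ _
  have hli : (l:ℝ) ≤ i := by exact_mod_cast min_le_left _ _
  have hjr : (j:ℝ) + 1 ≤ r := by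
    have : j + 1 ≤ r := by omega
    exact_mod_cast this
  have hir : (i:ℝ) + 1 ≤ r := by
    have : i + 1 ≤ r := by omega
    exact_mod_cast this
  -- rows
  have rowA : ∀ {x : ℝ} {c d t : ℤ}, (c:ℝ) < x → x < d → (t:ℝ) ≤ x → x ≤ t + 1 → c ≤ t ∧ t < d := by
    intro x c d t g1 g2 g3 g4
    have e3 : (c:ℝ) < ((t + 1 : ℤ):ℝ) := by push_cast; linarith
    have e4 : (t:ℝ) < (d:ℝ) := by linarith
    rw [Int.cast_lt] at e3 e4
    omega
  have lamnotS : ∀ p ∈ Rc i (i+1) a b, p ∉ VF S := by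
    intro p hp hpS
    have := hpS (i, ⌊p.2⌋) ⟨⟨hp.1.1.le, hp.1.2.le⟩, (mem_Sq_floor p).2⟩
    obtain ⟨r1, r2⟩ := rowA hp.2.1 hp.2.2 (mem_Sq_floor p).2.1 (mem_Sq_floor p).2.2
    exact h1 _ r1 r2 this
  have hRS : ∀ p ∈ Rc l r a' b', p ∈ VF S ↔ (j:ℝ) < p.1 ∧ p.1 < j + 1 := by
    intro p hp
    constructor
    · intro hpS
      by_contra hc
      have hc2 : (i:ℝ) ≤ p.1 ∧ p.1 ≤ i + 1 := by
        obtain ⟨⟨g1, g2⟩, -⟩ := hp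
        rcases hj with hj | hj
        · have e1 : l = i := by omega
          have e2 : r = i + 2 := by omega
          rw [e1] at g1; rw [e2] at g2; rw [hj] at hc
          push_cast at *
          refine ⟨g1.le, ?_⟩
          by_contra hh
          exact hc ⟨by linarith, by linarith⟩
        · have e1 : l = i - 1 := by omega
          have e2 : r = i + 1 := by omega
          rw [e1] at g1; rw [e2] at g2; rw [hj] at hc
          push_cast at *
          refine ⟨?_, g2.le⟩
          by_contra hh
          exact hc ⟨by linarith, by linarith⟩
      have := hpS (i, ⌊p.2⌋) ⟨hc2, (mem_Sq_floor p).2⟩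
      obtain ⟨r1, r2⟩ := rowA hp.2.1 hp.2.2 (mem_Sq_floor p).2.1 (mem_Sq_floor p).2.2
      exact h1 _ (by omega) (by omega) this
    · rintro ⟨g1, g2⟩ ⟨z1, z2⟩ hz
      obtain ⟨r1, r2⟩ := rowA hp.2.1 hp.2.2 hz.2.1 hz.2.2
      obtain ⟨r3, r4⟩ := rowA (d := j + 1) g1 (by push_cast; exact g2) hz.1.1 hz.1.2
      dsimp only at *
      have : z1 = j := by omega
      subst this
      exact (h2 z2 (by omega) (by omega)).2 ⟨r1, r2⟩
  have hRV : Rc l r a' b' ⊆ VF (S ∪ Run i a b) := by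
    rintro p hp ⟨z1, z2⟩ hz
    obtain ⟨r1, r2⟩ := rowA hp.2.1 hp.2.2 hz.2.1 hz.2.2
    obtain ⟨r3, r4⟩ := rowA hp.1.1 hp.1.2 hz.1.1 hz.1.2
    dsimp only at *
    by_cases h : z1 = i
    · right; exact ⟨h, by dsimp only; omega, by dsimp only; omega⟩
    · left
      have : z1 = j := by omega
      subst this
      exact (h2 z2 (by omega) (by omega)).2 ⟨r1, r2⟩
  have hLV : Rc i (i+1) a b ⊆ VF (S ∪ Run i a b) := by
    rw [← VF_Run]; exact VF_mono subset_union_right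
  have hcov : VF (S ∪ Run i a b) ⊆ (VF S ∪ Rc l r a' b') ∪ Rc i (i+1) a b := by
    intro p hp
    by_contra hc
    simp only [mem_union, not_or] at hc
    obtain ⟨⟨c1, c2⟩, c3⟩ := hc
    have : ∃ z, p ∈ Sq z ∧ z ∉ S := by
      by_contra hh; push Not at hh; exact c1 hh
    obtain ⟨⟨z1, z2⟩, hz, hzS⟩ := this
    have hzL : (z1, z2) ∈ Run i a b := (hp _ hz).resolve_left hzS
    obtain ⟨q1, q2, q3⟩ := hzL
    dsimp only at q1 q2 q3
    subst q1
    obtain ⟨⟨x1, x2⟩, y1, y2⟩ := hz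
    dsimp only at x1 x2 y1 y2
    have q2R : (a:ℝ) ≤ z2 := by exact_mod_cast q2
    have q3R : (z2:ℝ) + 1 ≤ b := by exact_mod_cast q3
    have ya : (a:ℝ) < p.2 := by
      rcases lt_or_eq_of_le (q2R.trans y1) with h | h
      · exact h
      · exfalso
        rcases hp (z1, a - 1) ⟨⟨x1, x2⟩, by push_cast; linarith, by push_cast; linarith⟩ with h' | h'
        · exact h1a h'
        · have := h'.2.1; dsimp only at this; omega
    have yb : p.2 < b := by
      rcases lt_or_eq_of_le (y2.trans q3R) with h | h
      · exact h
      · exfalso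
        rcases hp (z1, b) ⟨⟨x1, x2⟩, by dsimp only; linarith, by dsimp only; linarith⟩ with h' | h'
        · exact h1b h'
        · have := h'.2.2; dsimp only at this; omega
    by_cases hx : (z1:ℝ) < p.1 ∧ p.1 < z1 + 1
    · exact c3 ⟨hx, ya, yb⟩
    by_cases hx2 : (j:ℝ) ≤ p.1 ∧ p.1 ≤ j + 1
    · -- door
      have hdoor : ∀ t : ℤ, (t:ℝ) ≤ p.2 → p.2 ≤ t + 1 → a' ≤ t ∧ t < b' := by
        intro t g1 g2
        obtain ⟨r1, r2⟩ := rowA ya yb g1 g2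
        rw [← h2 t r1 r2]
        rcases hp (j, t) ⟨hx2, g1, g2⟩ with h | h
        · exact h
        · have := h.1; dsimp only at this; omega
      apply c2
      obtain ⟨d1, -⟩ := hdoor (⌈p.2⌉ - 1) (by have := Int.ceil_lt_add_one p.2; push_cast; linarith)
        (by have := Int.le_ceil p.2; push_cast; linarith)
      obtain ⟨-, d2⟩ := hdoor ⌊p.2⌋ (Int.floor_le _) (Int.lt_floor_add_one _).le
      have d1' : a' < ⌈p.2⌉ := by omega
      rw [Int.lt_ceil] at d1'
      rw [Int.floor_lt] at d2
      refine ⟨?_, d1', d2⟩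
      rcases hj with hj | hj
      · have e1 : l = z1 := by omega
        have e2 : r = z1 + 2 := by omega
        rw [e1, e2]; rw [hj] at hx2; push_cast at *
        constructor <;> linarith
      · have e1 : l = z1 - 1 := by omega
        have e2 : r = z1 + 1 := by omega
        rw [e1, e2]; rw [hj] at hx2; push_cast at *
        constructor <;> linarith
    · -- other side
      obtain ⟨r1, r2⟩ := rowA ya yb y1 y2
      have : (2 * z1 - j, z2) ∈ S := by
        refine (hp (2 * z1 - j, z2) ⟨?_, y1, y2⟩).resolve_right ?_
        · have hx' : p.1 = z1 ∨ p.1 = z1 + 1 := by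
            by_contra hh
            push Not at hh
            exact hx ⟨lt_of_le_of_ne x1 (Ne.symm hh.1), lt_of_le_of_ne x2 hh.2⟩
          rcases hj with hj | hj
          · subst hj; push_cast at *
            rcases hx' with h | h
            · constructor <;> linarith
            · exact absurd ⟨by linarith, by linarith⟩ hx2
          · subst hj; push_cast at *
            rcases hx' with h | h
            · exact absurd ⟨by linarith, by linarith⟩ hx2
            · constructor <;> linarith
        · intro h; have := h.1; dsimp only at this; omega
      exact h3 z2 r1 r2 this
  refine hS.extend (isOpen_VF _) (VF_mono subset_union_left) ?_
  intro F hF hFV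
  obtain ⟨Ψ1, u1, u2⟩ := pushY (l := i) (r := i+1) (a := a) (b := b) (E := VF S ∪ Rc l r a' b')
    haR habR hbR ((isOpen_VF S).union (isOpen_Rc _ _ _ _))
    (by
      intro p hp
      constructor
      · rintro (h | h)
        · exact absurd h (lamnotS p hp)
        · exact h.2
      · intro h
        right
        refine ⟨⟨?_, ?_⟩, h⟩
        · have := hp.1.1; linarith
        · have := hp.1.2; linarith) hF (fun p hp => hcov (hFV hp))
  obtain ⟨Ψ2, w1, w2⟩ := pushX (l := l) (r := r) (a := a') (b := b') (u := j) (v := j+1) (E := VF S)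
    hlj (by linarith) hjr (isOpen_VF S) hRS (hF.image Ψ1.continuous)
    (by rintro _ ⟨x, hx, rfl⟩; exact u2 x hx)
  refine ⟨Ψ1.trans Ψ2, fun x hx => ?_, fun x hx => w2 _ ⟨x, hx, rfl⟩⟩
  rw [Homeomorph.trans_apply, u1 x (fun h => hx (hLV h)), w1 x (fun h => hx (hRV h))]

lemma conn_const {A : Q → Q → Prop} {S : Set Q} (h : Conn A S) (hA : ∀ u v, A u v → A v u) (T : Set Q)
    (hT : ∀ u ∈ S, ∀ v ∈ S, A u v → (u ∈ T ↔ v ∈ T)) : ∀ u ∈ S, ∀ v ∈ S, (u ∈ T ↔ v ∈ T) := by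
  intro u hu v hv
  have : ∀ u ∈ S, ∀ v ∈ S, u ∈ T → v ∈ T := h T (fun u hu v hv huv => (hT u hu v hv huv).1)
  exact ⟨this u hu v hv, this v hv u hu⟩

lemma rconn {F T : Set Q} {i a b : ℤ} (hF : ∀ t, a ≤ t → t < b → (i, t) ∈ F)
    (hT : ∀ u ∈ F, ∀ v ∈ F, Adj4 u v → u ∈ T → v ∈ T) :
    ∀ t, a ≤ t → t < b → ∀ t', a ≤ t' → t' < b → ((i, t) ∈ T ↔ (i, t') ∈ T) := by
  apply int_run (p := fun t => (i, t) ∈ T)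
  intro t h1 h2
  have h : Adj4 (i, t) (i, t+1) := by left; simp
  exact ⟨hT _ (hF t h1 (by omega)) _ (hF _ (by omega) h2) h,
    hT _ (hF _ (by omega) h2) _ (hF t h1 (by omega)) h.symm⟩

lemma shr_step {F S : Set Q} (hfin : F.Finite) (hF8 : Conn Adj8 Fᶜ) (hSF : S ⊆ F)
    (hrc : ∀ i t, (i, t) ∈ F → (i, t+1) ∈ F → ((i, t) ∈ S ↔ (i, t+1) ∈ S)) (hconn : Conn Adj4 S)
    (hS : Shr (VF S)) {i r j : ℤ} (hj : j = i + 1 ∨ j = i - 1) (hz : (i, r) ∈ F) (hzS : (i, r) ∉ S)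
    (hz0 : (j, r) ∈ S) : ∃ S' ⊆ F, S ⊆ S' ∧ (i, r) ∈ S' ∧
      (∀ i t, (i, t) ∈ F → (i, t+1) ∈ F → ((i, t) ∈ S' ↔ (i, t+1) ∈ S')) ∧ Conn Adj4 S' ∧
      Shr (VF S') := by
  have hinj : ∀ i : ℤ, Function.Injective (fun t : ℤ => ((i, t) : Q)) := fun i x y h => by
    simpa using h
  obtain ⟨a, b, ha, hb, hrun, hna, hnb⟩ := int_maxrun (p := fun t => (i, t) ∈ F) hz
    (hfin.preimage (hinj i).injOn)
  obtain ⟨a', b', ha', hb', hdoor, hna', hnb'⟩ := int_maxrun (p := fun t => (i, t) ∈ F ∧ (j, t) ∈ F)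
    (r := r) ⟨hz, hSF hz0⟩ ((hfin.preimage (hinj i).injOn).subset (fun t h => h.1))
  have haa : a ≤ a' := by
    by_contra hc; exact hna (hdoor (a-1) (by omega) (by omega)).1
  have hbb : b' ≤ b := by
    by_contra hc; exact hnb (hdoor b (by omega) (by omega)).1
  -- rows of the run are not in S
  have hrunS : ∀ t, a ≤ t → t < b → (i, t) ∉ S := by
    intro t h1 h2
    rwa [int_run (p := fun t => (i, t) ∈ S) (a := a) (b := b)
      (fun t h1 h2 => hrc i t (hrun t h1 (by omega)) (hrun _ (by omega) h2)) t h1 h2 r ha hb]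
  have hdoorS : ∀ t, a' ≤ t → t < b' → (j, t) ∈ S := by
    intro t h1 h2
    rwa [int_run (p := fun t => (j, t) ∈ S) (a := a') (b := b')
      (fun t h1 h2 => hrc j t (hdoor t h1 (by omega)).2 (hdoor _ (by omega) h2).2) t h1 h2 r ha' hb']
  -- the function f
  have hf : ∃ f : Set Q, (∀ i t, (i, t) ∈ F → (i, t+1) ∈ F → ((i, t) ∈ f ↔ (i, t+1) ∈ f)) ∧
      (∀ t, (i, t) ∈ F → (j, t) ∈ F → (((i, t) ∈ f ↔ (j, t) ∈ f) ↔ ¬ (a' ≤ t ∧ t < b'))) ∧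
      (∀ x t, (x, t) ∈ F → (x+1, t) ∈ F → ¬ (x = i ∧ x + 1 = j) → ¬ (x = j ∧ x + 1 = i) →
        ((x, t) ∈ f ↔ (x+1, t) ∈ f)) := by
    rcases hj with hj | hj
    · subst hj
      obtain ⟨f, f1, f2⟩ := coh_edge hF8 hnb' hna'
      refine ⟨f, f1, ?_, ?_⟩
      · intro t g1 g2
        have hne : t ≠ b' := by rintro rfl; exact hnb' ⟨g1, g2⟩
        rw [f2 i t g1 g2]
        simp only [Dd, true_and]
        have q1 : (a' - 1 < t) ↔ a' ≤ t := by omega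
        have q2 : b' < t → a' ≤ t := by omega
        have q3 : (b' < t) ↔ ¬ (t < b') := by omega
        rw [q1]
        grind
      · intro x t g1 g2 g3 g4
        rw [f2 x t g1 g2]
        simp only [Dd]; omega
    · have hij : i = j + 1 := by omega
      subst hij
      obtain ⟨f, f1, f2⟩ := coh_edge (e := j) hF8 (fun h => hnb' h.symm) (fun h => hna' h.symm)
      refine ⟨f, f1, ?_, ?_⟩
      · intro t g1 g2
        have hne : t ≠ b' := by rintro rfl; exact hnb' ⟨g1, g2⟩
        rw [Iff.comm (a := (j+1, t) ∈ f), f2 j t g2 g1]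
        simp only [Dd, true_and]
        have q1 : (a' - 1 < t) ↔ a' ≤ t := by omega
        have q2 : b' < t → a' ≤ t := by omega
        have q3 : (b' < t) ↔ ¬ (t < b') := by omega
        rw [q1]
        grind
      · intro x t g1 g2 g3 g4
        rw [f2 x t g1 g2]
        simp only [Dd]; omega
  obtain ⟨f, f1, f2, f3⟩ := hf
  have fS : ∀ u ∈ S, ∀ v ∈ S, (u ∈ f ↔ v ∈ f) := by
    apply conn_const hconn (fun u v h => h.symm)
    have hor : ∀ x t, (x, t) ∈ S → (x+1, t) ∈ S → ((x, t) ∈ f ↔ (x+1, t) ∈ f) := by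
      intro x t h1 h2
      by_cases c1 : x = i ∧ x + 1 = j
      · obtain ⟨rfl, c1⟩ := c1
        rw [c1] at h2 ⊢
        rw [f2 t (hSF h1) (hSF h2)]
        intro ⟨c2, c3⟩
        exact hrunS t (by omega) (by omega) h1
      by_cases c2 : x = j ∧ x + 1 = i
      · obtain ⟨rfl, c2⟩ := c2
        rw [c2] at h2 ⊢
        rw [Iff.comm, f2 t (hSF h2) (hSF h1)]
        intro ⟨c2, c3⟩
        exact hrunS t (by omega) (by omega) h2
      exact f3 x t (hSF h1) (hSF h2) c1 c2
    rintro ⟨u1, u2⟩ hu ⟨v1, v2⟩ hv (⟨h1, h2 | h2⟩ | ⟨h1, h2 | h2⟩) <;> dsimp only at h1 h2 <;>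
      subst h1 <;> subst h2
    · exact f1 _ _ (hSF hu) (hSF hv)
    · exact (f1 _ _ (hSF hv) (hSF hu)).symm
    · exact hor _ _ hu hv
    · exact (hor _ _ hv hu).symm
  have frun : ∀ t, a ≤ t → t < b → ((i, t) ∈ f ↔ (i, r) ∈ f) := fun t h1 h2 =>
    int_run (p := fun t => (i, t) ∈ f) (a := a) (b := b)
      (fun t h1 h2 => f1 i t (hrun t h1 (by omega)) (hrun _ (by omega) h2)) t h1 h2 r ha hb
  have fr : ¬ ((i, r) ∈ f ↔ (j, r) ∈ f) := by
    rw [f2 r hz (hSF hz0)]; omega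
  refine ⟨S ∪ Run i a b, ?_, subset_union_left, Or.inr ⟨rfl, ha, hb⟩, ?_, ?_, ?_⟩
  · apply union_subset hSF
    rintro ⟨z1, z2⟩ ⟨h1, h2, h3⟩
    dsimp only at h1 h2 h3; subst h1
    exact hrun z2 h2 h3
  · intro x t h1 h2
    have h3 : (x, t) ∈ Run i a b ↔ (x, t+1) ∈ Run i a b := by
      simp only [Run, mem_ofPred_eq]
      constructor
      · rintro ⟨rfl, h4, h5⟩
        refine ⟨rfl, by omega, ?_⟩
        by_contra hc
        have : t + 1 = b := by omega
        rw [this] at h2; exact hnb h2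
      · rintro ⟨rfl, h4, h5⟩
        refine ⟨rfl, ?_, by omega⟩
        by_contra hc
        have : t = a - 1 := by omega
        rw [this] at h1; exact hna h1
    simp only [mem_union]
    rw [h3, hrc x t h1 h2]
  · intro T hT
    have c1 : ∀ u ∈ S, ∀ v ∈ S, u ∈ T → v ∈ T := hconn T (fun u hu v hv => hT u (Or.inl hu) v (Or.inl hv))
    have c2 := rconn (F := S ∪ Run i a b) (T := T) (i := i) (a := a) (b := b)
      (fun t h1 h2 => Or.inr ⟨rfl, h1, h2⟩) hT
    have had : Adj4 (i, r) (j, r) := by right; simp; omega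
    have m1 : (i, r) ∈ S ∪ Run i a b := Or.inr ⟨rfl, ha, hb⟩
    have c3 : (i, r) ∈ T ↔ (j, r) ∈ T :=
      ⟨hT _ m1 _ (Or.inl hz0) had, hT _ (Or.inl hz0) _ m1 had.symm⟩
    have c4 : ∀ u ∈ S ∪ Run i a b, (u ∈ T ↔ (i, r) ∈ T) := by
      rintro ⟨u1, u2⟩ (hu | ⟨h1, h2, h3⟩)
      · rw [c3]; exact ⟨c1 _ hu _ hz0, c1 _ hz0 _ hu⟩
      · dsimp only at h1 h2 h3; subst h1
        exact c2 u2 h2 h3 r ha hb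
    intro u hu v hv h
    rw [c4 u hu] at h
    rw [c4 v hv]; exact h
  · apply glue hj haa (by omega) hbb hrunS (fun h => hna (hSF h)) (fun h => hnb (hSF h)) _ _ hS
    · intro t h1 h2
      refine ⟨fun h => ?_, fun h => hdoorS t h.1 h.2⟩
      by_contra hc
      have e1 := (f2 t (hrun t h1 h2) (hSF h)).2 hc
      rw [frun t h1 h2, fS _ h _ hz0] at e1
      exact fr e1
    · intro t h1 h2 h
      have e1 : (i, t) ∈ f ↔ (2 * i - j, t) ∈ f := by
        rcases hj with hj | hj
        · have e : 2 * i - j = i - 1 := by omega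
          rw [e] at h ⊢
          have := f3 (i - 1) t (hSF h) (by simpa using hrun t h1 h2) (by omega) (by omega)
          simp at this; exact this.symm
        · have e : 2 * i - j = i + 1 := by omega
          rw [e] at h ⊢
          exact f3 i t (hrun t h1 h2) (hSF h) (by omega) (by omega)
      rw [frun t h1 h2, fS _ h _ hz0] at e1
      exact fr e1

lemma shr_VF {F : Set Q} (hfin : F.Finite) (hne : F.Nonempty) (hF4 : Conn Adj4 F)
    (hF8 : Conn Adj8 Fᶜ) : Shr (VF F) := by
  have main : ∀ n : ℕ, ∀ S ⊆ F, (F \ S).ncard = n → S.Nonempty →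
      (∀ i t, (i, t) ∈ F → (i, t+1) ∈ F → ((i, t) ∈ S ↔ (i, t+1) ∈ S)) → Conn Adj4 S →
      Shr (VF S) → Shr (VF F) := by
    intro n
    induction n using Nat.strong_induction_on with
    | _ n ih =>
      intro S hSF hn hSne hrc hconn hS
      by_cases hF : F ⊆ S
      · rwa [subset_antisymm hF hSF]
      have : ∃ u ∈ S, ∃ v ∈ F, v ∉ S ∧ Adj4 u v := by
        by_contra hc
        push Not at hc
        apply hF
        obtain ⟨u, hu⟩ := hSne
        intro v hv
        apply hF4 S _ u (hSF hu) v hv hu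
        intro x hx y hy hxy hxS
        by_contra hyS
        exact hc x hxS y hy hyS hxy
      obtain ⟨⟨u1, u2⟩, hu, ⟨v1, v2⟩, hv, hvS, had⟩ := this
      have : u2 = v2 ∧ (u1 = v1 + 1 ∨ u1 = v1 - 1) := by
        rcases had with ⟨h1, h2 | h2⟩ | ⟨h1, h2⟩
        · dsimp only at h1 h2; subst h1; subst h2
          exact absurd ((hrc _ _ (hSF hu) hv).1 hu) hvS
        · dsimp only at h1 h2; subst h1; subst h2
          exact absurd ((hrc _ _ hv (hSF hu)).2 hu) hvS
        · dsimp only at h1 h2; omega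
      obtain ⟨rfl, hj⟩ := this
      obtain ⟨S', s1, s2, s3, s4, s5, s6⟩ := shr_step hfin hF8 hSF hrc hconn hS hj hv hvS hu
      apply ih _ _ S' s1 rfl (hSne.mono s2) s4 s5 s6
      rw [← hn]
      apply Set.ncard_lt_ncard _ (hfin.sdiff)
      refine ⟨sdiff_subset_sdiff_right s2, fun h => ?_⟩
      exact (h ⟨hv, hvS⟩).2 s3
  obtain ⟨⟨i, r⟩, hz⟩ := hne
  have hinj : ∀ i : ℤ, Function.Injective (fun t : ℤ => ((i, t) : Q)) := fun i x y h => by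
    simpa using h
  obtain ⟨a, b, ha, hb, hrun, hna, hnb⟩ := int_maxrun (p := fun t => (i, t) ∈ F) hz
    (hfin.preimage (hinj i).injOn)
  refine main _ (Run i a b) ?_ rfl ⟨(i, r), rfl, ha, hb⟩ ?_ ?_ ?_
  · rintro ⟨z1, z2⟩ ⟨h1, h2, h3⟩
    dsimp only at h1 h2 h3; subst h1
    exact hrun z2 h2 h3
  · intro x t h1 h2
    simp only [Run, mem_ofPred_eq]
    constructor
    · rintro ⟨rfl, h4, h5⟩
      refine ⟨rfl, by omega, ?_⟩
      by_contra hc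
      have : t + 1 = b := by omega
      rw [this] at h2; exact hnb h2
    · rintro ⟨rfl, h4, h5⟩
      refine ⟨rfl, ?_, by omega⟩
      by_contra hc
      have : t = a - 1 := by omega
      rw [this] at h1; exact hna h1
  · rintro T hT ⟨u1, u2⟩ ⟨h1, h2, h3⟩ ⟨v1, v2⟩ ⟨h4, h5, h6⟩
    dsimp only at *; subst h1; subst h4
    exact (rconn (F := Run v1 a b) (T := T) (fun t h1 h2 => ⟨rfl, h1, h2⟩) hT u2 h2 h3 v2 h5 h6).1
  · rw [VF_Run]
    exact Shr_Rc (by linarith) (by exact_mod_cast (by omega : a < b))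

end DJ

namespace DJ

inductive Out (A : Set Q) : Q → Prop
  | far (z : Q) (h : ∀ a ∈ A, a.1 < z.1) : Out A z
  | step (u v : Q) (h : Out A u) (hv : v ∉ A) (ha : Adj8 u v) : Out A v

lemma Out.not_mem {A : Set Q} {z : Q} (h : Out A z) : z ∉ A := by
  intro hz
  cases h with
  | far _ h => exact lt_irrefl _ (h z hz)
  | step u _ h hv ha => exact hv hz

def Fill (A : Set Q) : Set Q := {z | ¬ Out A z}

lemma mem_Fill {A : Set Q} {z : Q} : z ∈ Fill A ↔ ¬ Out A z := Iff.rfl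

lemma subset_Fill (A : Set Q) : A ⊆ Fill A := fun _ hz h => h.not_mem hz

lemma fill_step {A : Set Q} {z w : Q} (hz : z ∈ Fill A) (hzA : z ∉ A) (h : Adj8 z w) : w ∈ Fill A :=
  fun hw => hz (Out.step w z hw hzA h.symm)

lemma fill_compl_conn (A : Set Q) (hA : A.Finite) : Conn Adj8 (Fill A)ᶜ := by
  have hbd : ∃ B : ℤ, ∀ a ∈ A, a.1 ≤ B := by
    obtain ⟨B, hB⟩ := (hA.image Prod.fst).bddAbove
    exact ⟨B, fun a ha => hB ⟨a, ha, rfl⟩⟩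
  obtain ⟨B, hB⟩ := hbd
  intro T hT
  have hT' : ∀ u v, Out A u → Out A v → Adj8 u v → (u ∈ T ↔ v ∈ T) := by
    intro u v hu hv h
    exact ⟨hT u (fun h => h hu) v (fun h => h hv) h, hT v (fun h => h hv) u (fun h => h hu) h.symm⟩
  have hfar : ∀ u v : Q, (∀ a ∈ A, a.1 < u.1) → (∀ a ∈ A, a.1 < v.1) → (u ∈ T ↔ v ∈ T) := by
    have hor : ∀ x y x' : ℤ, (∀ a ∈ A, a.1 < x) → x ≤ x' → ((x, y) ∈ T ↔ (x', y) ∈ T) := by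
      intro x y x' hx hxx
      refine int_run (p := fun s => (s, y) ∈ T) (a := x) (b := x' + 1) ?_ x le_rfl (by omega) x' hxx (by omega)
      intro t h1 h2
      apply hT' _ _ (Out.far _ fun a ha => by have := hx a ha; dsimp only; omega)
        (Out.far _ fun a ha => by have := hx a ha; dsimp only; omega)
      unfold Adj8; dsimp only; omega
    have ver : ∀ x y y' : ℤ, (∀ a ∈ A, a.1 < x) → ((x, y) ∈ T ↔ (x, y') ∈ T) := by
      intro x y y' hx
      refine int_run (p := fun s => (x, s) ∈ T) (a := min y y') (b := max y y' + 1) ?_ y (by omega) (by omega) y' (by omega) (by omega)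
      intro t h1 h2
      apply hT' _ _ (Out.far _ fun a ha => hx a ha)
        (Out.far _ fun a ha => hx a ha)
      unfold Adj8; dsimp only; omega
    rintro ⟨x, y⟩ ⟨x', y'⟩ h1 h2
    rw [hor x y (max x x') h1 (le_max_left _ _), hor x' y' (max x x') h2 (le_max_right _ _)]
    apply ver
    intro a ha
    have := h1 a ha; dsimp only at this; omega
  have hz0 : ∀ a ∈ A, a.1 < ((B + 1, 0) : Q).1 := fun a ha => by have := hB a ha; dsimp only; omega
  have key : ∀ v, Out A v → (v ∈ T ↔ ((B + 1, 0) : Q) ∈ T) := by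
    intro v hv
    induction hv with
    | far z h => exact hfar _ _ h hz0
    | step u v h hv ha ih =>
      rw [← ih]
      exact (hT' u v h (Out.step u v h hv ha) ha).symm
  intro u hu v hv h
  rw [key v (not_not.1 hv)]
  rwa [key u (not_not.1 hu)] at h

lemma fill_walk {A : Set Q} (hA : A.Finite) {z : Q} (hz : z ∈ Fill A) :
    ∃ n : ℕ, (z.1 + n, z.2) ∈ A ∧ ∀ m : ℕ, m ≤ n → (z.1 + m, z.2) ∈ Fill A := by
  classical
  have hbd : ∃ B : ℤ, ∀ a ∈ A, a.1 ≤ B := by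
    obtain ⟨B, hB⟩ := (hA.image Prod.fst).bddAbove
    exact ⟨B, fun a ha => hB ⟨a, ha, rfl⟩⟩
  obtain ⟨B, hB⟩ := hbd
  have stp : ∀ n : ℕ, (∀ m : ℕ, m < n → (z.1 + m, z.2) ∉ A) → (z.1 + n, z.2) ∈ Fill A := by
    intro n
    induction n with
    | zero => intro _; simpa using hz
    | succ n ih =>
      intro h
      refine fill_step (ih fun m hm => h m (by omega)) (h n (by omega)) ?_
      unfold Adj8; dsimp only; push_cast; omega
  have hex : ∃ n : ℕ, (z.1 + n, z.2) ∈ A := by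
    by_contra hc
    push Not at hc
    refine stp (B - z.1 + 1).toNat (fun m _ => hc m) (Out.far _ ?_)
    intro a ha
    have := hB a ha
    dsimp only; omega
  refine ⟨Nat.find hex, Nat.find_spec hex, ?_⟩
  intro m hm
  apply stp
  intro k hk
  exact Nat.find_min hex (by omega)

lemma fill_left {A : Set Q} (hA : A.Finite) {z : Q} (hz : z ∈ Fill A) : ∃ a ∈ A, a.1 ≤ z.1 := by
  by_contra hc
  push Not at hc
  have hbd : ∃ B : ℤ, ∀ a ∈ A, a.2 ≤ B := by
    obtain ⟨B, hB⟩ := (hA.image Prod.snd).bddAbove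
    exact ⟨B, fun a ha => hB ⟨a, ha, rfl⟩⟩
  obtain ⟨B, hB⟩ := hbd
  have up : ∀ n : ℕ, (z.1, z.2 + n) ∈ Fill A := by
    intro n
    induction n with
    | zero => simpa using hz
    | succ n ih =>
      refine fill_step ih (fun h => lt_irrefl z.1 (hc (z.1, z.2 + (n:ℤ)) h)) ?_
      unfold Adj8; dsimp only; push_cast; omega
  obtain ⟨n, hn, -⟩ := fill_walk hA (up (B - z.2 + 1).toNat)
  have := hB _ hn
  dsimp only at this; omega

lemma fill_right {A : Set Q} (hA : A.Finite) {z : Q} (hz : z ∈ Fill A) :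
    ∃ a ∈ A, z.1 ≤ a.1 ∧ a.2 = z.2 := by
  obtain ⟨n, hn, -⟩ := fill_walk hA hz
  exact ⟨_, hn, by dsimp only; omega, rfl⟩

lemma fill_finite {A : Set Q} (hA : A.Finite) : (Fill A).Finite := by
  obtain ⟨B, hB⟩ := (hA.image Prod.fst).bddAbove
  obtain ⟨C, hC⟩ := (hA.image Prod.fst).bddBelow
  apply ((Set.finite_Icc C B).prod (hA.image Prod.snd)).subset
  intro z hz
  obtain ⟨a, ha, ha'⟩ := fill_left hA hz
  obtain ⟨b, hb, hb', hb''⟩ := fill_right hA hz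
  have h1 := hB ⟨b, hb, rfl⟩
  have h2 := hC ⟨a, ha, rfl⟩
  exact ⟨⟨by omega, by omega⟩, ⟨b, hb, hb''⟩⟩

lemma fill_conn {A : Set Q} (hA : A.Finite) (hc : Conn Adj4 A) : Conn Adj4 (Fill A) := by
  intro T hT
  have hAT : ∀ u ∈ A, ∀ v ∈ A, u ∈ T → v ∈ T := hc T (fun u hu v hv =>
    hT u (subset_Fill A hu) v (subset_Fill A hv))
  have hw : ∀ z ∈ Fill A, ∃ a ∈ A, (z ∈ T ↔ a ∈ T) := by
    intro z hz
    obtain ⟨n, h1, h2⟩ := fill_walk hA hz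
    refine ⟨_, h1, ?_⟩
    have : ∀ m : ℕ, m ≤ n → (z ∈ T ↔ (z.1 + m, z.2) ∈ T) := by
      intro m
      induction m with
      | zero => intro _; simp
      | succ m ih =>
        intro hm
        rw [ih (by omega)]
        have had : Adj4 (z.1 + (m:ℤ), z.2) (z.1 + ((m+1 : ℕ) : ℤ), z.2) := by
          right; simp; left; ring
        exact ⟨hT _ (h2 m (by omega)) _ (h2 _ hm) had, hT _ (h2 _ hm) _ (h2 m (by omega)) had.symm⟩
    exact this n le_rfl
  intro u hu v hv h
  obtain ⟨a, ha, ha'⟩ := hw u hu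
  obtain ⟨b, hb, hb'⟩ := hw v hv
  rw [hb']; exact hAT a ha b hb (ha'.1 h)

lemma adj48 {u v : Q} (h : Adj4 u v) : Adj8 u v := by
  unfold Adj4 at h; unfold Adj8; omega

lemma fill_lam {A B : Set Q} (hA : A.Finite) (hB : B.Finite) (hAc : Conn Adj4 A) (hBc : Conn Adj4 B)
    (hd : Disjoint A B) (hBn : B.Nonempty) (hAn : A.Nonempty) :
    Fill A ⊆ Fill B ∨ Fill B ⊆ Fill A ∨ Disjoint (Fill A) (Fill B) := by
  have L1 : ∀ A B : Set Q, Conn Adj4 B → Disjoint A B → B.Nonempty →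
      (∀ b ∈ B, Out A b) ∨ B ⊆ Fill A := by
    intro A B hBc hd hBn
    by_cases h : ∃ b ∈ B, Out A b
    · obtain ⟨b, hb, hb'⟩ := h
      left
      intro v hv
      refine hBc {z | Out A z} ?_ b hb v hv hb'
      intro x hx y hy hxy hxo
      exact Out.step x y hxo (fun h => hd.le_bot ⟨h, hy⟩) (adj48 hxy)
    · right
      intro b hb hb'; exact h ⟨b, hb, hb'⟩
  have L2 : ∀ A B : Set Q, A.Finite → B ⊆ Fill A → Fill B ⊆ Fill A := by
    intro A B hA hBA z hz hzA
    apply hz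
    clear hz
    induction hzA with
    | far z h =>
      apply Out.far
      intro b hb
      obtain ⟨a, ha, ha', -⟩ := fill_right hA (hBA hb)
      have := h a ha; omega
    | step u v h hv ha ih =>
      exact Out.step u v ih (fun hb => hBA hb (Out.step u v h hv ha)) ha
  rcases L1 A B hBc hd hBn with h1 | h1
  · rcases L1 B A hAc hd.symm hAn with h2 | h2
    · right; right
      rw [Set.disjoint_left]
      intro x hx hx'
      obtain ⟨n, a1, a2⟩ := fill_walk hA hx
      obtain ⟨n', b1, b2⟩ := fill_walk hB hx'
      rcases le_total n n' with h | h
      · exact b2 n h (h2 _ a1)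
      · exact a2 n' h (h1 _ b1)
    · left; exact L2 B A hB h2
  · right; left; exact L2 A B hA h1

lemma exists_comp (S : Set Q) {u : Q} (hu : u ∈ S) : ∃ A ⊆ S, u ∈ A ∧ Conn Adj4 A ∧
    ∀ x ∈ A, ∀ y ∈ S, Adj4 x y → y ∈ A := by
  refine ⟨{v | Relation.ReflTransGen (fun x y => x ∈ S ∧ y ∈ S ∧ Adj4 x y) u v}, ?_, ?_, ?_, ?_⟩
  · intro v hv
    cases hv with
    | refl => exact hu
    | tail _ h => exact h.2.1
  · exact Relation.ReflTransGen.refl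
  · intro T hT
    have : ∀ v, Relation.ReflTransGen (fun x y => x ∈ S ∧ y ∈ S ∧ Adj4 x y) u v → (u ∈ T ↔ v ∈ T) := by
      intro v hv
      induction hv with
      | refl => rfl
      | tail h1 h2 ih =>
        rw [ih]
        exact ⟨hT _ h1 _ (h1.tail h2) h2.2.2, hT _ (h1.tail h2) _ h1 h2.2.2.symm⟩
    intro x hx y hy h
    rw [← this y hy, this x hx]; exact h
  · intro x hx y hy hxy
    refine Relation.ReflTransGen.tail hx ⟨?_, hy, hxy⟩
    cases hx with
    | refl => exact hu
    | tail _ h => exact h.2.1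

/-- clusters -/
lemma clusters (S : Set Q) (hS : S.Finite) : ∃ 𝓜 : Set (Set Q), 𝓜.Finite ∧
    (∀ F ∈ 𝓜, ∀ G ∈ 𝓜, F ≠ G → Disjoint F G) ∧
    (∀ F ∈ 𝓜, Shr (VF F) ∧ ∃ A ⊆ S, A.Nonempty ∧ A.Finite ∧ Conn Adj4 A ∧ F = Fill A) ∧
    (∀ B ⊆ S, B.Nonempty → Conn Adj4 B → ∃ F ∈ 𝓜, B ⊆ F) := by
  set 𝓒 : Set (Set Q) := {A | A ⊆ S ∧ A.Nonempty ∧ Conn Adj4 A ∧ ∀ x ∈ A, ∀ y ∈ S, Adj4 x y → y ∈ A} with h𝓒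
  have h𝓒fin : 𝓒.Finite := hS.finite_subsets.subset (fun A hA => hA.1)
  set 𝓕 : Set (Set Q) := Fill '' 𝓒 with h𝓕
  have h𝓕fin : 𝓕.Finite := h𝓒fin.image _
  have hlam : ∀ F ∈ 𝓕, ∀ G ∈ 𝓕, F ⊆ G ∨ G ⊆ F ∨ Disjoint F G := by
    rintro _ ⟨A, ⟨a1, a2, a3, a4⟩, rfl⟩ _ ⟨B, ⟨b1, b2, b3, b4⟩, rfl⟩
    by_cases hAB : Disjoint A B
    · exact fill_lam (hS.subset a1) (hS.subset b1) a3 b3 hAB b2 a2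
    · have sub : ∀ A B : Set Q, A ⊆ S → B ⊆ S → Conn Adj4 A → (∀ x ∈ B, ∀ y ∈ S, Adj4 x y → y ∈ B) →
          (A ∩ B).Nonempty → A ⊆ B := by
        rintro A B hA hB hAc hBc ⟨x, hxA, hxB⟩ y hy
        exact hAc B (fun u _ v hv huv huB => hBc u huB v (hA hv) huv) x hxA y hy hxB
      have hne := Set.not_disjoint_iff_nonempty_inter.1 hAB
      have : A = B := subset_antisymm (sub A B a1 b1 a3 b4 hne) (sub B A b1 a1 b3 a4 (by rwa [inter_comm]))
      left; rw [this]
  refine ⟨{F | F ∈ 𝓕 ∧ ∀ G ∈ 𝓕, F ⊆ G → G = F}, h𝓕fin.subset (fun F h => h.1), ?_, ?_, ?_⟩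
  · rintro F ⟨h1, h2⟩ G ⟨h3, h4⟩ hne
    rcases hlam F h1 G h3 with h | h | h
    · exact absurd (h2 G h3 h).symm hne
    · exact absurd (h4 F h1 h) hne
    · exact h
  · rintro F ⟨⟨A, ⟨a1, a2, a3, a4⟩, rfl⟩, -⟩
    have hf := hS.subset a1
    exact ⟨shr_VF (fill_finite hf) (a2.mono (subset_Fill A)) (fill_conn hf a3) (fill_compl_conn A hf),
      A, a1, a2, hf, a3, rfl⟩
  · rintro B hB ⟨b, hb⟩ hBc
    obtain ⟨A, a1, a2, a3, a4⟩ := exists_comp S (hB hb)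
    have hBA : B ⊆ A := fun y hy => hBc A (fun u _ v hv huv hu => a4 u hu v (hB hv) huv) b hb y hy a2
    have hAF : Fill A ∈ 𝓕 := ⟨A, ⟨a1, ⟨b, a2⟩, a3, a4⟩, rfl⟩
    obtain ⟨F, hF, hF'⟩ := h𝓕fin.exists_le_maximal hAF
    refine ⟨F, ⟨hF'.1, fun G hG hFG => ?_⟩, (hBA.trans (subset_Fill A)).trans hF⟩
    exact subset_antisymm (hF'.2 hG hFG) hFG

/-- locally constant labels -/
lemma exists_label {K : Type} [TopologicalSpace K] [CompactSpace K] [T2Space K]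
    [TotallyDisconnectedSpace K] (U : K → Set K) (hU : ∀ x, U x ∈ 𝓝 x) :
    ∃ (ι : Type) (_ : Finite ι) (ℓ : K → ι), IsLocallyConstant ℓ ∧ ∀ x, ∃ y, ∀ x', ℓ x' = ℓ x → x' ∈ U y := by
  have h1 : ∀ x, ∃ C : Set K, IsClopen C ∧ x ∈ C ∧ C ⊆ U x := by
    intro x
    obtain ⟨C, hC, h1, h2⟩ := (isTopologicalBasis_isClopen (X := K)).mem_nhds_iff.1 (hU x)
    exact ⟨C, hC, h1, h2⟩
  choose C hC hxC hCU using h1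
  obtain ⟨t, ht⟩ := isCompact_univ.elim_finite_subcover C (fun x => (hC x).isOpen)
    (fun x _ => mem_iUnion.2 ⟨x, hxC x⟩)
  refine ⟨Set t, inferInstance, fun x => {i | x ∈ C i}, ?_, ?_⟩
  · rw [IsLocallyConstant.iff_eventually_eq]
    intro x
    have : ∀ i : t, ∀ᶠ y in 𝓝 x, (y ∈ C i ↔ x ∈ C i) := by
      intro i
      by_cases h : x ∈ C i
      · filter_upwards [(hC i).isOpen.mem_nhds h] with y hy
        exact ⟨fun _ => h, fun _ => hy⟩
      · filter_upwards [(hC i).compl.isOpen.mem_nhds h] with y hy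
        exact ⟨fun h' => absurd h' hy, fun h' => absurd h' h⟩
    filter_upwards [eventually_all.2 this] with y hy
    ext i; exact hy i
  · intro x
    have := ht (mem_univ x)
    simp only [mem_iUnion] at this
    obtain ⟨i, hi, hx⟩ := this
    refine ⟨i, fun x' hx' => hCU i ?_⟩
    dsimp only at hx'
    have : (⟨i, hi⟩ : t) ∈ {i : t | x' ∈ C i} := by rw [hx']; exact hx
    exact this

/-- labels are separated under an injective map -/
lemma label_sep {K : Type} [TopologicalSpace K] [CompactSpace K] {ι : Type} (ℓ : K → ι)
    (hℓ : IsLocallyConstant ℓ) (j : K → P) (hj : Continuous j) (hi : Function.Injective j) :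
    ∃ δ > 0, ∀ x y, dist (j x) (j y) < δ → ℓ x = ℓ y := by
  set D : Set (K × K) := {q | ℓ q.1 ≠ ℓ q.2} with hD
  have hDc : IsCompact D := by
    apply IsClosed.isCompact
    have : IsLocallyConstant (fun q : K × K => ℓ q.1 = ℓ q.2) := by
      have h1 : IsLocallyConstant (fun q : K × K => ℓ q.1) := hℓ.comp_continuous continuous_fst
      have h2 : IsLocallyConstant (fun q : K × K => ℓ q.2) := hℓ.comp_continuous continuous_snd
      exact h1.comp₂ h2 (fun a b => a = b)
    have h3 := this.isClosed_fiber False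
    convert h3 using 1
    ext q; simp [hD]
  have hc : Continuous (fun q : K × K => dist (j q.1) (j q.2)) := by fun_prop
  rcases D.eq_empty_or_nonempty with h | h
  · refine ⟨1, one_pos, fun x y _ => ?_⟩
    by_contra hne
    have : (x, y) ∈ D := hne
    rw [h] at this; exact this
  · obtain ⟨q, hq, hmin⟩ := hDc.exists_isMinOn h hc.continuousOn
    refine ⟨dist (j q.1) (j q.2), ?_, ?_⟩
    · rw [gt_iff_lt, dist_pos]
      intro he; apply hq; rw [hi he]
    · intro x y hxy
      by_contra hne
      have := hmin (show (x, y) ∈ D from hne)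
      simp only [mem_ofPred_eq] at this
      linarith

lemma block_conn (c : Q) : Conn Adj4 {z | Adj8 z c} := by
  intro T hT
  have hc : c ∈ {z | Adj8 z c} := by show Adj8 c c; unfold Adj8; omega
  have key : ∀ z ∈ {z | Adj8 z c}, (z ∈ T ↔ c ∈ T) := by
    rintro ⟨x, y⟩ hz
    have hz' := hz
    simp only [mem_ofPred_eq, Adj8] at hz'
    have h1 := rconn (F := {z | Adj8 z c}) (T := T) (i := x) (a := c.2 - 1) (b := c.2 + 2)
      (fun t h1 h2 => by show Adj8 _ _; unfold Adj8; dsimp only; omega) hT y (by omega) (by omega)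
      c.2 (by omega) (by omega)
    rw [h1]
    by_cases hx : x = c.1
    · rw [hx]
    · have had : Adj4 (x, c.2) c := by right; dsimp only; omega
      have hm : (x, c.2) ∈ {z | Adj8 z c} := by show Adj8 _ _; unfold Adj8; dsimp only; omega
      exact ⟨hT _ hm _ hc had, hT _ hc _ hm had.symm⟩
  intro u hu v hv h
  rw [key v hv]; rwa [key u hu] at h

lemma cover_P {K : Type} [TopologicalSpace K] [CompactSpace K] [T2Space K]
    [TotallyDisconnectedSpace K] (j : K → P) (hj : Continuous j) (hi : Function.Injective j)
    (O : K → Set P) (hO : ∀ x, O x ∈ 𝓝 (j x)) :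
    ∃ (ι : Type) (_ : Finite ι) (V : ι → Set P), (∀ l, Shr (V l)) ∧
      (∀ l l', l ≠ l' → Disjoint (V l) (V l')) ∧ (∀ l, IsCompact (closure (V l))) ∧
      (∀ l, ∃ y, closure (V l) ⊆ O y) ∧ ∀ x, ∃ l, j x ∈ V l := by
  have h1 : ∀ x, ∃ r > 0, Metric.ball (j x) (3 * r) ⊆ O x := by
    intro x
    obtain ⟨ε, hε, h⟩ := Metric.mem_nhds_iff.1 (hO x)
    exact ⟨ε / 3, by positivity, by rwa [mul_div_cancel₀ _ (by norm_num)]⟩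
  choose r hr hrO using h1
  obtain ⟨ι, hfin, ℓ, hℓ, hy⟩ := exists_label (fun x => j ⁻¹' Metric.ball (j x) (r x))
    (fun x => hj.continuousAt (Metric.ball_mem_nhds _ (hr x)))
  obtain ⟨δ, hδ, hsep⟩ := label_sep ℓ hℓ j hj hi
  choose y hy using hy
  -- minimal radius
  have hρ : ∃ ρ > 0, ∀ x, ∃ y, ρ ≤ r y ∧ ∀ x', ℓ x' = ℓ x → dist (j x') (j y) < r y := by
    classical
    have hyl : ∀ c : ι, ∃ ρ > 0, (∃ x, ℓ x = c) → ∃ y, ρ ≤ r y ∧ ∀ x', ℓ x' = c → dist (j x') (j y) < r y := by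
      intro c
      by_cases h : ∃ x, ℓ x = c
      · obtain ⟨x, rfl⟩ := h
        exact ⟨r (y x), hr _, fun _ => ⟨y x, le_rfl, fun x' hx' => hy x x' hx'⟩⟩
      · exact ⟨1, one_pos, fun h' => absurd h' h⟩
    choose ρ hρ0 hρ using hyl
    rcases isEmpty_or_nonempty ι with he | hne
    · exact ⟨1, one_pos, fun x => (he.false (ℓ x)).elim⟩
    · obtain ⟨c, hc⟩ := Finite.exists_min ρ
      refine ⟨ρ c, hρ0 c, fun x => ?_⟩
      obtain ⟨y, h1, h2⟩ := hρ (ℓ x) ⟨x, rfl⟩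
      exact ⟨y, (hc _).trans h1, h2⟩
  obtain ⟨ρ, hρ0, hρ⟩ := hρ
  obtain ⟨N, hN⟩ := exists_nat_gt (max (5 / δ) (5 / ρ))
  have hN1 : 5 < N * δ := by
    have := (le_max_left _ _).trans_lt hN; rwa [div_lt_iff₀ hδ] at this
  have hN2 : 5 < N * ρ := by
    have := (le_max_right _ _).trans_lt hN; rwa [div_lt_iff₀ hρ0] at this
  have hN0 : (0:ℝ) < N := by
    have : 0 < 5 / δ := by positivity
    have := (le_max_left _ _).trans_lt hN
    linarith
  set cell : K → Q := fun x => (⌊(N:ℝ) * (j x).1⌋, ⌊(N:ℝ) * (j x).2⌋) with hcell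
  set S : Set Q := {z | ∃ x, Adj8 z (cell x)} with hS
  -- bounds
  have hb : ∀ z x, Adj8 z (cell x) → |(z.1:ℝ) - N * (j x).1| ≤ 2 ∧ |(z.2:ℝ) - N * (j x).2| ≤ 2 := by
    intro z x hz
    obtain ⟨a1, a2, a3, a4⟩ := hz
    simp only [hcell] at a1 a2 a3 a4
    have f1 := Int.floor_le ((N:ℝ) * (j x).1)
    have f2 := Int.lt_floor_add_one ((N:ℝ) * (j x).1)
    have f3 := Int.floor_le ((N:ℝ) * (j x).2)
    have f4 := Int.lt_floor_add_one ((N:ℝ) * (j x).2)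
    have a1' : (z.1:ℝ) ≤ ⌊(N:ℝ) * (j x).1⌋ + 1 := by exact_mod_cast a1
    have a2' : (⌊(N:ℝ) * (j x).1⌋ : ℝ) ≤ z.1 + 1 := by exact_mod_cast a2
    have a3' : (z.2:ℝ) ≤ ⌊(N:ℝ) * (j x).2⌋ + 1 := by exact_mod_cast a3
    have a4' : (⌊(N:ℝ) * (j x).2⌋ : ℝ) ≤ z.2 + 1 := by exact_mod_cast a4
    rw [abs_le, abs_le]
    refine ⟨⟨?_, ?_⟩, ?_, ?_⟩ <;> linarith
  have hSfin : S.Finite := by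
    obtain ⟨C, hC⟩ := (isCompact_range hj).isBounded.exists_norm_le
    apply ((Set.finite_Icc (-⌈N * C + 2⌉) ⌈N * C + 2⌉).prod (Set.finite_Icc (-⌈N * C + 2⌉) ⌈N * C + 2⌉)).subset
    rintro z ⟨x, hx⟩
    obtain ⟨h1, h2⟩ := hb z x hx
    have hCx := hC _ ⟨x, rfl⟩
    rw [Prod.norm_def, max_le_iff, Real.norm_eq_abs, Real.norm_eq_abs] at hCx
    have g : ∀ (w : ℤ) (q : ℝ), |(w:ℝ) - N * q| ≤ 2 → |q| ≤ C → w ∈ Icc (-⌈N * C + 2⌉) ⌈N * C + 2⌉ := by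
      intro w q e1 e2
      rw [abs_le] at e1 e2
      have e3 := Int.le_ceil (N * C + 2)
      have e4 : N * q ≤ N * C := mul_le_mul_of_nonneg_left e2.2 hN0.le
      have e5 : N * (-C) ≤ N * q := mul_le_mul_of_nonneg_left e2.1 hN0.le
      constructor
      · have : ((-⌈N * C + 2⌉ : ℤ) : ℝ) ≤ w := by push_cast; linarith
        exact_mod_cast this
      · have : (w:ℝ) ≤ ((⌈N * C + 2⌉ : ℤ) : ℝ) := by push_cast; linarith
        exact_mod_cast this
    exact ⟨g _ _ h1 hCx.1, g _ _ h2 hCx.2⟩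
  obtain ⟨𝓜, h𝓜f, hdis, hM, hcov⟩ := clusters S hSfin
  have hN0' : (N:ℝ)⁻¹ ≠ 0 := inv_ne_zero hN0.ne'
  set sc : P ≃ₜ P := Homeomorph.smulOfNeZero (N:ℝ)⁻¹ hN0' with hsc
  have hsc1 : ∀ p, (sc p).1 = (N:ℝ)⁻¹ * p.1 := fun p => rfl
  have hsc2 : ∀ p, (sc p).2 = (N:ℝ)⁻¹ * p.2 := fun p => rfl
  have hsub : ∀ F ∈ 𝓜, ∃ y, sc '' VF F ⊆ Metric.ball (j y) (2 * r y) := by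
    intro F hF
    obtain ⟨-, A, hAS, ⟨a0, ha0⟩, hAf, hAc, rfl⟩ := hM F hF
    have hAS' : ∀ a ∈ A, ∃ x, Adj8 a (cell x) := fun a ha => hAS ha
    obtain ⟨x0, hx0⟩ := hAS' a0 ha0
    -- all labels agree
    have hlab : ∀ a ∈ A, ∃ x, Adj8 a (cell x) ∧ ℓ x = ℓ x0 := by
      have hsame : ∀ a b x x', Adj8 a b → Adj8 a (cell x) → Adj8 b (cell x') → ℓ x = ℓ x' := by
        intro a b x x' hab hax hbx
        apply hsep
        obtain ⟨b1, b2⟩ := hb a x hax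
        obtain ⟨b3, b4⟩ := hb b x' hbx
        obtain ⟨c1, c2, c3, c4⟩ := hab
        have c1' : (a.1:ℝ) ≤ b.1 + 1 := by exact_mod_cast c1
        have c2' : (b.1:ℝ) ≤ a.1 + 1 := by exact_mod_cast c2
        have c3' : (a.2:ℝ) ≤ b.2 + 1 := by exact_mod_cast c3
        have c4' : (b.2:ℝ) ≤ a.2 + 1 := by exact_mod_cast c4
        rw [abs_le] at b1 b2 b3 b4
        rw [Prod.dist_eq, max_lt_iff, Real.dist_eq, Real.dist_eq, abs_lt, abs_lt]
        refine ⟨⟨?_, ?_⟩, ?_, ?_⟩ <;> nlinarith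
      intro a ha
      refine hAc {z | ∃ x, Adj8 z (cell x) ∧ ℓ x = ℓ x0} ?_ a0 ha0 a ha ⟨x0, hx0, rfl⟩
      rintro u hu v hv huv ⟨x, hx, hx'⟩
      obtain ⟨x2, hx2⟩ := hAS' v hv
      exact ⟨x2, hx2, by rw [← hx']; exact (hsame u v x x2 (adj48 huv) hx hx2).symm⟩
    obtain ⟨y, hy1, hy2⟩ := hρ x0
    refine ⟨y, ?_⟩
    rintro _ ⟨p, hp, rfl⟩
    have hpF := hp _ (mem_Sq_floor p)
    obtain ⟨a, ha, ha1⟩ := fill_left hAf hpF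
    obtain ⟨b, hb', hb1, hb2⟩ := fill_right hAf hpF
    obtain ⟨xa, hxa, hla⟩ := hlab a ha
    obtain ⟨xb, hxb, hlb⟩ := hlab b hb'
    obtain ⟨b1, -⟩ := hb a xa hxa
    obtain ⟨b3, b4⟩ := hb b xb hxb
    have da := hy2 xa hla
    have db := hy2 xb hlb
    rw [Prod.dist_eq, max_lt_iff, Real.dist_eq, Real.dist_eq, abs_lt, abs_lt] at da db
    rw [abs_le] at b1 b3 b4
    dsimp only at ha1 hb1 hb2
    have ha1' : (a.1:ℝ) ≤ ⌊p.1⌋ := by exact_mod_cast ha1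
    have hb1' : (⌊p.1⌋:ℝ) ≤ b.1 := by exact_mod_cast hb1
    have hb2' : (b.2:ℝ) = ⌊p.2⌋ := by exact_mod_cast hb2
    have f1 := Int.floor_le p.1
    have f2 := Int.lt_floor_add_one p.1
    have f3 := Int.floor_le p.2
    have f4 := Int.lt_floor_add_one p.2
    have hNr : 5 < N * r y := hN2.trans_le (mul_le_mul_of_nonneg_left hy1 hN0.le)
    have m1 : (N:ℝ) * (sc p).1 = p.1 := by rw [hsc1]; field_simp
    have m2 : (N:ℝ) * (sc p).2 = p.2 := by rw [hsc2]; field_simp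
    rw [Metric.mem_ball, Prod.dist_eq, max_lt_iff, Real.dist_eq, Real.dist_eq, abs_lt, abs_lt]
    refine ⟨⟨?_, ?_⟩, ?_, ?_⟩ <;> nlinarith
  refine ⟨𝓜, h𝓜f, fun F => sc '' VF F, ?_, ?_, ?_, ?_, ?_⟩
  · intro F; exact (hM F F.2).1.image sc
  · intro F G hne
    rw [Set.disjoint_image_iff sc.injective]
    exact VF_disjoint (hdis F F.2 G G.2 (fun h => hne (Subtype.ext h)))
  · intro F
    obtain ⟨y, hy⟩ := hsub F F.2
    exact (Metric.isBounded_ball.subset hy).isCompact_closure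
  · intro F
    obtain ⟨y, hy⟩ := hsub F F.2
    refine ⟨y, ((closure_mono hy).trans Metric.closure_ball_subset_closedBall).trans
      (subset_trans ?_ (hrO y))⟩
    apply Metric.closedBall_subset_ball
    have := hr y; linarith
  · intro x
    obtain ⟨F, hF, hBF⟩ := hcov {z | Adj8 z (cell x)} (fun z hz => ⟨x, hz⟩)
      ⟨cell x, by show Adj8 _ _; unfold Adj8; omega⟩ (block_conn _)
    refine ⟨⟨F, hF⟩, (N:ℝ) • j x, ?_, ?_⟩
    · intro z hz
      apply hBF
      obtain ⟨⟨z1, z2⟩, z3, z4⟩ := hz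
      have e1 : z.1 ≤ ⌊(N:ℝ) * (j x).1⌋ := Int.le_floor.2 z1
      have e2 : ⌊(N:ℝ) * (j x).1⌋ ≤ z.1 + 1 := by
        have : (⌊(N:ℝ) * (j x).1⌋ : ℝ) ≤ ((z.1 + 1 : ℤ) : ℝ) := by
          push_cast; exact (Int.floor_le _).trans z2
        exact_mod_cast this
      have e3 : z.2 ≤ ⌊(N:ℝ) * (j x).2⌋ := Int.le_floor.2 z3
      have e4 : ⌊(N:ℝ) * (j x).2⌋ ≤ z.2 + 1 := by
        have : (⌊(N:ℝ) * (j x).2⌋ : ℝ) ≤ ((z.2 + 1 : ℤ) : ℝ) := by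
          push_cast; exact (Int.floor_le _).trans z4
        exact_mod_cast this
      show Adj8 _ _
      unfold Adj8
      simp only [hcell]
      omega
    · show (N:ℝ)⁻¹ • ((N:ℝ) • j x) = j x
      rw [inv_smul_smul₀ hN0.ne']

end DJ

namespace DJ

def Surf (M : Type*) [TopologicalSpace M] : Prop := ∀ m : M, ∃ c : P → M, IsOpenEmbedding c ∧ c 0 = m

lemma surf_P : Surf P := fun m => ⟨fun p => m + p, (Homeomorph.addLeft m).isOpenEmbedding, by simp⟩

lemma ball_chart (p : P) {r : ℝ} (hr : 0 < r) :
    ∃ b : P → P, IsOpenEmbedding b ∧ b 0 = p ∧ range b = Metric.ball p r := by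
  refine ⟨OpenPartialHomeomorph.univBall p r, ?_, ?_, ?_⟩
  · exact (OpenPartialHomeomorph.univBall p r).to_isOpenEmbedding (OpenPartialHomeomorph.univBall_source p r)
  · exact OpenPartialHomeomorph.univBall_apply_zero p r
  · rw [← image_univ, ← OpenPartialHomeomorph.univBall_source p r,
      (OpenPartialHomeomorph.univBall p r).image_source_eq_target, OpenPartialHomeomorph.univBall_target p hr]

lemma surf_of {M : Type*} [TopologicalSpace M] 
    (hsurf : ∀ m : M, ∃ U : Set M, IsOpen U ∧ m ∈ U ∧
      ∃ V : Set (ℝ × ℝ), IsOpen V ∧ Nonempty (U ≃ₜ V)) : Surf M := by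
  intro m
  obtain ⟨U, hU, hm, V, hV, ⟨e⟩⟩ := hsurf m
  obtain ⟨r, hr, hrV⟩ := Metric.isOpen_iff.1 hV _ (e ⟨m, hm⟩).2
  obtain ⟨b, hb, hb0, hbr⟩ := ball_chart (e ⟨m, hm⟩ : P) hr
  have hbV : ∀ p, b p ∈ V := fun p => hrV (hbr ▸ mem_range_self p)
  have h1 : IsOpenEmbedding (fun p => (⟨b p, hbV p⟩ : V)) :=
    IsOpenEmbedding.of_comp _ hV.isOpenEmbedding_subtypeVal hb
  refine ⟨fun p => (e.symm ⟨b p, hbV p⟩ : M), 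
    hU.isOpenEmbedding_subtypeVal.comp (e.symm.isOpenEmbedding.comp h1), ?_⟩
  have : (⟨b 0, hbV 0⟩ : V) = e ⟨m, hm⟩ := Subtype.ext hb0
  simp only [this, e.symm_apply_apply]

/-- transfer of a homeomorphism through a chart -/
lemma transfer {M : Type*} [TopologicalSpace M] [T2Space M] {c : P → M} (hc : IsOpenEmbedding c)
    (ψ : P ≃ₜ P) {Z : Set P} (hZ : IsCompact Z) (hid : ∀ p, p ∉ Z → ψ p = p) :
    ∃ Ψ : M ≃ₜ M, (∀ p, Ψ (c p) = c (ψ p)) ∧ ∀ m, m ∉ range c → Ψ m = m := by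
  classical
  set T : (P ≃ₜ P) → M → M := fun ψ m => if h : ∃ p, c p = m then c (ψ h.choose) else m with hT
  have T1 : ∀ (ψ : P ≃ₜ P) p, T ψ (c p) = c (ψ p) := by
    intro ψ p
    have h : ∃ q, c q = c p := ⟨p, rfl⟩
    simp only [hT, dif_pos h]
    rw [hc.injective h.choose_spec]
  have T2 : ∀ (ψ : P ≃ₜ P) m, m ∉ range c → T ψ m = m := by
    intro ψ m hm
    simp only [hT]
    exact dif_neg hm
  have T3 : ∀ (ψ : P ≃ₜ P), (∀ p, p ∉ Z → ψ p = p) → Continuous (T ψ) := by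
    intro ψ hid
    rw [continuous_iff_continuousAt]
    intro m
    by_cases hm : m ∈ range c
    · obtain ⟨p, rfl⟩ := hm
      rw [← hc.continuousAt_iff]
      have : T ψ ∘ c = c ∘ ψ := by ext p; exact T1 ψ p
      rw [this]
      exact (hc.continuous.comp ψ.continuous).continuousAt
    · have h1 : IsOpen (c '' Z)ᶜ := (hZ.image hc.continuous).isClosed.isOpen_compl
      have h2 : m ∈ (c '' Z)ᶜ := fun ⟨p, _, h⟩ => hm ⟨p, h⟩
      have : T ψ =ᶠ[𝓝 m] id := by
        filter_upwards [h1.mem_nhds h2] with x hx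
        by_cases hxr : x ∈ range c
        · obtain ⟨p, rfl⟩ := hxr
          rw [T1, hid p (fun h => hx ⟨p, h, rfl⟩)]; rfl
        · exact T2 ψ x hxr
      exact continuousAt_id.congr this.symm
  have T4 : ∀ ψ φ : P ≃ₜ P, (∀ p, ψ (φ p) = p) → ∀ m, T ψ (T φ m) = m := by
    intro ψ φ h m
    by_cases hm : m ∈ range c
    · obtain ⟨p, rfl⟩ := hm
      rw [T1, T1, h]
    · rw [T2 φ m hm, T2 ψ m hm]
  refine ⟨⟨⟨T ψ, T ψ.symm, T4 _ _ (by simp), T4 _ _ (by simp)⟩, T3 ψ hid, 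
    T3 ψ.symm (symm_id_off ψ hid)⟩, T1 ψ, T2 ψ⟩

lemma Shr.chart {M : Type*} [TopologicalSpace M] [T2Space M] {c : P → M} (hc : IsOpenEmbedding c)
    {V : Set P} (hV : Shr V) (hcl : IsCompact (closure V)) : Shr (c '' V) := by
  obtain ⟨hVo, p, hp, H⟩ := hV
  refine ⟨hc.isOpenMap V hVo, c p, ⟨p, hp, rfl⟩, ?_⟩
  intro O hO F hF hFV
  obtain ⟨ψ, h1, h2⟩ := H (c ⁻¹' O) (hc.continuous.continuousAt hO) (c ⁻¹' F)
    (hc.isInducing.isCompact_preimage_iff (hFV.trans (image_subset_range _ _)) |>.2 hF) (by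
      intro x hx
      obtain ⟨y, hy, hxy⟩ := hFV hx
      rwa [← hc.injective hxy])
  obtain ⟨Ψ, g1, g2⟩ := transfer hc ψ hcl (fun p hp => h1 p (fun h => hp (subset_closure h)))
  refine ⟨Ψ, ?_, ?_⟩
  · intro x hx
    by_cases hxr : x ∈ range c
    · obtain ⟨q, rfl⟩ := hxr
      rw [g1, h1 q (fun h => hx ⟨q, h, rfl⟩)]
    · exact g2 x hxr
  · intro x hx
    obtain ⟨y, hy, rfl⟩ := hFV hx
    rw [g1]
    exact h2 y hx

lemma cover_M {M : Type*} [TopologicalSpace M] [T2Space M] (hM : Surf M)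
    {K : Type} [TopologicalSpace K] [CompactSpace K] [T2Space K]
    [TotallyDisconnectedSpace K] (j : K → M) (hj : Continuous j) (hi : Function.Injective j)
    (O : K → Set M) (hO : ∀ x, O x ∈ 𝓝 (j x)) :
    ∃ (ι : Type) (_ : Finite ι) (V : ι → Set M), (∀ l, Shr (V l)) ∧
      (∀ l l', l ≠ l' → Disjoint (V l) (V l')) ∧
      (∀ l, ∃ y, V l ⊆ O y) ∧ ∀ x, ∃ l, j x ∈ V l := by
  choose c hc hc0 using fun x => hM (j x)
  obtain ⟨ι, hfin, ℓ, hℓ, hy⟩ := exists_label (fun x => j ⁻¹' range (c x))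
    (fun x => hj.continuousAt ((hc x).isOpen_range.mem_nhds ⟨0, hc0 x⟩))
  -- disjoint open neighbourhoods of the pieces
  have hcl : ∀ a, IsClosed {x | ℓ x = a} := fun a => hℓ.isClosed_fiber a
  have hG : ∃ G : ι → Set M, (∀ a, G a ∈ 𝓝ˢ (j '' {x | ℓ x = a})) ∧ Pairwise (Function.onFun Disjoint G) := by
    apply Pairwise.exists_mem_filter_of_disjoint
    intro a b hab
    show Disjoint _ _
    rw [← separatedNhds_iff_disjoint]
    apply SeparatedNhds.of_isCompact_isCompact ((hcl a).isCompact.image hj) ((hcl b).isCompact.image hj)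
    rw [Set.disjoint_image_iff hi, Set.disjoint_left]
    rintro x h1 h2
    exact hab (h1.symm.trans h2)
  obtain ⟨G, hG1, hG2⟩ := hG
  have hpiece : ∀ a : ι, ∃ (κ : Type) (_ : Finite κ) (V : κ → Set M), (∀ l, Shr (V l)) ∧
      (∀ l l', l ≠ l' → Disjoint (V l) (V l')) ∧
      (∀ l, V l ⊆ G a) ∧ (∀ l, ∃ y, V l ⊆ O y) ∧ ∀ x, ℓ x = a → ∃ l, j x ∈ V l := by
    intro a
    by_cases hne : ∃ x, ℓ x = a
    · obtain ⟨x0, hx0⟩ := hne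
      obtain ⟨y, hy⟩ := hy x0
      rw [hx0] at hy
      haveI : CompactSpace {x | ℓ x = a} := isCompact_iff_compactSpace.1 (hcl a).isCompact
      have hy' : ∀ x : {x | ℓ x = a}, ∃ p, c y p = j x := fun x => hy x x.2
      choose g hg using hy'
      have hgc : Continuous g := by
        rw [(hc y).isInducing.continuous_iff]
        have : c y ∘ g = fun x : {x | ℓ x = a} => j x := by ext x; exact hg x
        rw [this]; exact hj.comp continuous_subtype_val
      have hgi : Function.Injective g := by
        intro x x' h
        apply Subtype.ext; apply hi
        rw [← hg, ← hg, h]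
      obtain ⟨κ, hκ, V, v1, v2, v3, v4, v5⟩ := cover_P g hgc hgi (fun x => c y ⁻¹' (O x ∩ G a)) (by
        intro x
        apply (hc y).continuous.continuousAt
        rw [hg]
        exact inter_mem (hO x) (mem_nhdsSet_iff_forall.1 (hG1 a) _ ⟨x, x.2, rfl⟩))
      refine ⟨κ, hκ, fun l => c y '' V l, ?_, ?_, ?_, ?_, ?_⟩
      · intro l; exact (v1 l).chart (hc y) (v3 l)
      · intro l l' hne
        exact (Set.disjoint_image_iff (hc y).injective).2 (v2 l l' hne)
      · intro l
        obtain ⟨z, hz⟩ := v4 l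
        rintro _ ⟨p, hp, rfl⟩
        exact (hz (subset_closure hp)).2
      · intro l
        obtain ⟨z, hz⟩ := v4 l
        refine ⟨z, ?_⟩
        rintro _ ⟨p, hp, rfl⟩
        exact (hz (subset_closure hp)).1
      · intro x hx
        obtain ⟨l, hl⟩ := v5 ⟨x, hx⟩
        exact ⟨l, _, hl, hg ⟨x, hx⟩⟩
    · exact ⟨Empty, inferInstance, fun l => l.elim, fun l => l.elim, fun l => l.elim, fun l => l.elim,
        fun l => l.elim, fun x hx => absurd ⟨x, hx⟩ hne⟩
  choose κ hκ V v1 v2 v3 v4 v5 using hpiece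
  refine ⟨Σ a, κ a, inferInstance, fun l => V l.1 l.2, fun l => v1 _ _, ?_, fun l => v4 _ _, ?_⟩
  · rintro ⟨a, l⟩ ⟨b, l'⟩ hne
    by_cases hab : a = b
    · subst hab
      exact v2 a l l' (fun h => hne (by rw [h]))
    · exact (hG2 hab).mono (v3 a l) (v3 b l')
  · intro x
    obtain ⟨l, hl⟩ := v5 (ℓ x) x rfl
    exact ⟨⟨ℓ x, l⟩, hl⟩

lemma push_ball (p q : P) {r : ℝ} (hr : 0 < r) (hq : dist q p < r) :
    ∃ ψ : P ≃ₜ P, ψ p = q ∧ ∀ z, z ∉ Metric.ball p r → ψ z = z := by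
  have hk : LipschitzWith 1 (fun z : P => max 0 (r - dist z p)) := by
    have h1 : LipschitzWith 1 (fun z : P => r - dist z p) := by
      have := (LipschitzWith.const (α := P) r).sub (LipschitzWith.dist_left p)
      simpa using this
    exact h1.const_max 0
  set v : P := r⁻¹ • (q - p) with hv
  have hvn : ‖v‖ < 1 := by
    rw [hv, norm_smul, ← dist_eq_norm, norm_inv, Real.norm_eq_abs, abs_of_pos hr, inv_mul_lt_iff₀ hr]
    simpa using hq
  obtain ⟨e, he⟩ := pert (fun z => max 0 (r - dist z p) • v) ‖v‖₊ hvn (by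
    apply LipschitzWith.of_dist_le_mul
    intro x y
    have := hk.dist_le_mul x y
    rw [dist_eq_norm, ← sub_smul, norm_smul, mul_comm]
    rw [dist_eq_norm] at this
    simp only [NNReal.coe_one, one_mul] at this
    exact mul_le_mul_of_nonneg_left this (norm_nonneg v))
  refine ⟨e, ?_, ?_⟩
  · rw [he, dist_self, sub_zero, max_eq_right hr.le, hv, smul_inv_smul₀ hr.ne']
    abel
  · intro z hz
    rw [he, max_eq_left, zero_smul, add_zero]
    rw [Metric.mem_ball, not_lt] at hz
    linarith

section surf
variable {M : Type*} [TopologicalSpace M] [T2Space M]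

lemma push_local (hM : Surf M) {V : Set M} (hV : IsOpen V) {x : M} (hx : x ∈ V) :
    ∃ N ∈ 𝓝 x, ∀ y ∈ N, ∃ ψ : M ≃ₜ M, ψ x = y ∧ ∀ z, z ∉ V → ψ z = z := by
  obtain ⟨c, hc, rfl⟩ := hM x
  obtain ⟨r, hr, hrV⟩ := Metric.nhds_basis_closedBall.mem_iff.1
    ((hV.preimage hc.continuous).mem_nhds hx)
  refine ⟨c '' Metric.ball 0 r, hc.isOpenMap.image_mem_nhds (Metric.ball_mem_nhds _ hr), ?_⟩
  rintro _ ⟨q, hq, rfl⟩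
  obtain ⟨ψ, h1, h2⟩ := push_ball 0 q hr hq
  obtain ⟨Ψ, g1, g2⟩ := transfer hc ψ (isCompact_closedBall (0:P) r) 
    (fun p hp => h2 p (fun h => hp (Metric.ball_subset_closedBall h)))
  refine ⟨Ψ, by rw [g1, h1], ?_⟩
  intro z hz
  by_cases hzr : z ∈ range c
  · obtain ⟨p, rfl⟩ := hzr
    rw [g1, h2]
    intro h; exact hz (hrV (Metric.ball_subset_closedBall h))
  · exact g2 z hzr

lemma push (hM : Surf M) {V : Set M} (hV : IsOpen V) (hVc : IsPreconnected V) {x y : M} (hx : x ∈ V)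
    (hy : y ∈ V) : ∃ ψ : M ≃ₜ M, ψ x = y ∧ ∀ z, z ∉ V → ψ z = z := by
  set A : Set M := {y | y ∈ V ∧ ∃ ψ : M ≃ₜ M, ψ x = y ∧ ∀ z, z ∉ V → ψ z = z} with hA
  have hAo : IsOpen A := by
    rw [isOpen_iff_mem_nhds]
    rintro y ⟨hyV, ψ, h1, h2⟩
    obtain ⟨N, hN, h⟩ := push_local hM hV hyV
    filter_upwards [hN, hV.mem_nhds hyV] with z hz hzV
    obtain ⟨φ, p1, p2⟩ := h z hz
    exact ⟨hzV, ψ.trans φ, by simp [h1, p1], fun w hw => by simp [h2 w hw, p2 w hw]⟩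
  have hBo : IsOpen (V \ A) := by
    rw [isOpen_iff_mem_nhds]
    rintro y ⟨hyV, hyA⟩
    obtain ⟨N, hN, h⟩ := push_local hM hV hyV
    filter_upwards [hN, hV.mem_nhds hyV] with z hz hzV
    refine ⟨hzV, ?_⟩
    rintro ⟨-, ψ, h1, h2⟩
    obtain ⟨φ, p1, p2⟩ := h z hz
    apply hyA
    refine ⟨hyV, ψ.trans φ.symm, ?_, fun w hw => ?_⟩
    · simp [h1, ← p1]
    · simp [h2 w hw, symm_id_off φ p2 w hw]
  by_contra hc
  obtain ⟨z, -, h1, h2⟩ := hVc A (V \ A) hAo hBo (fun z hz => by by_cases h : z ∈ A <;> simp [h, hz])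
    ⟨x, hx, hx, Homeomorph.refl M, rfl, fun _ _ => rfl⟩ ⟨y, hy, hy, fun h => hc h.2⟩
  exact h2.2 h1

lemma punctured (hM : Surf M) {V : Set M} (hV : IsOpen V) (hVc : IsPreconnected V) (x : M) :
    IsPreconnected (V \ {x}) := by
  by_cases hx : x ∈ V
  swap
  · rwa [sdiff_singleton_eq_self hx]
  obtain ⟨c, hc, rfl⟩ := hM x
  obtain ⟨r, hr, hrV⟩ := Metric.isOpen_iff.1 (hV.preimage hc.continuous) 0 hx
  obtain ⟨b, hb, hb0, hbr⟩ := ball_chart 0 hr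
  set g := c ∘ b with hg
  have hge : IsOpenEmbedding g := hc.comp hb
  have hg0 : g 0 = c 0 := by simp [hg, hb0]
  have hgV : range g ⊆ V := by
    rintro _ ⟨p, rfl⟩
    have : b p ∈ Metric.ball (0:P) r := hbr ▸ mem_range_self p
    exact hrV this
  have hconn : IsPreconnected (g '' {0}ᶜ) := by
    have : IsConnected ({0}ᶜ : Set P) := by
      apply isConnected_compl_singleton_of_one_lt_rank (E := P)
      rw [← Module.finrank_eq_rank]
      simp
    exact this.isPreconnected.image _ hge.continuous.continuousOn
  have key : ∀ A B : Set M, IsOpen A → IsOpen B → V \ {c 0} ⊆ A ∪ B → ((V \ {c 0}) ∩ A).Nonempty →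
      ((V \ {c 0}) ∩ B).Nonempty → ¬ (g '' {0}ᶜ ∩ B).Nonempty → ((V \ {c 0}) ∩ (A ∩ B)).Nonempty := by
    rintro A B hA hB hAB ⟨a, ha, haA⟩ ⟨b', hb', hbB⟩ hn
    obtain ⟨z, hzV, h1, h2⟩ := hVc (A ∪ range g) (B \ {c 0}) (hA.union hge.isOpen_range)
      (hB.sdiff isClosed_singleton) (by
        intro z hz
        by_cases hz0 : z = c 0
        · left; right; exact ⟨0, by rw [hz0, hg0]⟩
        · rcases hAB ⟨hz, hz0⟩ with h | h
          · left; left; exact h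
          · right; exact ⟨h, hz0⟩) ⟨a, ha.1, Or.inl haA⟩ ⟨b', hb'.1, hbB, hb'.2⟩
    rcases h1 with h1 | ⟨p, rfl⟩
    · exact ⟨z, ⟨hzV, h2.2⟩, h1, h2.1⟩
    · exact absurd ⟨g p, ⟨p, by rintro rfl; exact h2.2 hg0, rfl⟩, h2.1⟩ hn
  intro A B hA hB hAB hnA hnB
  by_cases h1 : (g '' {0}ᶜ ∩ B).Nonempty
  · by_cases h2 : (g '' {0}ᶜ ∩ A).Nonempty
    · have hsub : g '' {0}ᶜ ⊆ V \ {c 0} := by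
        rintro _ ⟨p, hp, rfl⟩
        refine ⟨hgV ⟨p, rfl⟩, fun h => hp (hge.injective ?_)⟩
        rw [hg0]; exact h
      obtain ⟨z, hz, hz'⟩ := hconn A B hA hB (hsub.trans hAB) h2 h1
      exact ⟨z, hsub hz, hz'⟩
    · rw [inter_comm A B]
      exact key B A hB hA (by rwa [union_comm]) hnB hnA h2
  · exact key A B hA hB hAB hnA hnB h1

lemma punctured_finite (hM : Surf M) {V : Set M} (hV : IsOpen V) (hVc : IsPreconnected V) {s : Set M}
    (hs : s.Finite) : IsPreconnected (V \ s) := by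
  induction s, hs using Set.Finite.induction_on with
  | empty => simpa using hVc
  | @insert a s _ hs ih =>
    have : V \ insert a s = (V \ s) \ {a} := by ext; simp; tauto
    rw [this]
    exact punctured hM (hV.sdiff hs.isClosed) ih a

lemma open_infinite (hM : Surf M) {W : Set M} (hW : IsOpen W) (hne : W.Nonempty) : W.Infinite := by
  obtain ⟨x, hx⟩ := hne
  obtain ⟨c, hc, rfl⟩ := hM x
  have : (c ⁻¹' W).Infinite := infinite_of_mem_nhds (0:P) ((hW.preimage hc.continuous).mem_nhds hx)
  exact (this.image hc.injective.injOn).mono (image_preimage_subset c W)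

lemma push_many (hM : Surf M) {V : Set M} (hV : IsOpen V) (hVc : IsPreconnected V) {ι : Type*}
    (s : Finset ι) (p : ι → M) (hp : ∀ l ∈ s, p l ∈ V) (hinj : Function.Injective p)
    (W : ι → Set M) (hW : ∀ l, IsOpen (W l)) (hWn : ∀ l, (W l).Nonempty) (hWV : ∀ l, W l ⊆ V) :
    ∃ ψ : M ≃ₜ M, (∀ l ∈ s, ψ (p l) ∈ W l) ∧ ∀ z, z ∉ V → ψ z = z := by
  classical
  induction s using Finset.induction_on with
  | empty => exact ⟨Homeomorph.refl M, by simp, fun _ _ => rfl⟩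
  | insert a s ha ih =>
    obtain ⟨ψ, h1, h2⟩ := ih (fun l hl => hp l (by simp [hl]))
    set t : Finset M := s.image (fun l => ψ (p l)) with ht
    obtain ⟨q, hqW, hqt⟩ := (open_infinite hM (hW a) (hWn a)).exists_notMem_finset t
    have hV' : IsOpen (V \ t) := hV.sdiff t.finite_toSet.isClosed
    obtain ⟨φ, g1, g2⟩ := push hM hV' (punctured_finite hM hV hVc t.finite_toSet) (x := ψ (p a)) (y := q)
      ⟨(maps_of_id_off ψ h2).2 (hp a (by simp)), by
        intro h
        simp only [ht, Finset.coe_image, mem_image] at h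
        obtain ⟨l, hl, hl'⟩ := h
        have := hinj (ψ.injective hl')
        subst this
        exact ha hl⟩ ⟨hWV a hqW, hqt⟩
    refine ⟨ψ.trans φ, ?_, ?_⟩
    · intro l hl
      rcases Finset.mem_insert.1 hl with rfl | hl
      · simp [g1, hqW]
      · rw [Homeomorph.trans_apply, g2]
        · exact h1 l hl
        · intro h
          apply h.2
          simp only [ht, Finset.coe_image, mem_image]
          exact ⟨l, hl, rfl⟩
    · intro z hz
      rw [Homeomorph.trans_apply, h2 z hz, g2 z (fun h => hz h.1)]

lemma lemmaH (hM : Surf M) {V : Set M} (hV : IsOpen V) (hVc : IsPreconnected V)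
    {K : Type} [TopologicalSpace K] [CompactSpace K] [T2Space K]
    [TotallyDisconnectedSpace K] (j : K → M) (hj : Continuous j) (hi : Function.Injective j)
    (hjV : ∀ x, j x ∈ V) (W : K → Set M) (hWlc : ∀ x, ∀ᶠ y in 𝓝 x, W y = W x) (hW : ∀ x, IsOpen (W x))
    (hWn : ∀ x, (W x).Nonempty) (hWV : ∀ x, W x ⊆ V) :
    ∃ θ : M ≃ₜ M, (∀ x, θ (j x) ∈ W x) ∧ ∀ z, z ∉ V → θ z = z := by
  have hje : IsEmbedding j := (hj.isClosedEmbedding hi).isEmbedding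
  have hO : ∀ x, ∃ O ∈ 𝓝 (j x), O ⊆ V ∧ ∀ y, j y ∈ O → W y = W x := by
    intro x
    have := hWlc x
    rw [hje.nhds_eq_comap] at this
    obtain ⟨O, hO, h⟩ := mem_comap.1 this
    exact ⟨O ∩ V, inter_mem hO (hV.mem_nhds (hjV x)), inter_subset_right, fun y hy => h hy.1⟩
  choose O hO hOV hOW using hO
  obtain ⟨ι, hfin, U, u1, u2, u3, u4⟩ := cover_M hM j hj hi O hO
  choose y hy using u3
  have u1' := fun l => (u1 l).2
  choose p hpU hp using u1'
  have hpinj : Function.Injective p := by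
    intro l l' h
    by_contra hne
    exact (u2 l l' hne).le_bot ⟨hpU l, h ▸ hpU l'⟩
  haveI := Fintype.ofFinite ι
  obtain ⟨π, π1, π2⟩ := push_many hM hV hVc Finset.univ p (fun l _ => hOV _ (hy l (hpU l))) hpinj
    (fun l => W (y l)) (fun l => hW _) (fun l => hWn _) (fun l => hWV _)
  have hF : ∀ l, IsCompact (j '' (j ⁻¹' U l)) := by
    intro l
    apply IsCompact.image _ hj
    apply IsClosed.isCompact
    rw [← isOpen_compl_iff]
    have : (j ⁻¹' U l)ᶜ = ⋃ l' ∈ {l' | l' ≠ l}, j ⁻¹' U l' := by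
      ext x
      simp only [mem_compl_iff, mem_preimage, mem_iUnion, exists_prop, mem_ofPred_eq]
      constructor
      · intro h
        obtain ⟨l', hl'⟩ := u4 x
        exact ⟨l', by rintro rfl; exact h hl', hl'⟩
      · rintro ⟨l', hne, hl'⟩ h
        exact (u2 l' l hne).le_bot ⟨hl', h⟩
    rw [this]
    exact isOpen_biUnion fun l' _ => (u1 l').1.preimage hj
  have hψ : ∀ l, ∃ ψ : M ≃ₜ M, (∀ x, x ∉ U l → ψ x = x) ∧ ∀ x ∈ j '' (j ⁻¹' U l), ψ x ∈ π ⁻¹' W (y l) :=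
    fun l => hp l _ (π.continuous.continuousAt ((hW _).mem_nhds (π1 l (Finset.mem_univ l)))) _ (hF l)
      (image_preimage_subset _ _)
  choose ψ ψ1 ψ2 using hψ
  obtain ⟨Ψ, Ψ1, Ψ2⟩ := prod_homeo Finset.univ U (fun l _ l' _ => u2 l l') ψ (fun l _ => ψ1 l)
  refine ⟨Ψ.trans π, ?_, ?_⟩
  · intro x
    obtain ⟨l, hl⟩ := u4 x
    rw [Homeomorph.trans_apply, Ψ1 l (Finset.mem_univ l) _ hl, hOW (y l) x (hy l hl)]
    exact ψ2 l _ ⟨x, hl, rfl⟩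
  · intro z hz
    rw [Homeomorph.trans_apply, Ψ2, π2 z hz]
    intro l _ h
    exact hz (hOV _ (hy l h))

end surf

end DJ

namespace DJ

section scheme
variable {K : Type} [TopologicalSpace K] [CompactSpace K] [T2Space K] [TotallyDisconnectedSpace K]

structure Pieces (V : K → Set P) : Prop where
  op : ∀ x, IsOpen (V x)
  con : ∀ x, IsPreconnected (V x)
  eqd : ∀ x y z, z ∈ V x → z ∈ V y → V x = V y
  loc : ∀ x, ∀ᶠ y in 𝓝 x, V y = V x

lemma Pieces.isLocallyConstant {V : K → Set P} (h : Pieces V) : IsLocallyConstant V :=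
  (IsLocallyConstant.iff_eventually_eq V).2 h.loc

lemma refine_pieces {V : K → Set P} (hV : Pieces V) (i : K → P) (hi : Continuous i)
    (hinj : Function.Injective i) (hiV : ∀ x, i x ∈ V x) (O : K → Set P) (hO : ∀ x, O x ∈ 𝓝 (i x)) :
    ∃ W : K → Set P, Pieces W ∧ (∀ x, i x ∈ W x) ∧ (∀ x, W x ⊆ V x) ∧ ∀ x, ∃ y, W x ⊆ O y := by
  obtain ⟨ι, hfin, ℓ, hℓ, hy⟩ := exists_label (fun x => i ⁻¹' interior (O x))
    (fun x => hi.continuousAt (isOpen_interior.mem_nhds (mem_interior_iff_mem_nhds.2 (hO x))))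
  have hcl : ∀ a, IsClosed {x | ℓ x = a} := fun a => hℓ.isClosed_fiber a
  have hG : ∃ G : ι → Set P, (∀ a, G a ∈ 𝓝ˢ (i '' {x | ℓ x = a})) ∧ Pairwise (Function.onFun Disjoint G) := by
    apply Pairwise.exists_mem_filter_of_disjoint
    intro a b hab
    show Disjoint _ _
    rw [← separatedNhds_iff_disjoint]
    apply SeparatedNhds.of_isCompact_isCompact ((hcl a).isCompact.image hi) ((hcl b).isCompact.image hi)
    rw [Set.disjoint_image_iff hinj, Set.disjoint_left]
    rintro x h1 h2
    exact hab (h1.symm.trans h2)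
  obtain ⟨G, hG1, hG2⟩ := hG
  have hO' : ∀ a, ∃ O' : Set P, IsOpen O' ∧ (∀ x, ℓ x = a → i x ∈ O') ∧ ∀ x, ℓ x = a → ∃ y, O' ⊆ O y := by
    intro a
    by_cases hne : ∃ x, ℓ x = a
    · obtain ⟨x, hx⟩ := hne
      obtain ⟨y, h⟩ := hy x
      refine ⟨interior (O y), isOpen_interior, fun x' hx' => h x' (hx'.trans hx.symm),
        fun _ _ => ⟨y, interior_subset⟩⟩
    · push Not at hne
      exact ⟨∅, isOpen_empty, fun x hx => (hne x hx).elim, fun x hx => (hne x hx).elim⟩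
  choose O' hO1 hO2 hO3 using hO'
  set E : K → Set P := fun x => interior (G (ℓ x)) ∩ O' (ℓ x) ∩ V x with hE
  have hEo : ∀ x, IsOpen (E x) := fun x => (isOpen_interior.inter (hO1 _)).inter (hV.op x)
  have hEi : ∀ x, i x ∈ E x := fun x => by
    refine ⟨⟨?_, hO2 _ x rfl⟩, hiV x⟩
    have := hG1 (ℓ x)
    rw [mem_nhdsSet_iff_forall] at this
    exact mem_interior_iff_mem_nhds.2 (this _ ⟨x, rfl, rfl⟩)
  have hEl : ∀ x, ∀ᶠ y in 𝓝 x, E y = E x := fun x => by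
    filter_upwards [hV.loc x, hℓ.eventually_eq x] with y h1 h2
    simp only [hE, h1, h2]
  have hEe : ∀ x y z, z ∈ E x → z ∈ E y → E x = E y := fun x y z hx hy => by
    have h1 : ℓ x = ℓ y := by
      by_contra hne
      exact (Set.disjoint_left.1 (hG2 hne) (interior_subset hx.1.1) (interior_subset hy.1.1))
    simp only [hE, h1, hV.eqd x y z hx.2 hy.2]
  set W : K → Set P := fun x => connectedComponentIn (E x) (i x) with hW
  have hWo : ∀ x, IsOpen (W x) := fun x => (hEo x).connectedComponentIn
  have hWE : ∀ x, W x ⊆ E x := fun x => connectedComponentIn_subset _ _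
  have hWi : ∀ x, i x ∈ W x := fun x => mem_connectedComponentIn (hEi x)
  refine ⟨W, ⟨hWo, fun x => isPreconnected_connectedComponentIn, ?_, ?_⟩, hWi,
    fun x => (hWE x).trans inter_subset_right, fun x => ?_⟩
  · intro x y z hx hy
    have h := hEe x y z (hWE x hx) (hWE y hy)
    have e1 := connectedComponentIn_eq hx
    have e2 := connectedComponentIn_eq hy
    simp only [hW]
    rw [e1, e2, h]
  · intro x
    filter_upwards [hEl x, hi.continuousAt ((hWo x).mem_nhds (hWi x))] with y h1 h2
    have e1 := connectedComponentIn_eq (show i y ∈ W x from h2)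
    simp only [hW]
    rw [e1, h1]
  · obtain ⟨y, h⟩ := hO3 _ x rfl
    exact ⟨y, fun z hz => h (hWE x hz).1.2⟩

lemma move_pieces {V : K → Set P} (hV : Pieces V) (j : K → P) (hj : Continuous j)
    (hinj : Function.Injective j) (hjV : ∀ x, j x ∈ V x) {W : K → Set P} (hW : Pieces W)
    (hWn : ∀ x, (W x).Nonempty) (hWV : ∀ x, W x ⊆ V x) :
    ∃ θ : P ≃ₜ P, (∀ x, θ (j x) ∈ W x) ∧ (∀ z, (∀ x, z ∉ V x) → θ z = z) ∧
      ∀ x z, θ z ∈ V x ↔ z ∈ V x := by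
  have hfin : (range V).Finite := hV.isLocallyConstant.range_finite
  have key : ∀ a ∈ range V, ∃ θ : P ≃ₜ P, (∀ x, V x = a → θ (j x) ∈ W x) ∧ ∀ z, z ∉ a → θ z = z := by
    rintro a ⟨x0, rfl⟩
    have hcl : IsClosed {x | V x = V x0} := hV.isLocallyConstant.isClosed_fiber _
    have : CompactSpace {x | V x = V x0} := isCompact_iff_compactSpace.1 hcl.isCompact
    have : TotallyDisconnectedSpace {x | V x = V x0} := inferInstance
    obtain ⟨θ, h1, h2⟩ := lemmaH surf_P (hV.op x0) (hV.con x0)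
      (fun x : {x | V x = V x0} => j x) (hj.comp continuous_subtype_val)
      (hinj.comp Subtype.val_injective) (fun x => subset_of_eq (show V x = V x0 from x.2) (hjV x)) (fun x => W x)
      (fun x => continuous_subtype_val.continuousAt.eventually (hW.loc x)) (fun x => hW.op _)
      (fun x => hWn _) (fun x => (hWV x).trans (subset_of_eq (show V x = V x0 from x.2)))
    exact ⟨θ, fun x hx => h1 ⟨x, hx⟩, h2⟩
  choose! ψ hψ1 hψ2 using key
  have hdis : ∀ l ∈ hfin.toFinset, ∀ l' ∈ hfin.toFinset, l ≠ l' → Disjoint l l' := by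
    intro l hl l' hl' hne
    rw [Set.Finite.mem_toFinset] at hl hl'
    obtain ⟨x, rfl⟩ := hl
    obtain ⟨y, rfl⟩ := hl'
    rw [Set.disjoint_left]
    intro z h1 h2
    exact hne (hV.eqd x y z h1 h2)
  obtain ⟨Ψ, h1, h2⟩ := prod_homeo hfin.toFinset (fun l : Set P => l) hdis ψ (fun l hl => hψ2 l (by simpa using hl))
  have h1' : ∀ x z, z ∈ V x → Ψ z = ψ (V x) z := fun x z hz => h1 _ (by simp) z hz
  have h2' : ∀ z, (∀ x, z ∉ V x) → Ψ z = z := fun z hz => h2 z (by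
    intro l hl
    rw [Set.Finite.mem_toFinset] at hl
    obtain ⟨x, rfl⟩ := hl
    exact hz x)
  have h3 : ∀ x z, z ∈ V x → Ψ z ∈ V x := fun x z hz => by
    rw [h1' x z hz]
    exact (maps_of_id_off (ψ (V x)) (hψ2 _ ⟨x, rfl⟩)).2 hz
  refine ⟨Ψ, fun x => ?_, h2', fun x z => ⟨fun hz => ?_, h3 x z⟩⟩
  · rw [h1' x _ (hjV x)]; exact hψ1 _ ⟨x, rfl⟩ x rfl
  · by_cases hex : ∃ y, z ∈ V y
    · obtain ⟨y, hy⟩ := hex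
      rwa [hV.eqd x y _ hz (h3 y z hy)]
    · push Not at hex
      rwa [h2' z hex] at hz

structure Good (i j : K → P) (s : (P ≃ₜ P) × (K → Set P)) : Prop where
  pc : Pieces s.2
  hi : ∀ x, i x ∈ s.2 x
  hj : ∀ x, s.1.symm (j x) ∈ s.2 x

structure Nxt (ε : ℝ) (s t : (P ≃ₜ P) × (K → Set P)) : Prop where
  sub : ∀ x, t.2 x ⊆ s.2 x
  d1 : ∀ x, ∀ p ∈ t.2 x, ∀ q ∈ t.2 x, dist p q < ε
  d2 : ∀ x, ∀ p ∈ t.2 x, ∀ q ∈ t.2 x, dist (t.1 p) (t.1 q) < ε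
  off : ∀ z, (∀ x, z ∉ s.2 x) → t.1 z = s.1 z
  inn : ∀ x, ∀ z ∈ s.2 x, s.1.symm (t.1 z) ∈ s.2 x

lemma step {i j : K → P} (hic : Continuous i) (hii : Function.Injective i) (hjc : Continuous j)
    (hji : Function.Injective j) (s : (P ≃ₜ P) × (K → Set P)) (hs : Good i j s) {ε : ℝ} (hε : 0 < ε) :
    ∃ t, Good i j t ∧ Nxt ε s t := by
  obtain ⟨Φ, V⟩ := s
  obtain ⟨hV, hiV, hjV⟩ := hs
  simp only at hV hiV hjV
  have hj'c : Continuous (fun x => Φ.symm (j x)) := Φ.symm.continuous.comp hjc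
  have hj'i : Function.Injective (fun x => Φ.symm (j x)) := Φ.symm.injective.comp hji
  obtain ⟨W, hW, hjW, hWV, hWO⟩ := refine_pieces hV (fun x => Φ.symm (j x)) hj'c hj'i hjV
    (fun x => Φ ⁻¹' Metric.ball (j x) (ε / 2)) (fun x => Φ.continuous.continuousAt
      (by rw [Homeomorph.apply_symm_apply]; exact Metric.ball_mem_nhds _ (by positivity)))
  obtain ⟨θ₁, a1, a2, a3⟩ := move_pieces hV i hic hii hiV hW (fun x => ⟨_, hjW x⟩) hWV
  obtain ⟨W', hW', hiW', hWW', hWO'⟩ := refine_pieces hW (fun x => θ₁ (i x)) (θ₁.continuous.comp hic)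
    (θ₁.injective.comp hii) a1
    (fun x => θ₁.symm ⁻¹' Metric.ball (i x) (ε / 2)) (fun x => θ₁.symm.continuous.continuousAt
      (by rw [Homeomorph.symm_apply_apply]; exact Metric.ball_mem_nhds _ (by positivity)))
  obtain ⟨θ₂, b1, b2, b3⟩ := move_pieces hW (fun x => Φ.symm (j x)) hj'c hj'i hjW hW' (fun x => ⟨_, hiW' x⟩) hWW'
  have b3' : ∀ x z, z ∈ W x → θ₂.symm z ∈ W x := fun x z hz => by
    rw [← b3, Homeomorph.apply_symm_apply]; exact hz
  have b2' : ∀ z, (∀ x, z ∉ W x) → θ₂.symm z = z := fun z hz => by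
    rw [Homeomorph.symm_apply_eq, b2 z hz]
  refine ⟨((θ₁.trans θ₂.symm).trans Φ, fun x => θ₁ ⁻¹' W' x), ⟨⟨?_, ?_, ?_, ?_⟩, ?_, ?_⟩, ⟨?_, ?_, ?_, ?_, ?_⟩⟩
  · exact fun x => (hW'.op x).preimage θ₁.continuous
  · intro x
    simp only
    rw [← Homeomorph.image_symm]
    exact (hW'.con x).image _ θ₁.symm.continuous.continuousOn
  · intro x y z h1 h2
    simp only
    rw [hW'.eqd x y _ h1 h2]
  · intro x
    filter_upwards [hW'.loc x] with y hy
    simp only [hy]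
  · exact hiW'
  · intro x
    simp only [Homeomorph.symm_trans_apply, mem_preimage, Homeomorph.symm_symm, Homeomorph.apply_symm_apply]
    exact b1 x
  · intro x z hz
    exact (a3 x z).1 (hWV x (hWW' x hz))
  · intro x p hp q hq
    obtain ⟨y, hy⟩ := hWO' x
    have h1 := hy hp
    have h2 := hy hq
    simp only [mem_preimage, Homeomorph.symm_apply_apply, Metric.mem_ball] at h1 h2
    calc dist p q ≤ dist p (i y) + dist q (i y) := dist_triangle_right _ _ _
      _ < ε := by linarith
  · intro x p hp q hq
    obtain ⟨y, hy⟩ := hWO x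
    have h1 := hy (b3' x _ (hWW' x hp))
    have h2 := hy (b3' x _ (hWW' x hq))
    simp only [mem_preimage, Metric.mem_ball] at h1 h2
    simp only [Homeomorph.trans_apply]
    calc _ ≤ _ := dist_triangle_right _ _ (j y)
      _ < ε := by linarith
  · intro z hz
    simp only [Homeomorph.trans_apply]
    rw [a2 z hz, b2' z (fun x h => hz x (hWV x h))]
  · intro x z hz
    simp only [Homeomorph.trans_apply, Homeomorph.symm_apply_apply]
    have hz' := (a3 x z).2 hz
    by_cases hex : ∃ y, θ₁ z ∈ W y
    · obtain ⟨y, hy⟩ := hex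
      have := b3' y _ hy
      rw [hV.eqd x y _ hz' (hWV y hy)]
      exact hWV y this
    · push Not at hex
      rwa [b2' _ hex]

theorem scheme (i j : K → P) (hic : Continuous i) (hii : Function.Injective i) (hjc : Continuous j)
    (hji : Function.Injective j) :
    ∃ Ψ : P → P, Continuous Ψ ∧ Function.Injective Ψ ∧ ∀ x, Ψ (i x) = j x := by
  classical
  have hpos : ∀ n : ℕ, (0:ℝ) < 1 / ((n:ℝ) + 1) := fun n => by positivity
  have g0 : Good i j (Homeomorph.refl P, fun _ => univ) :=
    ⟨⟨fun _ => isOpen_univ, fun _ => isPreconnected_univ, fun _ _ _ _ _ => rfl, fun _ => by simp⟩,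
      fun _ => trivial, fun _ => trivial⟩
  choose nx hnx1 hnx2 using fun (s : {s // Good i j s}) (n : ℕ) => step hic hii hjc hji s.1 s.2 (hpos n)
  let S : ℕ → {s // Good i j s} := fun n => Nat.rec ⟨_, g0⟩ (fun n s => ⟨nx s n, hnx1 s n⟩) n
  have hS : ∀ n : ℕ, Nxt (1 / ((n:ℝ) + 1)) (S n).1 (S (n+1)).1 := fun n => hnx2 (S n) n
  set Φ : ℕ → (P ≃ₜ P) := fun n => (S n).1.1 with hΦ
  set V : ℕ → K → Set P := fun n => (S n).1.2 with hV
  have hgood : ∀ n, Good i j (Φ n, V n) := fun n => (S n).2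
  have hnxt : ∀ n : ℕ, Nxt (1 / ((n:ℝ) + 1)) (Φ n, V n) (Φ (n+1), V (n+1)) := hS
  clear_value Φ V
  have hsub : ∀ n m, n ≤ m → ∀ x, V m x ⊆ V n x := by
    intro n m h x
    induction m, h using Nat.le_induction with
    | base => exact subset_rfl
    | succ m _ ih => exact ((hnxt m).sub x).trans ih
  have hoff : ∀ n m, n ≤ m → ∀ z, (∀ x, z ∉ V n x) → Φ m z = Φ n z := by
    intro n m h z hz
    induction m, h using Nat.le_induction with
    | base => rfl
    | succ m hm ih => exact ((hnxt m).off z (fun x hx => hz x (hsub n m hm x hx))).trans ih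
  have hinn : ∀ n m, n ≤ m → ∀ x, ∀ z ∈ V n x, (Φ n).symm (Φ m z) ∈ V n x := by
    intro n m h
    induction m, h using Nat.le_induction with
    | base => intro x z hz; simpa using hz
    | succ m hm ih =>
      intro x z hz
      by_cases hex : ∃ y, z ∈ V m y
      · obtain ⟨y, hy⟩ := hex
        have h1 := (hnxt m).inn y z hy
        simp only at h1
        have h2 := ih y _ (hsub n m hm y h1)
        rw [Homeomorph.apply_symm_apply] at h2
        rwa [show V n x = V n y from (hgood n).pc.eqd x y z hz (hsub n m hm y hy)]
      · push Not at hex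
        have : Φ (m+1) z = Φ m z := (hnxt m).off z hex
        rw [this]
        exact ih x z hz
  have hd1 : ∀ n x, ∀ p ∈ V (n+1) x, ∀ q ∈ V (n+1) x, dist p q < 1 / ((n:ℝ) + 1) := fun n => (hnxt n).d1
  have hd2 : ∀ n x, ∀ p ∈ V (n+1) x, ∀ q ∈ V (n+1) x, dist (Φ (n+1) p) (Φ (n+1) q) < 1 / ((n:ℝ) + 1) :=
    fun n => (hnxt n).d2
  have hclosed : IsClosed (range i) := (isCompact_range hic).isClosed
  -- points off the image of `i`
  have hfar : ∀ p, p ∉ range i → ∃ n, ∀ᶠ q in 𝓝 p, ∀ x, q ∉ V n x := by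
    intro p hp
    obtain ⟨δ, hδ, hb⟩ := Metric.isOpen_iff.1 hclosed.isOpen_compl p hp
    obtain ⟨n, hn⟩ := exists_nat_one_div_lt (half_pos hδ)
    refine ⟨n+1, ?_⟩
    filter_upwards [Metric.ball_mem_nhds p (half_pos hδ)] with q hq x hx
    have h1 := hd1 n x _ hx _ ((hgood (n+1)).hi x)
    have : i x ∈ Metric.ball p δ := by
      rw [Metric.mem_ball] at hq ⊢
      calc dist (i x) p ≤ dist q (i x) + dist q p := by
            rw [dist_comm q (i x)]; exact dist_triangle _ _ _
        _ < δ := by linarith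
    exact hb this ⟨x, rfl⟩
  have hfar' : ∀ p, p ∉ range i → ∃ n, ∀ x, p ∉ V n x := fun p hp => by
    obtain ⟨n, hn⟩ := hfar p hp
    exact ⟨n, hn.self_of_nhds⟩
  have hex : ∃ Ψ : P → P, (∀ x, Ψ (i x) = j x) ∧ ∀ n p, (∀ x, p ∉ V n x) → Ψ p = Φ n p := by
    have : ∀ p, ∃ w, (∀ x, i x = p → w = j x) ∧ ∀ n, (∀ x, p ∉ V n x) → w = Φ n p := by
      intro p
      by_cases hp : p ∈ range i
      · obtain ⟨x, rfl⟩ := hp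
        exact ⟨j x, fun y hy => by rw [hii hy], fun n hn => (hn x ((hgood n).hi x)).elim⟩
      · obtain ⟨n, hn⟩ := hfar' p hp
        refine ⟨Φ n p, fun x hx => (hp ⟨x, hx⟩).elim, fun m hm => ?_⟩
        rcases le_total n m with h | h
        · exact (hoff n m h p hn).symm
        · exact hoff m n h p hm
    choose Ψ h1 h2 using this
    exact ⟨Ψ, fun x => h1 _ x rfl, fun n p => h2 p n⟩
  obtain ⟨Ψ, hΨi, hΨo⟩ := hex
  refine ⟨Ψ, ?_, ?_, hΨi⟩
  · rw [continuous_iff_continuousAt]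
    intro p
    by_cases hp : p ∈ range i
    · obtain ⟨x, rfl⟩ := hp
      have hloc : ∀ n, ∀ q ∈ V n x, (Φ n).symm (Ψ q) ∈ V n x := by
        intro n q hq
        by_cases hqi : q ∈ range i
        · obtain ⟨y, rfl⟩ := hqi
          rw [hΨi, show V n x = V n y from (hgood n).pc.eqd x y _ hq ((hgood n).hi y)]
          exact (hgood n).hj y
        · obtain ⟨m, hm⟩ := hfar' q hqi
          have hle : n ≤ max n m := le_max_left _ _
          have : Ψ q = Φ (max n m) q := hΨo _ _ (fun y hy => hm y (hsub m _ (le_max_right _ _) y hy))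
          rw [this]
          exact hinn n _ hle x q hq
      rw [Metric.continuousAt_iff']
      intro ε hε
      obtain ⟨n, hn⟩ := exists_nat_one_div_lt hε
      filter_upwards [((hgood (n+1)).pc.op x).mem_nhds ((hgood (n+1)).hi x)] with q hq
      have h1 := hd2 n x _ (hloc (n+1) q hq) _ (hloc (n+1) (i x) ((hgood (n+1)).hi x))
      rw [Homeomorph.apply_symm_apply, Homeomorph.apply_symm_apply] at h1
      exact h1.trans hn
    · obtain ⟨n, hn⟩ := hfar p hp
      exact ((Φ n).continuous.continuousAt).congr (by
        filter_upwards [hn] with q hq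
        exact (hΨo n q hq).symm)
  · have hmix : ∀ x q, q ∉ range i → Ψ (i x) ≠ Ψ q := by
      intro x q hq h
      obtain ⟨n, hn⟩ := hfar' q hq
      rw [hΨi, hΨo n q hn] at h
      have := (hgood n).hj x
      simp only [h, Homeomorph.symm_apply_apply] at this
      exact hn x this
    intro p q h
    by_cases hp : p ∈ range i
    · obtain ⟨x, rfl⟩ := hp
      by_cases hq : q ∈ range i
      · obtain ⟨y, rfl⟩ := hq
        rw [hΨi, hΨi] at h
        rw [hji h]
      · exact (hmix x q hq h).elim
    · by_cases hq : q ∈ range i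
      · obtain ⟨y, rfl⟩ := hq
        exact (hmix y p hp h.symm).elim
      · obtain ⟨n, hn⟩ := hfar' p hp
        obtain ⟨m, hm⟩ := hfar' q hq
        rw [hΨo (max n m) p (fun y hy => hn y (hsub n _ (le_max_left _ _) y hy)),
          hΨo (max n m) q (fun y hy => hm y (hsub m _ (le_max_right _ _) y hy))] at h
        exact (Φ _).injective h

end scheme
end DJ

namespace DJ

lemma circle_emb : ∃ c : UnitAddCircle → P, Continuous c ∧ Function.Injective c := by
  refine ⟨fun t => Complex.equivRealProdCLM ((AddCircle.toCircle t : Circle) : ℂ), ?_, ?_⟩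
  · exact Complex.equivRealProdCLM.continuous.comp (continuous_subtype_val.comp AddCircle.continuous_toCircle)
  · exact Complex.equivRealProdCLM.injective.comp
      (Subtype.val_injective.comp (AddCircle.injective_toCircle one_ne_zero))

theorem extension {M : Type*} [TopologicalSpace M] [T2Space M] (hM : Surf M) {M0 : Set M}
    (hM0 : IsOpen M0) (hM0c : IsPreconnected M0) (K : Set UnitAddCircle) (hK : IsCompact K) (hKn : K.Nonempty)
    (hKt : IsTotallyDisconnected K) (e : K → M) (he : Continuous e) (hei : Function.Injective e)
    (heM : ∀ x, e x ∈ M0) :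
    ∃ γ : UnitAddCircle → M, Continuous γ ∧ Function.Injective γ ∧ ∀ x : K, γ x = e x := by
  have : CompactSpace K := isCompact_iff_compactSpace.1 hK
  have : TotallyDisconnectedSpace K := totallyDisconnectedSpace_subtype_iff.2 hKt
  obtain ⟨x0, hx0⟩ := hKn
  obtain ⟨c0, hc0, hc00⟩ := hM (e ⟨x0, hx0⟩)
  -- a chart inside `M0`
  have : ∃ c : P → M, IsOpenEmbedding c ∧ range c ⊆ M0 := by
    have hn : c0 ⁻¹' M0 ∈ 𝓝 (0 : P) := hc0.continuous.continuousAt (hM0.mem_nhds (by rw [hc00]; exact heM _))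
    obtain ⟨r, hr, hb⟩ := Metric.mem_nhds_iff.1 hn
    obtain ⟨b, hb1, hb2, hb3⟩ := ball_chart (0 : P) hr
    refine ⟨c0 ∘ b, hc0.comp hb1, ?_⟩
    rintro _ ⟨p, rfl⟩
    exact hb (hb3 ▸ mem_range_self p)
  obtain ⟨c, hc, hcM⟩ := this
  obtain ⟨θ, h1, -⟩ := lemmaH hM hM0 hM0c e he hei heM (fun _ => range c) (fun _ => by simp)
    (fun _ => hc.isOpen_range) (fun _ => range_nonempty c) (fun _ => hcM)
  choose j hj using h1
  have hjc : Continuous j := by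
    rw [hc.isEmbedding.continuous_iff]
    have : c ∘ j = fun x => θ (e x) := funext hj
    rw [this]
    exact θ.continuous.comp he
  have hji : Function.Injective j := fun x y h => hei (θ.injective (by rw [← hj, ← hj, h]))
  obtain ⟨i0, hi0, hi0i⟩ := circle_emb
  obtain ⟨Ψ, p1, p2, p3⟩ := scheme (fun x : K => i0 x) j (hi0.comp continuous_subtype_val)
    (hi0i.comp Subtype.val_injective) hjc hji
  refine ⟨fun t => θ.symm (c (Ψ (i0 t))), ?_, ?_, ?_⟩
  · exact θ.symm.continuous.comp (hc.continuous.comp (p1.comp hi0))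
  · exact θ.symm.injective.comp (hc.injective.comp (p2.comp hi0i))
  · intro x
    simp only
    rw [p3, hj, Homeomorph.symm_apply_apply]

lemma comp_open {M : Type*} [TopologicalSpace M] (hM : Surf M) (m : M) : IsOpen (connectedComponent m) := by
  rw [isOpen_iff_mem_nhds]
  intro x hx
  obtain ⟨c, hc, hc0⟩ := hM x
  have hsub : range c ⊆ connectedComponent x :=
    (isPreconnected_range hc.continuous).subset_connectedComponent ⟨0, hc0⟩
  rw [connectedComponent_eq hx]
  exact mem_of_superset (hc.isOpen_range.mem_nhds ⟨0, hc0⟩) hsub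

lemma horseshoe_comp {M : Type*} [TopologicalSpace M] (hM : Surf M) (f : M → M) (hf : IsHomeomorph f)
    (k : (ℤ → Fin 2) → M) (hk : Continuous k) (hconj : ∀ u, f (k u) = k (shift2 u)) :
    ∃ M0 : Set M, IsOpen M0 ∧ IsPreconnected M0 ∧ ∀ u, k u ∈ M0 := by
  set z : ℤ → Fin 2 := fun _ => 0 with hz
  refine ⟨connectedComponent (k z), comp_open hM _, isPreconnected_connectedComponent, ?_⟩
  have hfz : f (k z) = k z := by rw [hconj]; rfl
  have hback : ∀ x, f x ∈ connectedComponent (k z) → x ∈ connectedComponent (k z) := by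
    intro x hx
    let e := hf.homeomorph
    have he : ∀ y, e.symm (f y) = y := fun y => e.symm_apply_apply y
    have := e.symm.continuous.image_connectedComponent_subset (k z) ⟨_, hx, rfl⟩
    rw [he] at this
    have h2 := he (k z)
    rw [hfz] at h2
    rwa [h2] at this
  have hbk : ∀ (n : ℕ) u, k (fun i => u (i + n)) ∈ connectedComponent (k z) → k u ∈ connectedComponent (k z) := by
    intro n
    induction n with
    | zero => intro u h; simpa using h
    | succ n ih =>
      intro u h
      apply ih
      apply hback
      rw [hconj]
      convert h using 3
      simp only [shift2]
      congr 1
      push_cast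
      ring
  have hfs : ∀ (u : ℤ → Fin 2) (N : ℤ), (∀ i, N ≤ i → u i = 0) → k u ∈ connectedComponent (k z) := by
    intro u N hu
    have ht : Tendsto (fun n : ℕ => (fun i : ℤ => u (i + n))) atTop (𝓝 z) := by
      rw [tendsto_pi_nhds]
      intro i
      apply tendsto_const_nhds.congr'
      filter_upwards [eventually_ge_atTop (N - i).toNat] with n hn
      rw [hu _ (by omega)]
    have := (hk.tendsto z).comp ht
    obtain ⟨n, hn⟩ := (this.eventually ((comp_open hM _).mem_nhds mem_connectedComponent)).exists
    exact hbk n u hn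
  intro u
  have ht : Tendsto (fun n : ℕ => (fun i : ℤ => if i < n then u i else 0)) atTop (𝓝 u) := by
    rw [tendsto_pi_nhds]
    intro i
    apply tendsto_const_nhds.congr'
    filter_upwards [eventually_gt_atTop i.toNat] with n hn
    rw [if_pos (by omega)]
  refine isClosed_connectedComponent.mem_of_tendsto ((hk.tendsto u).comp ht) (Eventually.of_forall fun n => ?_)
  exact hfs _ n (fun i hi => if_neg (by omega))

end DJ

namespace DJ

lemma dens {α : ℝ} (hα : Irrational α) {a b : ℝ} (hab : a < b) : ∃ n m : ℤ, a < n * α + m ∧ n * α + m < b := by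
  have h : Dense (AddSubgroup.closure {α, 1} : Set ℝ) := by
    rw [dense_addSubgroupClosure_pair_iff]; simpa using hα
  obtain ⟨y, hy, h1, h2⟩ := h.exists_between hab
  obtain ⟨n, m, rfl⟩ := AddSubgroup.mem_closure_pair.1 hy
  exact ⟨n, m, by simpa using h1, by simpa using h2⟩

lemma weights : ∃ w : ℤ → ℝ, (∀ n, 0 < w n) ∧ HasSum w 1 := by
  obtain ⟨u, h1, c, h2, h3⟩ := posSumOfEncodable one_pos ℤ
  have hc : 0 < c := by
    rw [← h2.tsum_eq]
    exact h2.summable.tsum_pos (fun n => (h1 n).le) 0 (h1 0)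
  refine ⟨fun n => u n / c, fun n => div_pos (h1 n) hc, ?_⟩
  have := h2.div_const c
  rwa [div_self hc.ne'] at this

structure PD (α : ℝ) where
  A : ℝ → ℝ
  B : ℝ → ℝ
  AB : ∀ x, A x ≤ B x
  lt : ∀ x y, x < y → B x < A y
  gap : ∀ x, A x < B x ↔ ∃ n m : ℤ, x = n * α + m
  A_add : ∀ x, A (x + 1) = A x + 1
  B_add : ∀ x, B (x + 1) = B x + 1
  Bc : ∀ x ε, 0 < ε → ∃ y, x < y ∧ B y < B x + ε
  Ac : ∀ x ε, 0 < ε → ∃ y, y < x ∧ A x - ε < A y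
  B0 : B 0 = 0

section
variable (α : ℝ) (w : ℤ → ℝ)

def tB (x : ℝ) (n : ℤ) : ℝ := w n * ((⌊x - n * α⌋ : ℝ) - ⌊-(n * α)⌋)
def tA (x : ℝ) (n : ℤ) : ℝ := w n * ((⌈x - n * α⌉ : ℝ) - 1 - ⌊-(n * α)⌋)

variable {α w}

lemma tB_bd (hw : ∀ n, 0 < w n) (x : ℝ) (n : ℤ) : ‖tB α w x n‖ ≤ w n * (|x| + 1) := by
  rw [tB, norm_mul, Real.norm_of_nonneg (hw n).le]
  apply mul_le_mul_of_nonneg_left _ (hw n).le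
  rw [Real.norm_eq_abs, abs_le]
  have h1 := Int.floor_le (x - n * α)
  have h2 := Int.lt_floor_add_one (x - n * α)
  have h3 := Int.floor_le (-(n * α))
  have h4 := Int.lt_floor_add_one (-(n * α))
  have := neg_abs_le x
  have := le_abs_self x
  constructor <;> linarith

lemma tA_bd (hw : ∀ n, 0 < w n) (x : ℝ) (n : ℤ) : ‖tA α w x n‖ ≤ w n * (|x| + 1) := by
  rw [tA, norm_mul, Real.norm_of_nonneg (hw n).le]
  apply mul_le_mul_of_nonneg_left _ (hw n).le
  rw [Real.norm_eq_abs, abs_le]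
  have h1 := Int.le_ceil (x - n * α)
  have h2 := Int.ceil_lt_add_one (x - n * α)
  have h3 := Int.floor_le (-(n * α))
  have h4 := Int.lt_floor_add_one (-(n * α))
  have := neg_abs_le x
  have := le_abs_self x
  constructor <;> linarith

lemma sB (hw : ∀ n, 0 < w n) (hs : HasSum w 1) (x : ℝ) : Summable (tB α w x) :=
  Summable.of_norm_bounded (hs.summable.mul_right _) (tB_bd hw x)

lemma sA (hw : ∀ n, 0 < w n) (hs : HasSum w 1) (x : ℝ) : Summable (tA α w x) :=
  Summable.of_norm_bounded (hs.summable.mul_right _) (tA_bd hw x)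

lemma tAB (hw : ∀ n, 0 < w n) (x : ℝ) (n : ℤ) : tA α w x n ≤ tB α w x n := by
  apply mul_le_mul_of_nonneg_left _ (hw n).le
  have : (⌈x - n * α⌉ : ℝ) ≤ ⌊x - n * α⌋ + 1 := by exact_mod_cast Int.ceil_le_floor_add_one _
  linarith

lemma tBA (hw : ∀ n, 0 < w n) {x y : ℝ} (h : x < y) (n : ℤ) : tB α w x n ≤ tA α w y n := by
  apply mul_le_mul_of_nonneg_left _ (hw n).le
  have : ⌊x - n * α⌋ < ⌈y - n * α⌉ := by
    rw [Int.lt_ceil]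
    have := Int.floor_le (x - n * α)
    linarith
  have : (⌊x - n * α⌋ : ℝ) + 1 ≤ ⌈y - n * α⌉ := by exact_mod_cast this
  linarith

lemma tBA' (hw : ∀ n, 0 < w n) {x y : ℝ} (n m : ℤ) (h1 : x < n * α + m) (h2 : n * α + m < y) : tB α w x n < tA α w y n := by
  apply mul_lt_mul_of_pos_left _ (hw n)
  have a1 : ⌊x - n * α⌋ < m := by rw [Int.floor_lt]; linarith
  have a2 : m < ⌈y - n * α⌉ := by rw [Int.lt_ceil]; linarith
  have : (⌊x - n * α⌋ : ℝ) + 2 ≤ ⌈y - n * α⌉ := by exact_mod_cast (by omega : ⌊x - n * α⌋ + 2 ≤ ⌈y - n * α⌉)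
  linarith

lemma tgap (hw : ∀ n, 0 < w n) (x : ℝ) (n : ℤ) : tA α w x n < tB α w x n ↔ ∃ m : ℤ, x = n * α + m := by
  constructor
  · intro h
    have h' := lt_of_mul_lt_mul_left h (hw n).le
    refine ⟨⌊x - n * α⌋, ?_⟩
    have h1 : ⌈x - n * α⌉ ≤ ⌊x - n * α⌋ := by
      have : (⌈x - n * α⌉ : ℝ) < ⌊x - n * α⌋ + 1 := by linarith
      have : ⌈x - n * α⌉ < ⌊x - n * α⌋ + 1 := by exact_mod_cast this
      omega
    have h2 : (⌈x - n * α⌉ : ℝ) ≤ ⌊x - n * α⌋ := by exact_mod_cast h1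
    have := Int.le_ceil (x - n * α)
    have := Int.floor_le (x - n * α)
    linarith
  · rintro ⟨m, hm⟩
    apply mul_lt_mul_of_pos_left _ (hw n)
    have : x - n * α = m := by linarith
    rw [this]
    simp

lemma BcT (hw : ∀ n, 0 < w n) (hs : HasSum w 1) (x : ℝ) : Tendsto (fun y => ∑' n, tB α w y n) (𝓝[>] x) (𝓝 (∑' n, tB α w x n)) := by
  apply tendsto_tsum_of_dominated_convergence (bound := fun n => w n * ((|x| + 1) + 1)) (hs.summable.mul_right _)
  · intro n
    apply tendsto_const_nhds.congr'
    have : ∀ᶠ y in 𝓝[>] x, y < n * α + ⌊x - n * α⌋ + 1 :=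
      mem_nhdsWithin_of_mem_nhds (Iio_mem_nhds (by have := Int.lt_floor_add_one (x - n * α); linarith))
    filter_upwards [this, self_mem_nhdsWithin] with y hy hxy
    have hxy : x < y := hxy
    have : ⌊y - n * α⌋ = ⌊x - n * α⌋ := by
      rw [Int.floor_eq_iff]
      have := Int.floor_le (x - n * α)
      constructor <;> linarith
    rw [tB, tB, this]
  · filter_upwards [mem_nhdsWithin_of_mem_nhds (Metric.ball_mem_nhds x one_pos)] with y hy n
    refine (tB_bd hw y n).trans (mul_le_mul_of_nonneg_left ?_ (hw n).le)
    rw [Metric.mem_ball, Real.dist_eq] at hy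
    have := abs_sub_abs_le_abs_sub y x
    linarith

lemma AcT (hw : ∀ n, 0 < w n) (hs : HasSum w 1) (x : ℝ) : Tendsto (fun y => ∑' n, tA α w y n) (𝓝[<] x) (𝓝 (∑' n, tA α w x n)) := by
  apply tendsto_tsum_of_dominated_convergence (bound := fun n => w n * ((|x| + 1) + 1)) (hs.summable.mul_right _)
  · intro n
    apply tendsto_const_nhds.congr'
    have : ∀ᶠ y in 𝓝[<] x, n * α + ⌈x - n * α⌉ - 1 < y :=
      mem_nhdsWithin_of_mem_nhds (Ioi_mem_nhds (by have := Int.ceil_lt_add_one (x - n * α); linarith))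
    filter_upwards [this, self_mem_nhdsWithin] with y hy hxy
    have hxy : y < x := hxy
    have : ⌈y - n * α⌉ = ⌈x - n * α⌉ := by
      rw [Int.ceil_eq_iff]
      have := Int.le_ceil (x - n * α)
      constructor <;> linarith
    rw [tA, tA, this]
  · filter_upwards [mem_nhdsWithin_of_mem_nhds (Metric.ball_mem_nhds x one_pos)] with y hy n
    refine (tA_bd hw y n).trans (mul_le_mul_of_nonneg_left ?_ (hw n).le)
    rw [Metric.mem_ball, Real.dist_eq] at hy
    have := abs_sub_abs_le_abs_sub y x
    linarith

end

lemma exists_PD {α : ℝ} (hα : Irrational α) : Nonempty (PD α) := by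
  obtain ⟨w, hw, hs⟩ := weights
  refine ⟨⟨fun x => ∑' n, tA α w x n, fun x => ∑' n, tB α w x n, ?_, ?_, ?_, ?_, ?_, ?_, ?_, ?_⟩⟩
  · exact fun x => (sA hw hs x).tsum_le_tsum (tAB hw x) (sB hw hs x)
  · intro x y hxy
    obtain ⟨n, m, h1, h2⟩ := dens hα hxy
    exact Summable.tsum_lt_tsum (tBA hw hxy) (tBA' hw n m h1 h2) (sB hw hs x) (sA hw hs y)
  · intro x
    constructor
    · intro h
      by_contra hno
      push Not at hno
      have : ∀ n, tA α w x n = tB α w x n := fun n => by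
        refine le_antisymm (tAB hw x n) (not_lt.1 fun hlt => ?_)
        obtain ⟨m, hm⟩ := (tgap hw x n).1 hlt
        exact hno n m hm
      exact h.ne (tsum_congr this)
    · rintro ⟨n, m, h⟩
      exact Summable.tsum_lt_tsum (tAB hw x) ((tgap hw x n).2 ⟨m, h⟩) (sA hw hs x) (sB hw hs x)
  · intro x
    have := ((sA (α := α) hw hs x).hasSum.add hs).tsum_eq
    rw [← this]
    congr 1; funext n
    rw [tA, tA, show x + 1 - n * α = (x - n * α) + 1 by ring, Int.ceil_add_one]
    push_cast; ring
  · intro x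
    have := ((sB (α := α) hw hs x).hasSum.add hs).tsum_eq
    rw [← this]
    congr 1; funext n
    rw [tB, tB, show x + 1 - n * α = (x - n * α) + 1 by ring, Int.floor_add_one]
    push_cast; ring
  · intro x ε hε
    obtain ⟨y, h1, h2⟩ := (((BcT (α := α) hw hs x).eventually (Iio_mem_nhds (lt_add_of_pos_right _ hε))).and
      self_mem_nhdsWithin).exists
    exact ⟨y, h2, h1⟩
  · intro x ε hε
    obtain ⟨y, h1, h2⟩ := (((AcT (α := α) hw hs x).eventually (Ioi_mem_nhds (sub_lt_self _ hε))).and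
      self_mem_nhdsWithin).exists
    exact ⟨y, h2, h1⟩
  · simp [tB]

end DJ

namespace DJ
namespace PD
variable {α : ℝ} (D : PD α)

def F (x s : ℝ) : ℝ := (1 - s) * D.A x + s * D.B x

lemma F_one (x : ℝ) : D.F x 1 = D.B x := by simp [F]
lemma F_zero (x : ℝ) : D.F x 0 = D.A x := by simp [F]

lemma A_le_F {x s : ℝ} (h0 : 0 ≤ s) : D.A x ≤ D.F x s := by
  have := mul_nonneg h0 (sub_nonneg.2 (D.AB x))
  simp only [F]; linarith

lemma F_le_B {x s : ℝ} (h1 : s ≤ 1) : D.F x s ≤ D.B x := by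
  have := mul_nonneg (sub_nonneg.2 h1) (sub_nonneg.2 (D.AB x))
  simp only [F]; linarith

lemma F_lt {x y s s' : ℝ} (h : x < y) (hs : s ≤ 1) (hs' : 0 ≤ s') : D.F x s < D.F y s' :=
  (D.F_le_B hs).trans_lt ((D.lt x y h).trans_le (D.A_le_F hs'))

lemma F_add (x s : ℝ) : D.F (x + 1) s = D.F x s + 1 := by
  simp only [F, D.A_add, D.B_add]; ring

lemma F_add_int (x s : ℝ) (m : ℤ) : D.F (x + m) s = D.F x s + m := by
  induction m using Int.induction_on with
  | zero => simp
  | succ n ih => push_cast at *; rw [← add_assoc, F_add, ih]; ring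
  | pred n ih =>
    push_cast at *
    have := D.F_add (x + (-n - 1)) s
    rw [show x + (-(n:ℝ) - 1) + 1 = x + -n by ring, ih] at this
    linarith

lemma F_surj (t : ℝ) : ∃ x s, (0 ≤ s ∧ s ≤ 1) ∧ D.F x s = t := by
  set S : Set ℝ := {y | D.A y ≤ t} with hS
  have hA : ∀ m : ℤ, D.A m = D.A 0 + m := fun m => by
    have := D.F_add_int 0 0 m
    simpa [F_zero] using this
  have mono : ∀ x y, x ≤ y → D.A x ≤ D.A y := fun x y h => by
    rcases h.eq_or_lt with rfl | h
    · exact le_rfl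
    · exact (D.AB x).trans (D.lt x y h).le
  have hne : S.Nonempty := ⟨(⌊t - D.A 0⌋ : ℤ), by
    simp only [hS, mem_ofPred_eq, hA]; have := Int.floor_le (t - D.A 0); linarith⟩
  have hbd : BddAbove S := ⟨(⌊t - D.A 0⌋ + 1 : ℤ), by
    intro y hy
    by_contra hlt
    push Not at hlt
    have h1 := mono _ _ hlt.le
    rw [hA] at h1
    have := Int.lt_floor_add_one (t - D.A 0)
    push_cast at h1
    have hy : D.A y ≤ t := hy
    linarith⟩
  set x := sSup S with hx
  have h1 : D.A x ≤ t := by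
    by_contra hlt
    push Not at hlt
    obtain ⟨y, hy, hy2⟩ := D.Ac x (D.A x - t) (sub_pos.2 hlt)
    obtain ⟨z, hz, hyz⟩ := exists_lt_of_lt_csSup hne hy
    have := mono _ _ hyz.le
    have hz : D.A z ≤ t := hz
    linarith
  have h2 : t ≤ D.B x := by
    by_contra hlt
    push Not at hlt
    obtain ⟨y, hy, hy2⟩ := D.Bc x (t - D.B x) (sub_pos.2 hlt)
    have : y ∈ S := by
      have := D.AB y
      show D.A y ≤ t
      linarith
    exact absurd (le_csSup hbd this) (not_le.2 hy)
  rcases (D.AB x).eq_or_lt with he | hl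
  · exact ⟨x, 0, ⟨le_rfl, zero_le_one⟩, by rw [F_zero]; linarith⟩
  · have hp : 0 < D.B x - D.A x := sub_pos.2 hl
    refine ⟨x, (t - D.A x) / (D.B x - D.A x), ⟨div_nonneg (by linarith) hp.le, (div_le_one hp).2 (by linarith)⟩, ?_⟩
    simp only [F]; field_simp; ring

def xx (t : ℝ) : ℝ := (D.F_surj t).choose
def ss (t : ℝ) : ℝ := (D.F_surj t).choose_spec.choose
lemma ss0 (t : ℝ) : 0 ≤ D.ss t := (D.F_surj t).choose_spec.choose_spec.1.1
lemma ss1 (t : ℝ) : D.ss t ≤ 1 := (D.F_surj t).choose_spec.choose_spec.1.2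
lemma F_xs (t : ℝ) : D.F (D.xx t) (D.ss t) = t := (D.F_surj t).choose_spec.choose_spec.2

def H (n : ℤ) (t : ℝ) : ℝ := D.F (D.xx t + n * α) (D.ss t)

lemma gap_add (x : ℝ) (n : ℤ) : D.A (x + n * α) < D.B (x + n * α) ↔ D.A x < D.B x := by
  rw [D.gap, D.gap]
  constructor
  · rintro ⟨a, b, h⟩
    exact ⟨a - n, b, by push_cast; linarith⟩
  · rintro ⟨a, b, h⟩
    exact ⟨a + n, b, by push_cast; linarith⟩

lemma F_le {x x' s s' : ℝ} (hs' : s' ≤ 1) (hs : 0 ≤ s) (h : D.F x s ≤ D.F x' s') : x ≤ x' := by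
  by_contra hlt
  push Not at hlt
  exact absurd (D.F_lt hlt hs' hs) (not_lt.2 h)

lemma F_inj {x x' s s' : ℝ} (h0 : 0 ≤ s) (h1 : s ≤ 1) (h0' : 0 ≤ s') (h1' : s' ≤ 1)
    (h : D.F x s = D.F x' s') : x = x' :=
  le_antisymm (D.F_le h1' h0 h.le) (D.F_le h1 h0' h.ge)

lemma F_lt_iff (x s s' : ℝ) : D.F x s < D.F x s' ↔ D.A x < D.B x ∧ s < s' := by
  have e : D.F x s' - D.F x s = (s' - s) * (D.B x - D.A x) := by simp only [F]; ring
  have := D.AB x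
  rw [← sub_pos, e]
  constructor
  · intro h
    have h3 : 0 < D.B x - D.A x := by
      rcases this.eq_or_lt with h' | h'
      · rw [h', sub_self, mul_zero] at h; exact (lt_irrefl _ h).elim
      · linarith
    exact ⟨by linarith, by have := (mul_pos_iff_of_pos_right h3).1 h; linarith⟩
  · rintro ⟨h1, h2⟩
    exact mul_pos (by linarith) (by linarith)

lemma H_F (n : ℤ) {x s : ℝ} (h0 : 0 ≤ s) (h1 : s ≤ 1) : D.H n (D.F x s) = D.F (x + n * α) s := by
  have e := D.F_xs (D.F x s)
  have hx := D.F_inj (D.ss0 _) (D.ss1 _) h0 h1 e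
  rw [H]
  rw [hx] at e ⊢
  refine le_antisymm (not_lt.1 fun h => ?_) (not_lt.1 fun h => ?_)
  · rw [F_lt_iff, gap_add, ← F_lt_iff] at h
    exact h.ne e.symm
  · rw [F_lt_iff, gap_add, ← F_lt_iff] at h
    exact h.ne e

lemma H_mono (n : ℤ) : StrictMono (D.H n) := by
  intro t t' h
  have h' := h
  rw [← D.F_xs t, ← D.F_xs t'] at h'
  have hx := D.F_le (D.ss1 t') (D.ss0 t) h'.le
  rcases hx.eq_or_lt with he | hl
  · rw [H, H]
    rw [he] at h' ⊢
    rwa [F_lt_iff, gap_add, ← F_lt_iff]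
  · exact D.F_lt (by linarith) (D.ss1 _) (D.ss0 _)

lemma H_H (n m : ℤ) (t : ℝ) : D.H n (D.H m t) = D.H (m + n) t := by
  rw [show D.H m t = D.F (D.xx t + m * α) (D.ss t) from rfl, H_F _ _ (D.ss0 _) (D.ss1 _), H]
  push_cast
  rw [add_mul, add_assoc]

lemma H_zero (t : ℝ) : D.H 0 t = t := by
  rw [H]; simp [D.F_xs]

lemma H_surj (n : ℤ) : Function.Surjective (D.H n) := fun t => ⟨D.H (-n) t, by rw [H_H]; simp [H_zero]⟩

lemma H_cont (n : ℤ) : Continuous (D.H n) := (D.H_mono n).monotone.continuous_of_surjective (D.H_surj n)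

lemma H_add_one (n : ℤ) (t : ℝ) : D.H n (t + 1) = D.H n t + 1 := by
  conv_lhs => rw [← D.F_xs t, ← F_add, H_F _ _ (D.ss0 _) (D.ss1 _)]
  rw [H, ← F_add]; ring_nf

def T' (n : ℤ) : UnitAddCircle → UnitAddCircle :=
  Function.Periodic.lift (f := fun t => ((D.H n t : ℝ) : UnitAddCircle)) (c := 1)
    (fun t => by simp only [H_add_one, AddCircle.coe_add_period])

lemma T'_coe (n : ℤ) (t : ℝ) : D.T' n (t : UnitAddCircle) = ((D.H n t : ℝ) : UnitAddCircle) := rfl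

lemma T'_cont (n : ℤ) : Continuous (D.T' n) := by
  have hq : IsQuotientMap (fun t : ℝ => (t : UnitAddCircle)) := QuotientAddGroup.isQuotientMap_mk _
  rw [hq.continuous_iff]
  exact (AddCircle.continuous_mk' 1).comp (D.H_cont n)

lemma T'_T' (n m : ℤ) (z : UnitAddCircle) : D.T' n (D.T' m z) = D.T' (m + n) z := by
  induction z using QuotientAddGroup.induction_on with
  | H t => rw [T'_coe, T'_coe, H_H, T'_coe]

lemma T'_zero (z : UnitAddCircle) : D.T' 0 z = z := by
  induction z using QuotientAddGroup.induction_on with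
  | H t => rw [T'_coe, H_zero]

def h : UnitAddCircle ≃ₜ UnitAddCircle where
  toFun := D.T' 1
  invFun := D.T' (-1)
  left_inv z := by rw [T'_T']; exact D.T'_zero z
  right_inv z := by rw [T'_T']; exact D.T'_zero z
  continuous_toFun := D.T'_cont 1
  continuous_invFun := D.T'_cont (-1)

lemma h_zpow (n : ℤ) (z : UnitAddCircle) : (D.h.toEquiv ^ n) z = D.T' n z := by
  induction n using Int.induction_on generalizing z with
  | zero => rw [zpow_zero, T'_zero]; rfl
  | succ n ih =>
    rw [zpow_add_one, Equiv.Perm.mul_apply, ih]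
    show D.T' n (D.T' 1 z) = _
    rw [T'_T', add_comm]
  | pred n ih =>
    rw [zpow_sub_one, Equiv.Perm.mul_apply, ih]
    show D.T' (-n) (D.T' (-1) z) = _
    rw [T'_T']; congr 1; ring


def R : Set ℝ := {t | ∃ x, t = D.A x ∨ t = D.B x}
def K : Set UnitAddCircle := (fun t : ℝ => (t : UnitAddCircle)) '' D.R

lemma R_iff (t : ℝ) : t ∈ D.R ↔ ∃ x s, (s = 0 ∨ s = 1) ∧ t = D.F x s := by
  constructor
  · rintro ⟨x, h | h⟩
    · exact ⟨x, 0, Or.inl rfl, by rw [h, F_zero]⟩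
    · exact ⟨x, 1, Or.inr rfl, by rw [h, F_one]⟩
  · rintro ⟨x, s, rfl | rfl, h⟩
    · exact ⟨x, Or.inl (by rw [h, F_zero])⟩
    · exact ⟨x, Or.inr (by rw [h, F_one])⟩

lemma s01 {s : ℝ} (h : s = 0 ∨ s = 1) : 0 ≤ s ∧ s ≤ 1 := by
  rcases h with rfl | rfl <;> norm_num

lemma R_H {t : ℝ} (n : ℤ) (ht : t ∈ D.R) : D.H n t ∈ D.R := by
  rw [R_iff] at *
  obtain ⟨x, s, hs, rfl⟩ := ht
  exact ⟨x + n * α, s, hs, D.H_F n (s01 hs).1 (s01 hs).2⟩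

lemma R_add {t : ℝ} (m : ℤ) (ht : t ∈ D.R) : t + m ∈ D.R := by
  rw [R_iff] at *
  obtain ⟨x, s, hs, rfl⟩ := ht
  exact ⟨x + m, s, hs, (D.F_add_int _ _ m).symm⟩

lemma coe_eq {s t : ℝ} (h : (s : UnitAddCircle) = (t : UnitAddCircle)) : ∃ m : ℤ, s = t + m := by
  rw [← sub_eq_zero, ← AddCircle.coe_sub, AddCircle.coe_eq_zero_iff] at h
  obtain ⟨n, hn⟩ := h
  exact ⟨n, by simp at hn; linarith⟩

lemma mem_K (t : ℝ) : (t : UnitAddCircle) ∈ D.K ↔ t ∈ D.R := by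
  constructor
  · rintro ⟨s, hs, h⟩
    obtain ⟨m, rfl⟩ := coe_eq (show (s : UnitAddCircle) = t from h)
    have := D.R_add (-m) hs
    simpa using this
  · exact fun h => ⟨t, h, rfl⟩

lemma F_not_R {x s : ℝ} (h0 : 0 < s) (h1 : s < 1) (hg : D.A x < D.B x) : D.F x s ∉ D.R := by
  rw [R_iff]
  rintro ⟨y, s', hs', h⟩
  have := D.F_inj h0.le h1.le (s01 hs').1 (s01 hs').2 h
  subst this
  rcases lt_trichotomy s s' with hl | he | hl
  · exact ((D.F_lt_iff _ _ _).2 ⟨hg, hl⟩).ne h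
  · rcases hs' with rfl | rfl <;> linarith
  · exact ((D.F_lt_iff _ _ _).2 ⟨hg, hl⟩).ne h.symm

lemma R_closed : IsClosed D.R := by
  rw [← isOpen_compl_iff, isOpen_iff_mem_nhds]
  intro t ht
  obtain ⟨x, s, ⟨h0, h1⟩, rfl⟩ := D.F_surj t
  have hA : D.F x s ≠ D.A x := fun h => ht ⟨x, Or.inl h⟩
  have hB : D.F x s ≠ D.B x := fun h => ht ⟨x, Or.inr h⟩
  have hA' := lt_of_le_of_ne (D.A_le_F (x := x) h0) hA.symm
  have hB' := lt_of_le_of_ne (D.F_le_B (x := x) h1) hB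
  filter_upwards [Ioo_mem_nhds hA' hB'] with u hu
  rintro ⟨y, hy⟩
  have hAB := D.AB y
  rcases lt_trichotomy x y with hl | rfl | hl
  · have := D.lt x y hl
    rcases hy with rfl | rfl <;> linarith [hu.1, hu.2]
  · rcases hy with rfl | rfl <;> linarith [hu.1, hu.2]
  · have := D.lt y x hl
    rcases hy with rfl | rfl <;> linarith [hu.1, hu.2]

lemma K_closed : IsClosed D.K := by
  have hq : IsQuotientMap (fun t : ℝ => (t : UnitAddCircle)) := QuotientAddGroup.isQuotientMap_mk _
  rw [← hq.isClosed_preimage]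
  convert D.R_closed using 1
  ext t
  exact D.mem_K t

lemma T'_K {z : UnitAddCircle} (n : ℤ) (hz : z ∈ D.K) : D.T' n z ∈ D.K := by
  obtain ⟨t, ht, rfl⟩ := hz
  exact ⟨_, D.R_H n ht, rfl⟩

lemma K_inv : D.h '' D.K = D.K := by
  apply subset_antisymm
  · rintro _ ⟨z, hz, rfl⟩
    exact D.T'_K 1 hz
  · intro z hz
    exact ⟨D.T' (-1) z, D.T'_K _ hz, D.h.right_inv z⟩

lemma gap0 : D.A 0 < D.B 0 := (D.gap 0).2 ⟨0, 0, by simp⟩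

lemma K_proper : D.K ≠ univ := by
  intro h
  have : ((D.F 0 (1/2) : ℝ) : UnitAddCircle) ∈ D.K := h ▸ mem_univ _
  rw [mem_K] at this
  exact D.F_not_R (by norm_num) (by norm_num) D.gap0 this

lemma approach (hα : Irrational α) {t u : ℝ} (ht : t ∈ D.R) (hu : u ∈ D.R) {ε : ℝ} (hε : 0 < ε) :
    ∃ n m : ℤ, D.H n t + m ≠ u ∧ |D.H n t + m - u| < ε := by
  rw [R_iff] at ht
  obtain ⟨x, s, hs, rfl⟩ := ht
  obtain ⟨h0, h1⟩ := s01 hs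
  have e : ∀ n m : ℤ, D.H n (D.F x s) + m = D.F (x + n * α + m) s := fun n m => by
    rw [H_F _ _ h0 h1, F_add_int]
  obtain ⟨y, rfl | rfl⟩ := hu
  · obtain ⟨y', hy, hy2⟩ := D.Ac y ε hε
    obtain ⟨n, m, a1, a2⟩ := dens hα (show y' - x < y - x by linarith)
    refine ⟨n, m, ?_⟩
    rw [e]
    have b1 := D.F_lt (s := 0) (s' := s) (show y' < x + n * α + m by linarith) zero_le_one h0
    have b2 := D.F_lt (s := s) (s' := 0) (show x + n * α + m < y by linarith) h1 le_rfl
    rw [F_zero] at b1 b2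
    exact ⟨b2.ne, by rw [abs_lt]; constructor <;> linarith⟩
  · obtain ⟨y', hy, hy2⟩ := D.Bc y ε hε
    obtain ⟨n, m, a1, a2⟩ := dens hα (show y - x < y' - x by linarith)
    refine ⟨n, m, ?_⟩
    rw [e]
    have b1 := D.F_lt (s := 1) (s' := s) (show y < x + n * α + m by linarith) le_rfl h0
    have b2 := D.F_lt (s := s) (s' := 1) (show x + n * α + m < y' by linarith) h1 zero_le_one
    rw [F_one] at b1 b2
    exact ⟨b1.ne', by rw [abs_lt]; constructor <;> linarith⟩

lemma coe_shift (t : ℝ) (m : ℤ) : ((t + m : ℝ) : UnitAddCircle) = (t : UnitAddCircle) := by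
  rw [AddCircle.coe_add]
  have : ((m : ℝ) : UnitAddCircle) = 0 := by
    rw [AddCircle.coe_eq_zero_iff]; exact ⟨m, by simp⟩
  rw [this, add_zero]

lemma K_min (hα : Irrational α) : ∀ x ∈ D.K, ∀ y ∈ D.K,
    y ∈ closure {z | ∃ n : ℤ, (D.h.toEquiv ^ n) x = z} := by
  rintro _ ⟨t, ht, rfl⟩ _ ⟨u, hu, rfl⟩
  rw [mem_closure_iff_nhds]
  intro V hV
  have hV' := (AddCircle.continuous_mk' (1:ℝ)).continuousAt (x := u) hV
  obtain ⟨ε, hε, hb⟩ := Metric.mem_nhds_iff.1 hV'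
  obtain ⟨n, m, -, h2⟩ := D.approach hα ht hu hε
  refine ⟨((D.H n t + m : ℝ) : UnitAddCircle), hb (by rwa [Metric.mem_ball, Real.dist_eq]), n, ?_⟩
  rw [h_zpow, T'_coe, coe_shift]

lemma K_perf (hα : Irrational α) : Perfect D.K := by
  refine ⟨D.K_closed, ?_⟩
  rintro _ ⟨u, hu, rfl⟩
  rw [accPt_iff_nhds]
  intro V hV
  have hV' := (AddCircle.continuous_mk' (1:ℝ)).continuousAt (x := u) hV
  obtain ⟨ε, hε, hb⟩ := Metric.mem_nhds_iff.1 hV'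
  obtain ⟨n, m, h1, h2⟩ := D.approach hα hu hu (lt_min hε one_pos)
  refine ⟨((D.H n u + m : ℝ) : UnitAddCircle), ⟨hb (by rw [Metric.mem_ball, Real.dist_eq]; exact h2.trans_le (min_le_left _ _)), ?_⟩, ?_⟩
  · exact ⟨_, D.R_add m (D.R_H n hu), rfl⟩
  · intro h
    obtain ⟨l, hl⟩ := coe_eq (show ((D.H n u + m : ℝ) : UnitAddCircle) = u from h)
    rw [hl] at h1 h2
    rw [add_sub_cancel_left] at h2
    have h3 := h2.trans_le (min_le_right _ _)
    have : |l| < 1 := by exact_mod_cast h3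
    rw [Int.abs_lt_one_iff] at this
    simp [this] at h1

lemma H_one_iter (n : ℕ) : (D.H 1)^[n] 0 = D.B (n * α) := by
  induction n with
  | zero => simp [D.B0]
  | succ n ih =>
    rw [Function.iterate_succ_apply', ih, ← F_one, H_F _ _ zero_le_one le_rfl, F_one]
    congr 1; push_cast; ring

lemma B_near (x : ℝ) : |D.B x - x| ≤ 1 := by
  have hB : ∀ m : ℤ, D.B m = m := fun m => by
    have := D.F_add_int 0 1 m
    simpa [F_one, D.B0] using this
  have mono : ∀ x y, x ≤ y → D.B x ≤ D.B y := fun x y h => by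
    rcases h.eq_or_lt with rfl | h
    · exact le_rfl
    · exact (D.lt x y h).le.trans (D.AB y)
  have h1 := mono _ _ (Int.floor_le x)
  have h2 := mono _ _ (Int.lt_floor_add_one x).le
  rw [hB] at h1
  have := hB (⌊x⌋ + 1)
  push_cast at this
  rw [this] at h2
  have := Int.floor_le x
  have := Int.lt_floor_add_one x
  rw [abs_le]; constructor <;> linarith

lemma rot_lim : Tendsto (fun n : ℕ => (D.H 1)^[n] 0 / (n : ℝ)) atTop (𝓝 α) := by
  rw [tendsto_iff_dist_tendsto_zero]
  refine squeeze_zero' (Eventually.of_forall fun _ => dist_nonneg) ?_ tendsto_one_div_atTop_nhds_zero_nat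
  filter_upwards [eventually_gt_atTop 0] with n hn
  have hn : (0:ℝ) < n := by exact_mod_cast hn
  rw [H_one_iter, Real.dist_eq]
  have : D.B (n * α) / n - α = (D.B (n * α) - n * α) / n := by field_simp
  rw [this, abs_div, abs_of_pos hn]
  exact div_le_div_of_nonneg_right (D.B_near _) hn.le

end PD
end DJ

namespace DJ
namespace PD
variable {α : ℝ} (D : PD α)

open Classical in
def G (s y : ℝ) : ℤ := if s = 1 then ⌊y⌋ else ⌈y⌉ - 1

lemma G_one (y : ℝ) : G 1 y = ⌊y⌋ := by simp [G]
lemma G_zero (y : ℝ) : G 0 y = ⌈y⌉ - 1 := by simp [G]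

lemma G_add (s y : ℝ) (m : ℤ) : G s (y + m) = G s y + m := by
  unfold G
  split_ifs
  · simp
  · rw [Int.ceil_add_intCast]; ring

lemma floor_F {a y s : ℝ} (ha : ∃ n m : ℤ, a = n * α + m) (hs : s = 0 ∨ s = 1) :
    ⌊D.F y s - D.F a (1/2)⌋ = G s (y - a) := by
  have hgap : ∀ m : ℤ, D.A (a + m) < D.B (a + m) := fun l => by
    rw [D.gap]
    obtain ⟨n, m, h⟩ := ha
    exact ⟨n, m + l, by push_cast; linarith⟩
  have e : ∀ m : ℤ, D.F a (1/2) + m = D.F (a + m) (1/2) := fun m => (D.F_add_int _ _ _).symm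
  rcases hs with rfl | rfl
  · rw [G_zero, Int.floor_eq_iff]
    set m := ⌈y - a⌉ - 1 with hm
    have h1 : y - a ≤ m + 1 := by rw [hm]; push_cast; linarith [Int.le_ceil (y - a)]
    have h2 : m < y - a := by rw [hm]; push_cast; linarith [Int.ceil_lt_add_one (y - a)]
    have e1 := e m
    have e2 := e (m + 1)
    push_cast at e2
    have b1 := D.F_lt (x := a + m) (y := y) (s := 1/2) (s' := 0) (by linarith) (by norm_num) le_rfl
    have b2 : D.F y 0 < D.F (a + (m + 1)) (1/2) := by
      rcases (show y ≤ a + (m + 1) by linarith).eq_or_lt with h | h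
      · rw [h, F_lt_iff]
        have := hgap (m + 1)
        push_cast at this
        exact ⟨this, by norm_num⟩
      · exact D.F_lt h (by norm_num) (by norm_num)
    constructor <;> linarith
  · rw [G_one, Int.floor_eq_iff]
    set m := ⌊y - a⌋ with hm
    have h1 := Int.floor_le (y - a)
    have h2 := Int.lt_floor_add_one (y - a)
    rw [← hm] at h1 h2
    have e1 := e m
    have e2 := e (m + 1)
    push_cast at e2
    have b2 := D.F_lt (x := y) (y := a + (m + 1)) (s := 1) (s' := 1/2) (by linarith) (by norm_num) (by norm_num)
    have b1 : D.F (a + m) (1/2) ≤ D.F y 1 := by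
      rcases (show a + m ≤ y by linarith).eq_or_lt with h | h
      · rw [← h]
        exact ((D.F_lt_iff _ _ _).2 ⟨hgap m, by norm_num⟩).le
      · exact (D.F_lt h (by norm_num) (by norm_num)).le
    constructor <;> linarith

def bz (t : ℝ) : ℤ := ⌊t - D.F 0 (1/2)⌋ - ⌊t - D.F α (1/2)⌋

lemma bz_F {y s : ℝ} (hs : s = 0 ∨ s = 1) : D.bz (D.F y s) = G s y - G s (y - α) := by
  rw [bz, D.floor_F ⟨0, 0, by simp⟩ hs, D.floor_F ⟨1, 0, by simp⟩ hs, sub_zero]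

lemma bz_01 (h0 : 0 < α) (h1 : α < 1) (t : ℝ) : D.bz t = 0 ∨ D.bz t = 1 := by
  have a1 := D.F_lt (s := 1/2) (s' := 1/2) h0 (by norm_num) (by norm_num)
  have a2 := D.F_lt (s := 1/2) (s' := 1/2) (show α < 0 + 1 by linarith) (by norm_num) (by norm_num)
  rw [F_add] at a2
  rw [bz]
  have b1 : ⌊t - D.F α (1/2)⌋ ≤ ⌊t - D.F 0 (1/2)⌋ := Int.floor_le_floor (by linarith)
  have b2 : ⌊t - D.F 0 (1/2)⌋ ≤ ⌊(t - D.F α (1/2)) + 1⌋ := Int.floor_le_floor (by linarith)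
  rw [Int.floor_add_one] at b2
  omega

def bc : UnitAddCircle → ℤ :=
  Function.Periodic.lift (f := D.bz) (c := 1) (fun t => by
    simp only [bz]
    rw [show ∀ c, t + 1 - c = (t - c) + 1 from fun c => by ring, show ∀ c, t + 1 - c = (t - c) + 1 from fun c => by ring,
      Int.floor_add_one, Int.floor_add_one]
    ring)

lemma bc_coe (t : ℝ) : D.bc (t : UnitAddCircle) = D.bz t := rfl

lemma floor_cont {a t : ℝ} (h : ∀ m : ℤ, t ≠ a + m) : ContinuousAt (fun t => ⌊t - a⌋) t := by
  apply ContinuousAt.comp (f := fun t => t - a) (g := fun u : ℝ => ⌊u⌋)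
  · have h1 : (⌊t - a⌋ : ℝ) < t - a := by
      refine lt_of_le_of_ne (Int.floor_le _) fun h' => h ⌊t - a⌋ (by linarith)
    have h2 := Int.lt_floor_add_one (t - a)
    apply ContinuousAt.congr (f := fun _ => ⌊t - a⌋) continuousAt_const
    filter_upwards [Ioo_mem_nhds h1 h2] with u hu
    exact (Int.floor_eq_iff.2 ⟨hu.1.le, hu.2⟩).symm
  · fun_prop

lemma bc_cont {z : UnitAddCircle} (hz : z ∈ D.K) : ContinuousAt D.bc z := by
  obtain ⟨t, ht, rfl⟩ := hz
  have hq : IsOpenQuotientMap (fun t : ℝ => (t : UnitAddCircle)) := QuotientAddGroup.isOpenQuotientMap_mk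
  rw [← hq.continuousAt_comp_iff]
  have hne : ∀ a, (∃ n m : ℤ, a = n * α + m) → ∀ m : ℤ, t ≠ D.F a (1/2) + m := by
    rintro a ha l h
    rw [← F_add_int] at h
    refine D.F_not_R (x := a + l) (s := 1/2) (by norm_num) (by norm_num) ?_ (h ▸ ht)
    rw [D.gap]
    obtain ⟨n, m, h⟩ := ha
    exact ⟨n, m + l, by push_cast; linarith⟩
  have h1 := floor_cont (hne 0 ⟨0, 0, by simp⟩)
  have h2 := floor_cont (hne α ⟨1, 0, by simp⟩)
  exact h1.sub h2

open Classical in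
def J (z : UnitAddCircle) (k : ℤ) : Fin 2 := if D.bc (D.T' k z) = 1 then 1 else 0

lemma J_h (z : UnitAddCircle) : D.J (D.h z) = shift2 (D.J z) := by
  funext k
  simp only [J, shift2]
  show (if D.bc (D.T' k (D.T' 1 z)) = 1 then (1 : Fin 2) else 0) = _
  rw [T'_T', add_comm]

lemma J_cont : ContinuousOn D.J D.K := by
  rw [continuousOn_pi]
  intro k z hz
  have h1 : ContinuousAt (fun z => D.bc (D.T' k z)) z :=
    ContinuousAt.comp (D.bc_cont (D.T'_K k hz)) (D.T'_cont k).continuousAt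
  classical
  exact ((continuous_of_discreteTopology (f := fun b : ℤ => if b = 1 then (1 : Fin 2) else 0)).continuousAt.comp
    h1).continuousWithinAt

lemma J_inj (hα : Irrational α) (h0 : 0 < α) (h1 : α < 1) : InjOn D.J D.K := by
  rintro _ ⟨t, ht, rfl⟩ _ ⟨u, hu, rfl⟩ hJ
  rw [R_iff] at ht hu
  obtain ⟨x, s, hs, rfl⟩ := ht
  obtain ⟨x', s', hs', rfl⟩ := hu
  obtain ⟨l, hl⟩ : ∃ l : ℤ, l = ⌊x - x'⌋ := ⟨_, rfl⟩
  obtain ⟨y, hy⟩ : ∃ y, y = x' + l := ⟨_, rfl⟩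
  have hyx : y ≤ x := by have := Int.floor_le (x - x'); rw [← hl] at this; linarith
  have hxy : x < y + 1 := by have := Int.lt_floor_add_one (x - x'); rw [← hl] at this; linarith
  have hcoe : ((D.F y s' : ℝ) : UnitAddCircle) = (D.F x' s' : ℝ) := by
    rw [hy, F_add_int, coe_shift]
  simp only at hJ ⊢
  rw [← hcoe] at hJ ⊢
  have hb : ∀ k : ℤ, G s (x + k * α) - G s (x + k * α - α) = G s' (y + k * α) - G s' (y + k * α - α) := by
    intro k
    have h := congrFun hJ k
    have g1 : D.bc (D.T' k ((D.F x s : ℝ) : UnitAddCircle)) = D.bz (D.F (x + k * α) s) := by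
      rw [T'_coe, bc_coe, D.H_F k (s01 hs).1 (s01 hs).2]
    have g2 : D.bc (D.T' k ((D.F y s' : ℝ) : UnitAddCircle)) = D.bz (D.F (y + k * α) s') := by
      rw [T'_coe, bc_coe, D.H_F k (s01 hs').1 (s01 hs').2]
    simp only [J, g1, g2] at h
    have c1 := D.bz_01 h0 h1 (D.F (x + k * α) s)
    have c2 := D.bz_01 h0 h1 (D.F (y + k * α) s')
    rw [← D.bz_F hs, ← D.bz_F hs']
    rcases c1 with c1 | c1 <;> rcases c2 with c2 | c2 <;> simp [c1, c2] at h ⊢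
  have hstep : ∀ k : ℤ, G s (x + (k + 1 : ℤ) * α) - G s' (y + (k + 1 : ℤ) * α) = G s (x + k * α) - G s' (y + k * α) := by
    intro k
    have := hb (k + 1)
    push_cast at *
    rw [show x + (k + 1) * α - α = x + k * α by ring, show y + (k + 1) * α - α = y + k * α by ring] at this
    linarith
  have hconst : ∀ k : ℤ, G s (x + k * α) - G s' (y + k * α) = G s x - G s' y := by
    intro k
    induction k using Int.induction_on with
    | zero => simp
    | succ n ih => rw [hstep, ih]
    | pred n ih =>
      have := hstep (-n - 1)
      rw [sub_add_cancel] at this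
      rw [← this, ih]
  have hconst' : ∀ k m k' m' : ℤ, G s (x + (k * α + m)) - G s' (y + (k * α + m)) =
      G s (x + (k' * α + m')) - G s' (y + (k' * α + m')) := by
    intro k m k' m'
    simp only [← add_assoc, G_add]
    linarith [hconst k, hconst k']
  -- values of G on open unit intervals
  have Gv : ∀ (s v : ℝ) (m : ℤ), (s = 0 ∨ s = 1) → (m : ℝ) < v → v < m + 1 → G s v = m := by
    rintro s v m (rfl | rfl) h1 h2
    · rw [G_zero]
      have : ⌈v⌉ = m + 1 := by rw [Int.ceil_eq_iff]; push_cast; constructor <;> linarith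
      omega
    · rw [G_one, Int.floor_eq_iff]; constructor <;> linarith
  rcases hyx.eq_or_lt with he | hlt
  · subst he
    by_cases hg : D.A y < D.B y
    · have hss : s = s' := by
        by_contra hne
        obtain ⟨n, m, hnm⟩ := (D.gap y).1 hg
        obtain ⟨k', m', a1, a2⟩ := dens hα (show -y < -y + 1 by linarith)
        have e := hconst' (-n) (-m) k' m'
        rw [Gv s (y + (k' * α + m')) 0 hs (by push_cast; linarith) (by push_cast; linarith),
          Gv s' (y + (k' * α + m')) 0 hs' (by push_cast; linarith) (by push_cast; linarith)] at e
        have : y + (((-n : ℤ) : ℝ) * α + ((-m : ℤ) : ℝ)) = 0 := by push_cast; linarith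
        rw [this] at e
        rcases hs with rfl | rfl <;> rcases hs' with rfl | rfl <;> simp [G_one, G_zero] at e hne
      rw [hss]
    · have hAB : D.A y = D.B y := le_antisymm (D.AB y) (not_lt.1 hg)
      have : ∀ s, D.F y s = D.B y := fun s => by simp only [F, hAB]; ring
      rw [this, this]
  · exfalso
    obtain ⟨k, m, a1, a2⟩ := dens hα (show -x < -y by linarith)
    obtain ⟨k', m', b1, b2⟩ := dens hα (show -y < -x + 1 by linarith)
    have e := hconst' k m k' m'
    rw [Gv s _ 0 hs (by push_cast; linarith) (by push_cast; linarith),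
      Gv s' _ (-1) hs' (by push_cast; linarith) (by push_cast; linarith),
      Gv s _ 0 hs (by push_cast; linarith) (by push_cast; linarith),
      Gv s' _ 0 hs' (by push_cast; linarith) (by push_cast; linarith)] at e
    norm_num at e

lemma K_td (hα : Irrational α) (h0 : 0 < α) (h1 : α < 1) : IsTotallyDisconnected D.K :=
  fun _t hts ht _x x_in _y y_in =>
    D.J_inj hα h0 h1 (hts x_in) (hts y_in)
      (isTotallyDisconnected_of_totallyDisconnectedSpace (D.J '' D.K) _ (image_mono hts)
        (ht.image D.J (D.J_cont.mono hts)) (mem_image_of_mem _ x_in) (mem_image_of_mem _ y_in))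

end PD
end DJ

/-- On a surface, a `σ₂`-horseshoe of a homeomorphism `f` contains, for every irrational
`α ∈ (0, 1/2)`, a `C⁰` Denjoy sub-system for `f` with rotation number `α`. -/
theorem sigma2_horseshoe_contains_Denjoy_subsystem_on_surface
    {M : Type*} [TopologicalSpace M] [T2Space M]
    (hsurf : ∀ m : M, ∃ U : Set M, IsOpen U ∧ m ∈ U ∧
      ∃ V : Set (ℝ × ℝ), IsOpen V ∧ Nonempty (U ≃ₜ V))
    (f : M → M) (hf : IsHomeomorph f)
    (H : Set M) (k : (ℤ → Fin 2) → M) (hk : Topology.IsEmbedding k)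
    (hrange : Set.range k = H) (hconj : ∀ u, f (k u) = k (shift2 u)) :
    ∀ α : ℝ, Irrational α → 0 < α → α < 1 / 2 →
      ∃ (D : DenjoySystem) (γ : UnitAddCircle → M),
        Continuous γ ∧ Function.Injective γ ∧
        (D.rot : UnitAddCircle) = (α : UnitAddCircle) ∧
        (∀ x ∈ D.K, γ (D.h x) = f (γ x)) ∧
        f '' (γ '' D.K) = γ '' D.K ∧
        γ '' D.K ⊆ H := by
  intro α hα h0 h1
  have hM := DJ.surf_of hsurf
  obtain ⟨M0, m1, m2, m3⟩ := DJ.horseshoe_comp hM f hf k hk.continuous hconj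
  obtain ⟨D⟩ := DJ.exists_PD hα
  have h1' : α < 1 := by linarith
  have htd := D.K_td hα h0 h1'
  have hne : D.K.Nonempty := ⟨_, D.A 0, ⟨0, Or.inl rfl⟩, rfl⟩
  obtain ⟨γ, g1, g2, g3⟩ := DJ.extension hM m1 m2 D.K D.K_closed.isCompact hne htd
    (fun x => k (D.J x)) (hk.continuous.comp (continuousOn_iff_continuous_restrict.1 D.J_cont))
    (fun x y h => Subtype.ext (D.J_inj hα h0 h1' x.2 y.2 (hk.injective h))) (fun x => m3 _)
  have g3' : ∀ x ∈ D.K, γ x = k (D.J x) := fun x hx => g3 ⟨x, hx⟩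
  have hK : ∀ x ∈ D.K, D.h x ∈ D.K := fun x hx => D.K_inv ▸ mem_image_of_mem D.h hx
  have heq : ∀ x ∈ D.K, γ (D.h x) = f (γ x) := fun x hx => by
    rw [g3' _ (hK x hx), g3' x hx, hconj, D.J_h]
  refine ⟨{ h := D.h, K := D.K, lift := D.H 1, lift_mono := D.H_mono 1, lift_cont := D.H_cont 1,
            lift_bij := ⟨(D.H_mono 1).injective, D.H_surj 1⟩, lift_add := D.H_add_one 1,
            lift_proj := fun x => rfl, rot := α, rot_lim := D.rot_lim, rot_irr := hα, K_ne := hne,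
            K_cpt := D.K_closed.isCompact, K_proper := D.K_proper, K_inv := D.K_inv,
            K_perf := D.K_perf hα, K_td := htd, K_min := D.K_min hα }, γ, g1, g2, rfl, heq, ?_, ?_⟩
  · apply subset_antisymm
    · rintro _ ⟨_, ⟨x, hx, rfl⟩, rfl⟩
      exact ⟨D.h x, hK x hx, heq x hx⟩
    · rintro _ ⟨x, hx, rfl⟩
      have hx' : x ∈ D.h '' D.K := by rw [D.K_inv]; exact hx
      obtain ⟨y, hy, rfl⟩ := hx'
      exact ⟨γ y, ⟨y, hy, rfl⟩, (heq y hy).symm⟩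
  · rintro _ ⟨x, hx, rfl⟩
    rw [g3' x hx, ← hrange]
    exact mem_range_self _
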